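/- Let f be a loxodromic automorphism of ℂ², with components f = (f₁, f₂). Then there do not exist holomorphic (entire) functions a, b : ℂ² → ℂ, not both identically zero, such that for every z ∈ ℂ²: b(z)·[a(f(z))·∂f₁/∂x(z) + b(f(z))·∂f₂/∂x(z)] = a(z)·[a(f(z))·∂f₁/∂y(z) + b(f(z))·∂f₂/∂y(z)], where ∂/∂x and ∂/∂y denote the complex partial derivatives with respect to the two coordinates of ℂ². (This identity says that the pullback f*ω of the holomorphic 1-form ω = a dx + b dy satisfies f*ω ∧ ω ≡ 0, i.e., f preserves the singular holomorphic foliation of ℂ² defined by ω; since every global singular holomorphic foliation of ℂ² is defined by such a 1-form, this is the statement that a loxodromic automorphism of ℂ² does not preserve any global singular holomorphic foliation.) -/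

import Mathlib

open Function Set Filter Topology

noncomputable section

/-- A polynomial map of `ℂ²`. -/
def IsPolyMap (F : ℂ × ℂ → ℂ × ℂ) : Prop :=
  ∃ P Q : MvPolynomial (Fin 2) ℂ, ∀ z : ℂ × ℂ,
    F z = (MvPolynomial.eval ![z.1, z.2] P, MvPolynomial.eval ![z.1, z.2] Q)

/-- A polynomial automorphism of `ℂ²`. -/
def IsPolyAuto (F : ℂ × ℂ → ℂ × ℂ) : Prop :=
  IsPolyMap F ∧ ∃ G : ℂ × ℂ → ℂ × ℂ, IsPolyMap G ∧
    (∀ z, G (F z) = z) ∧ (∀ z, F (G z) = z)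

/-- A generalized Hénon map. -/
def IsHenon (h : ℂ × ℂ → ℂ × ℂ) : Prop :=
  ∃ (p : Polynomial ℂ) (a : ℂ), a ≠ 0 ∧ 2 ≤ p.natDegree ∧
    ∀ z : ℂ × ℂ, h z = (Polynomial.eval z.1 p - a * z.2, z.1)

/-- A loxodromic automorphism of `ℂ²`. -/
def IsLoxodromic (f : ℂ × ℂ → ℂ × ℂ) : Prop :=
  IsPolyAuto f ∧
  ∃ (u uinv : ℂ × ℂ → ℂ × ℂ) (hs : List (ℂ × ℂ → ℂ × ℂ)),
    IsPolyAuto u ∧ (∀ z, uinv (u z) = z) ∧ (∀ z, u (uinv z) = z) ∧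
    hs ≠ [] ∧ (∀ h ∈ hs, IsHenon h) ∧
    ∀ z, f z = uinv (hs.foldr (fun h acc => h ∘ acc) id (u z))

/-- The set of points with bounded forward orbit. -/
def Kplus (f : ℂ × ℂ → ℂ × ℂ) : Set (ℂ × ℂ) :=
  {z | ∃ C : ℝ, ∀ n : ℕ, ‖f^[n] z‖ ≤ C}

/-- `lam` is an eigenvalue of the continuous linear map `T`. -/
def IsEigenvalue (T : (ℂ × ℂ) →L[ℂ] ℂ × ℂ) (lam : ℂ) : Prop :=
  ∃ v : ℂ × ℂ, v ≠ 0 ∧ T v = lam • v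

/-- `p` is a saddle periodic point of period `n` with stable multiplier `ls`
and unstable multiplier `lu`. -/
def IsSaddle (f : ℂ × ℂ → ℂ × ℂ) (p : ℂ × ℂ) (n : ℕ) (ls lu : ℂ) : Prop :=
  1 ≤ n ∧ f^[n] p = p ∧
  IsEigenvalue (fderiv ℂ (f^[n]) p) ls ∧ IsEigenvalue (fderiv ℂ (f^[n]) p) lu ∧
  ‖ls‖ < 1 ∧ 1 < ‖lu‖

/-- Coordinatewise complex conjugation `σ(x,y) = (x̄, ȳ)`. -/
def conjMap (z : ℂ × ℂ) : ℂ × ℂ := (starRingEnd ℂ z.1, starRingEnd ℂ z.2)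

/-- The open unit disk in `ℂ`. -/
def unitDisk : Set ℂ := Metric.ball 0 1

/-- `γ` is a transversal to `J⁺`. -/
def IsTransversal (f : ℂ × ℂ → ℂ × ℂ) (γ : ℂ → ℂ × ℂ) : Prop :=
  Set.InjOn γ unitDisk ∧ DifferentiableOn ℂ γ unitDisk ∧
  (∃ z ∈ unitDisk, γ z ∈ Kplus f) ∧ ¬ (∀ z ∈ unitDisk, γ z ∈ Kplus f)

/-- The Julia slice associated to a transversal. -/
def juliaSlice (f : ℂ × ℂ → ℂ × ℂ) (γ : ℂ → ℂ × ℂ) : Set ℂ :=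
  unitDisk ∩ frontier {z | z ∈ unitDisk ∧ γ z ∈ Kplus f}

/-- An unstable parametrization of a saddle periodic point. -/
def IsUnstableParam (f : ℂ × ℂ → ℂ × ℂ) (n : ℕ) (lu : ℂ) (p : ℂ × ℂ) (ψ : ℂ → ℂ × ℂ) : Prop :=
  Function.Injective ψ ∧ Differentiable ℂ ψ ∧ ψ 0 = p ∧
  ∀ ζ : ℂ, f^[n] (ψ ζ) = ψ (lu * ζ)

/-- `S` is contained in a proper real-analytic subvariety of `ℂ²`. -/
def ContainedInProperRealAnalyticSubvariety (S : Set (ℂ × ℂ)) : Prop :=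
  ∃ V : Set (ℂ × ℂ), IsClosed V ∧ V ≠ Set.univ ∧ S ⊆ V ∧
    ∀ x ∈ V, ∃ (U : Set (ℂ × ℂ)) (g : ℂ × ℂ → ℝ),
      IsOpen U ∧ x ∈ U ∧ (∀ y ∈ U, AnalyticAt ℝ g y) ∧
      (∃ y ∈ U, g y ≠ 0) ∧ ∀ y ∈ V ∩ U, g y = 0

set_option linter.all false

noncomputable section


theorem fderiv_apply_eq_deriv {F : Type*} [NormedAddCommGroup F] [NormedSpace ℂ F]
    {φ : F → ℂ} (hφ : Differentiable ℂ φ) (y v : F) :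
    fderiv ℂ φ y v = deriv (fun s : ℂ => φ (y + s • v)) 0 := by
  have h1 : HasDerivAt (fun s : ℂ => y + s • v) v 0 := by
    simpa using ((hasDerivAt_id (0:ℂ)).smul_const v).const_add y
  have h2 : HasFDerivAt φ (fderiv ℂ φ y) (y + (0:ℂ) • v) := by
    simpa using (hφ y).hasFDerivAt
  exact (h2.comp_hasDerivAt (0:ℂ) h1).deriv.symm

theorem differentiable_line {F : Type*} [NormedAddCommGroup F] [NormedSpace ℂ F]
    {φ : F → ℂ} (hφ : Differentiable ℂ φ) (y v : F) :
    Differentiable ℂ (fun s : ℂ => φ (y + s • v)) := by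
  fun_prop

theorem norm_fderiv_le_of_entire {F : Type*} [NormedAddCommGroup F] [NormedSpace ℂ F]
    {φ : F → ℂ} (hφ : Differentiable ℂ φ) (y : F) {B : ℝ} (hB : 0 ≤ B)
    (h : ∀ x, ‖x - y‖ ≤ 1 → ‖φ x‖ ≤ B) : ‖fderiv ℂ φ y‖ ≤ B := by
  refine ContinuousLinearMap.opNorm_le_bound _ hB fun v => ?_
  by_cases hv : v = 0
  · simp [hv]
  have hv' : 0 < ‖v‖ := norm_pos_iff.2 hv
  rw [fderiv_apply_eq_deriv hφ]
  have := Complex.norm_deriv_le_of_forall_mem_sphere_norm_le (c := 0) (R := ‖v‖⁻¹) (C := B)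
    (inv_pos.2 hv') (differentiable_line hφ y v).diffContOnCl (fun s hs => by
      apply h
      rw [add_sub_cancel_left, norm_smul]
      rw [mem_sphere_zero_iff_norm] at hs
      rw [hs, inv_mul_cancel₀ hv'.ne'])
  simpa using this

/-- Directional derivative of an entire function on a complex normed space is entire. -/
theorem differentiable_fderiv_apply_entire {F : Type*} [NormedAddCommGroup F] [NormedSpace ℂ F]
    [FiniteDimensional ℂ F] [ProperSpace F]
    {φ : F → ℂ} (hφ : Differentiable ℂ φ) (v : F) :
    Differentiable ℂ (fun z => fderiv ℂ φ z v) := by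
  have key : ∀ z, fderiv ℂ φ z v = ∫ θ in (0:ℝ)..2 * Real.pi,
      ((2 * Real.pi * Complex.I)⁻¹ * (deriv (circleMap 0 1) θ * ((circleMap 0 1 θ) ^ 2)⁻¹)) •
        φ (z + circleMap 0 1 θ • v) := by
    intro z
    rw [fderiv_apply_eq_deriv hφ, ← Complex.cderiv_eq_deriv isOpen_univ
      (differentiable_line hφ z v).differentiableOn one_pos (subset_univ _)]
    simp only [Complex.cderiv, circleIntegral, sub_zero, smul_eq_mul,
      ← intervalIntegral.integral_const_mul, mul_assoc]
  simp_rw [key]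
  intro z₀
  obtain ⟨B, hB⟩ := (isCompact_closedBall z₀ (2 + ‖v‖)).exists_bound_of_continuousOn
    hφ.continuous.continuousOn
  have hB0 : 0 ≤ B := (norm_nonneg _).trans (hB z₀ (by simp; positivity))
  have hcirc : ∀ θ, ‖circleMap 0 1 θ‖ = 1 := by intro θ; simp
  have hk : Continuous fun θ : ℝ => ((2 * Real.pi * Complex.I)⁻¹ *
      (deriv (circleMap 0 1) θ * ((circleMap 0 1 θ) ^ 2)⁻¹) : ℂ) := by
    simp only [deriv_circleMap]
    have : Continuous fun θ : ℝ => ((circleMap 0 1 θ) ^ 2)⁻¹ :=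
      ((continuous_circleMap 0 1).pow 2).inv₀ (fun θ => by
        have := hcirc θ
        intro h
        replace h : circleMap 0 1 θ ^ 2 = 0 := h
        rw [pow_eq_zero_iff two_ne_zero] at h
        rw [h] at this; simp at this)
    fun_prop
  set k : ℝ → ℂ := fun θ : ℝ => ((2 * Real.pi * Complex.I)⁻¹ *
      (deriv (circleMap 0 1) θ * ((circleMap 0 1 θ) ^ 2)⁻¹) : ℂ) with hkdef
  have hcont : ∀ z, Continuous fun θ => k θ • φ (z + circleMap 0 1 θ • v) := fun z =>
    hk.smul (hφ.continuous.comp (by fun_prop))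
  letI : MeasurableSpace F := borel F
  haveI : BorelSpace F := ⟨rfl⟩
  refine (intervalIntegral.hasFDerivAt_integral_of_dominated_of_fderiv_le (𝕜 := ℂ)
    (F' := fun z θ => k θ • fderiv ℂ φ (z + circleMap 0 1 θ • v))
    (bound := fun θ => ‖k θ‖ * B)
    (Metric.ball_mem_nhds z₀ one_pos) (Eventually.of_forall fun z =>
      (hcont z).aestronglyMeasurable) ((hcont z₀).intervalIntegrable _ _) ?_ ?_
      (Continuous.intervalIntegrable (by fun_prop) _ _) ?_).differentiableAt
  · refine hk.aestronglyMeasurable.smul ?_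
    haveI : FiniteDimensional ℂ (F →L[ℂ] ℂ) := inferInstance
    haveI : ProperSpace (F →L[ℂ] ℂ) := FiniteDimensional.proper ℂ _
    exact ((measurable_fderiv ℂ φ).comp (by
      have : Continuous fun θ : ℝ => z₀ + circleMap 0 1 θ • v := by fun_prop
      exact this.measurable)).aestronglyMeasurable
  · refine Eventually.of_forall fun θ _ z hz => ?_
    rw [norm_smul]
    refine mul_le_mul_of_nonneg_left ?_ (norm_nonneg _)
    refine norm_fderiv_le_of_entire hφ _ hB0 fun x hx => hB _ ?_
    rw [mem_closedBall_iff_norm]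
    rw [mem_ball_iff_norm] at hz
    calc ‖x - z₀‖ = ‖(x - (z + circleMap 0 1 θ • v)) + (z - z₀) + circleMap 0 1 θ • v‖ := by
          congr 1; abel
      _ ≤ 1 + 1 + ‖v‖ := by
          refine (norm_add_le _ _).trans (add_le_add ((norm_add_le _ _).trans
            (add_le_add hx hz.le)) ?_)
          rw [norm_smul, hcirc, one_mul]
      _ = _ := by ring
  · refine Eventually.of_forall fun θ _ z hz => ?_
    have h1 : HasFDerivAt (fun z => z + circleMap 0 1 θ • v) (ContinuousLinearMap.id ℂ F) z :=
      (hasFDerivAt_id z).add_const _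
    have h2 := (hφ (z + circleMap 0 1 θ • v)).hasFDerivAt.comp z h1
    rw [ContinuousLinearMap.comp_id] at h2
    exact h2.const_smul (k θ)

theorem contDiff_of_entire {F : Type*} [NormedAddCommGroup F] [NormedSpace ℂ F]
    [FiniteDimensional ℂ F] [ProperSpace F]
    {φ : F → ℂ} (hφ : Differentiable ℂ φ) : ContDiff ℂ (⊤ : ℕ∞) φ := by
  rw [contDiff_infty]
  intro n
  induction n generalizing φ with
  | zero => exact contDiff_zero.2 hφ.continuous
  | succ n ih =>
    rw [Nat.cast_add, Nat.cast_one, contDiff_succ_iff_fderiv_apply]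
    exact ⟨hφ, by simp, fun y => ih (differentiable_fderiv_apply_entire hφ y)⟩
end

noncomputable section


section Wirtinger

variable {F : Type*} [NormedAddCommGroup F] [NormedSpace ℂ F] [NormedSpace ℝ F]
  [IsScalarTower ℝ ℂ F]

/-- General Wirtinger operator. -/
def Wi (s : ℂ) (v : F) (u : F → ℂ) (e : F) : ℂ :=
  (1 / 2) * (fderiv ℝ u e v + s * fderiv ℝ u e (Complex.I • v))

/-- holomorphic derivative -/
abbrev wd (v : F) (u : F → ℂ) : F → ℂ := Wi (-Complex.I) v u

/-- antiholomorphic derivative -/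
abbrev wb (v : F) (u : F → ℂ) : F → ℂ := Wi Complex.I v u

/-- Smooth functions. -/
abbrev Sm (u : F → ℂ) : Prop := ContDiff ℝ (⊤ : ℕ∞) u

theorem Sm.diff {u : F → ℂ} (hu : Sm u) : Differentiable ℝ u :=
  hu.differentiable (by simp)

theorem Wi_congr {s : ℂ} {v : F} {u u' : F → ℂ} (h : u = u') : Wi s v u = Wi s v u' := by rw [h]

theorem Wi_add (s : ℂ) (v : F) {u u' : F → ℂ} {e : F} (hu : DifferentiableAt ℝ u e)
    (hu' : DifferentiableAt ℝ u' e) :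
    Wi s v (fun e => u e + u' e) e = Wi s v u e + Wi s v u' e := by
  simp only [Wi]
  rw [fderiv_fun_add hu hu']
  simp only [ContinuousLinearMap.add_apply]; ring

theorem Wi_sub (s : ℂ) (v : F) {u u' : F → ℂ} {e : F} (hu : DifferentiableAt ℝ u e)
    (hu' : DifferentiableAt ℝ u' e) :
    Wi s v (fun e => u e - u' e) e = Wi s v u e - Wi s v u' e := by
  simp only [Wi]
  rw [fderiv_fun_sub hu hu']
  simp only [ContinuousLinearMap.sub_apply]; ring

theorem Wi_mul (s : ℂ) (v : F) {u u' : F → ℂ} {e : F} (hu : DifferentiableAt ℝ u e)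
    (hu' : DifferentiableAt ℝ u' e) :
    Wi s v (fun e => u e * u' e) e = Wi s v u e * u' e + u e * Wi s v u' e := by
  simp only [Wi]
  rw [fderiv_fun_mul hu hu']
  simp only [ContinuousLinearMap.add_apply, ContinuousLinearMap.smul_apply, smul_eq_mul]; ring

theorem Wi_const (s : ℂ) (v : F) (c : ℂ) (e : F) : Wi s v (fun _ => c) e = 0 := by
  simp [Wi]

theorem Wi_const_mul (s : ℂ) (v : F) (c : ℂ) {u : F → ℂ} {e : F} (hu : DifferentiableAt ℝ u e) :
    Wi s v (fun e => c * u e) e = c * Wi s v u e := by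
  rw [Wi_mul s v (differentiableAt_const c) hu, Wi_const]; ring

theorem Wi_sum {ι : Type*} (s : ℂ) (v : F) (t : Finset ι) {u : ι → F → ℂ} {e : F}
    (hu : ∀ i ∈ t, DifferentiableAt ℝ (u i) e) :
    Wi s v (fun e => ∑ i ∈ t, u i e) e = ∑ i ∈ t, Wi s v (u i) e := by
  simp only [Wi]
  rw [fderiv_fun_sum hu]
  simp only [ContinuousLinearMap.sum_apply, Finset.mul_sum, ← Finset.sum_add_distrib]

theorem Sm.W {u : F → ℂ} (hu : Sm u) (s : ℂ) (v : F) : Sm (Wi s v u) := by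
  have h1 : ∀ w : F, Sm (fun e => fderiv ℝ u e w) := fun w =>
    (hu.fderiv_right (m := (⊤ : ℕ∞)) (by simp)).clm_apply contDiff_const
  exact contDiff_const.mul ((h1 v).add (contDiff_const.mul (h1 _)))

theorem fderiv_fderiv_comm {u : F → ℂ} (hu : Sm u) (v w e : F) :
    fderiv ℝ (fun e => fderiv ℝ u e w) e v = fderiv ℝ (fun e => fderiv ℝ u e v) e w := by
  have h1 : DifferentiableAt ℝ (fderiv ℝ u) e :=
    ((hu.fderiv_right (m := (⊤ : ℕ∞)) (by simp)).differentiable (by simp)) e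
  have h2 : ∀ w v : F, fderiv ℝ (fun e => fderiv ℝ u e w) e v = fderiv ℝ (fderiv ℝ u) e v w := by
    intro w v
    rw [fderiv_clm_apply h1 (differentiableAt_const w)]
    simp
  rw [h2, h2]
  have := (hu.contDiffAt (x := e)).isSymmSndFDerivAt (by
    simp only [minSmoothness_of_isRCLikeNormedField]; exact WithTop.coe_le_coe.2 (le_top : (2 : ℕ∞) ≤ ⊤))
  exact this v w

theorem Wi_comm {u : F → ℂ} (hu : Sm u) (s t : ℂ) (v w : F) :
    Wi s v (Wi t w u) = Wi t w (Wi s v u) := by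
  have h1 : ∀ w : F, Differentiable ℝ (fun e => fderiv ℝ u e w) := fun w =>
    Sm.diff ((hu.fderiv_right (m := (⊤ : ℕ∞)) (by simp)).clm_apply contDiff_const)
  have h3 : ∀ t (w : F) e x, fderiv ℝ (Wi t w u) e x = (1/2) * (fderiv ℝ (fun e => fderiv ℝ u e w) e x
      + t * fderiv ℝ (fun e => fderiv ℝ u e (Complex.I • w)) e x) := by
    intro t w e x
    have : Wi t w u = fun e => (1/2) * (fderiv ℝ u e w + t * fderiv ℝ u e (Complex.I • w)) := rfl
    rw [this, fderiv_const_mul ((h1 w e).fun_add ((h1 _ e).const_mul t)),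
      fderiv_fun_add (h1 w e) ((h1 _ e).const_mul t), fderiv_const_mul (h1 _ e)]
    simp; ring
  funext e
  conv_lhs => rw [Wi]
  conv_rhs => rw [Wi]
  simp only [h3]
  rw [fderiv_fderiv_comm hu v w, fderiv_fderiv_comm hu v (Complex.I • w),
    fderiv_fderiv_comm hu (Complex.I • v) w, fderiv_fderiv_comm hu (Complex.I • v) (Complex.I • w)]
  ring

theorem wd_holo {h : F → ℂ} {e : F} (hh : DifferentiableAt ℂ h e) (v : F) :
    wd v h e = fderiv ℂ h e v := by
  simp only [wd, Wi]
  rw [hh.fderiv_restrictScalars ℝ]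
  simp only [ContinuousLinearMap.coe_restrictScalars', map_smul, smul_eq_mul]
  linear_combination (-1/2 * fderiv ℂ h e v) * Complex.I_mul_I

theorem wb_holo {h : F → ℂ} {e : F} (hh : DifferentiableAt ℂ h e) (v : F) :
    wb v h e = 0 := by
  simp only [wb, Wi]
  rw [hh.fderiv_restrictScalars ℝ]
  simp only [ContinuousLinearMap.coe_restrictScalars', map_smul, smul_eq_mul]
  linear_combination (1/2 * fderiv ℂ h e v) * Complex.I_mul_I

theorem fderiv_conj {u : F → ℂ} {e : F} (hu : DifferentiableAt ℝ u e) (v : F) :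
    fderiv ℝ (fun e => (starRingEnd ℂ) (u e)) e v = (starRingEnd ℂ) (fderiv ℝ u e v) := by
  have := (Complex.conjCLE.toContinuousLinearMap.hasFDerivAt (x := u e)).comp e hu.hasFDerivAt
  have h2 : HasFDerivAt (fun e => (starRingEnd ℂ) (u e)) _ e := this
  rw [h2.fderiv]; simp

theorem wb_conj {u : F → ℂ} {e : F} (hu : DifferentiableAt ℝ u e) (v : F) :
    wb v (fun e => (starRingEnd ℂ) (u e)) e = (starRingEnd ℂ) (wd v u e) := by
  simp only [wb, wd, Wi]
  rw [fderiv_conj hu, fderiv_conj hu]; simp [Complex.conj_ofNat]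

theorem wd_conj {u : F → ℂ} {e : F} (hu : DifferentiableAt ℝ u e) (v : F) :
    wd v (fun e => (starRingEnd ℂ) (u e)) e = (starRingEnd ℂ) (wb v u e) := by
  simp only [wb, wd, Wi]
  rw [fderiv_conj hu, fderiv_conj hu]; simp [Complex.conj_ofNat]

theorem Sm.conj {u : F → ℂ} (hu : Sm u) : Sm (fun e => (starRingEnd ℂ) (u e)) :=
  Complex.conjCLE.contDiff.comp hu

theorem Wi_real_comp (s : ℂ) (v : F) {S : F → ℝ} {φ : ℝ → ℝ} {φ' : ℝ} {e : F}
    (hS : DifferentiableAt ℝ S e) (hφ : HasDerivAt φ φ' (S e)) :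
    Wi s v (fun e => ((φ (S e) : ℝ) : ℂ)) e = φ' * Wi s v (fun e => ((S e : ℝ) : ℂ)) e := by
  have h1 : HasFDerivAt (fun e => ((S e : ℝ) : ℂ)) (Complex.ofRealCLM ∘L fderiv ℝ S e) e :=
    (Complex.ofRealCLM.hasFDerivAt (x := S e)).comp e hS.hasFDerivAt
  have h2 : HasFDerivAt (fun e => ((φ (S e) : ℝ) : ℂ)) (Complex.ofRealCLM ∘L (φ' • fderiv ℝ S e)) e :=
    (Complex.ofRealCLM.hasFDerivAt (x := φ (S e))).comp e (hφ.comp_hasFDerivAt e hS.hasFDerivAt)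
  simp only [Wi, h1.fderiv, h2.fderiv]
  simp; ring

theorem wd_dir_add (u : F → ℂ) (s : ℂ) (v w e : F) : Wi s (v + w) u e = Wi s v u e + Wi s w u e := by
  simp only [Wi, smul_add, map_add]; ring

theorem fderiv_complex_dir (u : F → ℂ) (c : ℂ) (v e : F) :
    fderiv ℝ u e (c • v) = c.re * fderiv ℝ u e v + c.im * fderiv ℝ u e (Complex.I • v) := by
  have : c • v = c.re • v + c.im • (Complex.I • v) := by
    rw [← algebraMap_smul ℂ c.re v, ← algebraMap_smul ℂ c.im (Complex.I • v), smul_smul, ← add_smul]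
    simp
  rw [this, map_add, map_smul, map_smul]; simp

theorem wd_dir_smul (u : F → ℂ) (c : ℂ) (v e : F) : wd (c • v) u e = c * wd v u e := by
  simp only [wd, Wi, smul_smul]
  rw [fderiv_complex_dir u c, fderiv_complex_dir u (Complex.I * c)]
  have := Complex.re_add_im c
  simp
  linear_combination (c.im * fderiv ℝ u e (Complex.I • v)/2) * Complex.I_mul_I +
    (fderiv ℝ u e v / 2 - Complex.I * fderiv ℝ u e (Complex.I • v) / 2) * this

theorem wb_dir_smul (u : F → ℂ) (c : ℂ) (v e : F) :
    wb (c • v) u e = (starRingEnd ℂ) c * wb v u e := by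
  simp only [wb, Wi, smul_smul]
  rw [fderiv_complex_dir u c, fderiv_complex_dir u (Complex.I * c)]
  have : (c.re : ℂ) - c.im * Complex.I = (starRingEnd ℂ) c := by
    apply Complex.ext <;> simp
  simp
  linear_combination (c.im * fderiv ℝ u e (Complex.I • v)/2) * Complex.I_mul_I +
    (fderiv ℝ u e v / 2 + Complex.I * fderiv ℝ u e (Complex.I • v) / 2) * this

end Wirtinger
end

noncomputable section


theorem integral_comb4 {α : Type*} [MeasurableSpace α] {μ : MeasureTheory.Measure α}
    {A B C D : α → ℂ} (hA : MeasureTheory.Integrable A μ) (hB : MeasureTheory.Integrable B μ)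
    (hC : MeasureTheory.Integrable C μ) (hD : MeasureTheory.Integrable D μ) :
    ∫ e, (A e + B e - C e - D e) ∂μ =
      (∫ e, A e ∂μ) + (∫ e, B e ∂μ) - (∫ e, C e ∂μ) - ∫ e, D e ∂μ := by
  have h1 := MeasureTheory.integral_add hA hB
  have h2 := MeasureTheory.integral_sub (hA.add hB) hC
  have h3 := MeasureTheory.integral_sub ((hA.add hB).sub hC) hD
  simp only [Pi.add_apply, Pi.sub_apply] at h1 h2 h3
  rw [h3, h2, h1]

section LeviDef

variable {F : Type*} [NormedAddCommGroup F] [NormedSpace ℂ F] [NormedSpace ℝ F]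
  [IsScalarTower ℝ ℂ F]

/-- Levi form coefficient. -/
def Lv (u : F → ℂ) (v w : F) : F → ℂ := wb w (wd v u)

theorem Sm.Lv {u : F → ℂ} (hu : Sm u) (v w : F) : Sm (Lv u v w) := (hu.W _ v).W _ w

theorem hasCompactSupport_Wi {m : F → ℂ} (hm : HasCompactSupport m) (s : ℂ) (v : F) :
    HasCompactSupport (Wi s v m) := by
  have := (hm.fderiv ℝ).comp_left
    (g := fun L : F →L[ℝ] ℂ => (1 / 2) * (L v + s * L (Complex.I • v))) (by simp)
  exact this

theorem Lv_add {u u' : F → ℂ} (hu : Sm u) (hu' : Sm u') (v w e : F) :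
    Lv (fun e => u e + u' e) v w e = Lv u v w e + Lv u' v w e := by
  have : wd v (fun e => u e + u' e) = fun e => wd v u e + wd v u' e := by
    funext e; exact Wi_add _ _ (hu.diff e) (hu'.diff e)
  rw [Lv, this]; exact Wi_add _ _ ((hu.W _ v).diff e) ((hu'.W _ v).diff e)

theorem Lv_sub {u u' : F → ℂ} (hu : Sm u) (hu' : Sm u') (v w e : F) :
    Lv (fun e => u e - u' e) v w e = Lv u v w e - Lv u' v w e := by
  have : wd v (fun e => u e - u' e) = fun e => wd v u e - wd v u' e := by
    funext e; exact Wi_sub _ _ (hu.diff e) (hu'.diff e)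
  rw [Lv, this]; exact Wi_sub _ _ ((hu.W _ v).diff e) ((hu'.W _ v).diff e)

theorem Lv_const_mul (c : ℂ) {u : F → ℂ} (hu : Sm u) (v w e : F) :
    Lv (fun e => c * u e) v w e = c * Lv u v w e := by
  have : wd v (fun e => c * u e) = fun e => c * wd v u e := by
    funext e; exact Wi_const_mul _ _ _ (hu.diff e)
  rw [Lv, this]; exact Wi_const_mul _ _ _ ((hu.W _ v).diff e)

theorem Lv_mul {u u' : F → ℂ} (hu : Sm u) (hu' : Sm u') (v w e : F) :
    Lv (fun e => u e * u' e) v w e = Lv u v w e * u' e + wd v u e * wb w u' e +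
      wb w u e * wd v u' e + u e * Lv u' v w e := by
  have : wd v (fun e => u e * u' e) = fun e => wd v u e * u' e + u e * wd v u' e := by
    funext e; exact Wi_mul _ _ (hu.diff e) (hu'.diff e)
  rw [Lv, this]
  rw [wb, Wi_add _ _ (((hu.W _ v).diff e).fun_mul (hu'.diff e)) ((hu.diff e).fun_mul ((hu'.W _ v).diff e)),
    Wi_mul _ _ ((hu.W _ v).diff e) (hu'.diff e), Wi_mul _ _ (hu.diff e) ((hu'.W _ v).diff e)]
  simp only [Lv, wb, wd]; ring

theorem Lv_T1 {u : F → ℂ} (hu : Sm u) (a c d : F) : wd a (Lv u c d) = wd c (Lv u a d) := by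
  simp only [Lv, wd, wb]
  rw [Wi_comm (hu.W _ c), Wi_comm hu, ← Wi_comm (hu.W _ a)]

theorem Lv_T2 {u : F → ℂ} (hu : Sm u) (b c d : F) : wb b (Lv u c d) = wb d (Lv u c b) := by
  simp only [Lv, wd, wb]
  rw [Wi_comm (hu.W _ c)]

theorem Lv_comm {u : F → ℂ} (hu : Sm u) (v w : F) : wd v (wb w u) = Lv u v w :=
  Wi_comm hu _ _ _ _

theorem Lv_dir_left_add {u : F → ℂ} (hu : Sm u) (v v' w e : F) :
    Lv u (v + v') w e = Lv u v w e + Lv u v' w e := by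
  rw [← Lv_comm hu, ← Lv_comm hu, ← Lv_comm hu]; exact wd_dir_add _ _ _ _ _

theorem Lv_dir_left_smul {u : F → ℂ} (hu : Sm u) (c : ℂ) (v w e : F) :
    Lv u (c • v) w e = c * Lv u v w e := by
  rw [← Lv_comm hu, ← Lv_comm hu]; exact wd_dir_smul _ _ _ _

theorem Lv_dir_right_add (u : F → ℂ) (v w w' e : F) :
    Lv u v (w + w') e = Lv u v w e + Lv u v w' e := wd_dir_add _ _ _ _ _

theorem Lv_dir_right_smul (u : F → ℂ) (c : ℂ) (v w e : F) :
    Lv u v (c • w) e = (starRingEnd ℂ) c * Lv u v w e := wb_dir_smul _ _ _ _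

/-- Levi form of `log`-type compositions. -/
theorem Lv_real_comp {S : F → ℝ} (hS : ContDiff ℝ (⊤ : ℕ∞) S) {φ φ' φ'' : ℝ → ℝ}
    (h1 : ∀ e, HasDerivAt φ (φ' (S e)) (S e)) (h2 : ∀ e, HasDerivAt φ' (φ'' (S e)) (S e))
    (v w e : F) :
    Lv (fun e => ((φ (S e) : ℝ) : ℂ)) v w e =
      φ'' (S e) * (wb w (fun e => ((S e : ℝ) : ℂ)) e * wd v (fun e => ((S e : ℝ) : ℂ)) e)
        + φ' (S e) * Lv (fun e => ((S e : ℝ) : ℂ)) v w e := by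
  have hSd : Differentiable ℝ S := hS.differentiable (by simp)
  have hSc : Sm (fun e => ((S e : ℝ) : ℂ)) := Complex.ofRealCLM.contDiff.comp hS
  have e1 : wd v (fun e => ((φ (S e) : ℝ) : ℂ)) =
      fun e => ((φ' (S e) : ℝ) : ℂ) * wd v (fun e => ((S e : ℝ) : ℂ)) e := by
    funext e; exact Wi_real_comp _ _ (hSd e) (h1 e)
  have hd : DifferentiableAt ℝ (fun e => ((φ' (S e) : ℝ) : ℂ)) e :=
    (Complex.ofRealCLM.differentiableAt (x := φ' (S e))).comp e
      ((h2 e).differentiableAt.comp e (hSd e))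
  rw [Lv, e1, wb, Wi_mul _ _ hd ((hSc.W _ v).diff e), Wi_real_comp _ _ (hSd e) (h2 e)]
  simp only [Lv, wb, wd]; ring

variable [MeasurableSpace F] [BorelSpace F] [FiniteDimensional ℝ F]
  (μ : MeasureTheory.Measure F) [μ.IsAddHaarMeasure]
open MeasureTheory

theorem Wi_ibp {u m : F → ℂ} (hu : Sm u) (hm : Sm m) (hc : HasCompactSupport m) (s : ℂ) (v : F) :
    ∫ e, Wi s v u e * m e ∂μ = -∫ e, u e * Wi s v m e ∂μ := by
  have hc' : ∀ w : F, HasCompactSupport (fun e => fderiv ℝ m e w) := fun w =>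
    (hc.fderiv ℝ).comp_left (g := fun L : F →L[ℝ] ℂ => L w) (by simp)
  have cu : ∀ w : F, Continuous (fun e => fderiv ℝ u e w) := fun w =>
    ((hu.fderiv_right (m := (⊤ : ℕ∞)) (by simp)).clm_apply contDiff_const).continuous
  have cm : ∀ w : F, Continuous (fun e => fderiv ℝ m e w) := fun w =>
    ((hm.fderiv_right (m := (⊤ : ℕ∞)) (by simp)).clm_apply contDiff_const).continuous
  have i1 : ∀ w : F, Integrable (fun e => fderiv ℝ u e w * m e) μ := fun w =>
    ((cu w).mul hm.continuous).integrable_of_hasCompactSupport hc.mul_left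
  have i2 : ∀ w : F, Integrable (fun e => u e * fderiv ℝ m e w) μ := fun w =>
    (hu.continuous.mul (cm w)).integrable_of_hasCompactSupport (hc' w).mul_left
  have key : ∀ w : F, ∫ e, u e * fderiv ℝ m e w ∂μ = -∫ e, fderiv ℝ u e w * m e ∂μ := fun w =>
    integral_mul_fderiv_eq_neg_fderiv_mul_of_integrable (i1 w) (i2 w)
      ((hu.continuous.mul hm.continuous).integrable_of_hasCompactSupport hc.mul_left)
      (fun x _ => hu.diff x) (fun x _ => hm.diff x)
  have e1 : ∀ e, Wi s v u e * m e = (1/2) * (fderiv ℝ u e v * m e) +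
      (s/2) * (fderiv ℝ u e (Complex.I • v) * m e) := fun e => by simp only [Wi]; ring
  have e2 : ∀ e, u e * Wi s v m e = (1/2) * (u e * fderiv ℝ m e v) +
      (s/2) * (u e * fderiv ℝ m e (Complex.I • v)) := fun e => by simp only [Wi]; ring
  simp only [e1, e2]
  rw [integral_add ((i1 _).const_mul _) ((i1 _).const_mul _),
    integral_add ((i2 _).const_mul _) ((i2 _).const_mul _)]
  simp only [integral_const_mul, key]; ring

theorem Lv_ibp {u m : F → ℂ} (hu : Sm u) (hm : Sm m) (hc : HasCompactSupport m) (v w : F) :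
    ∫ e, Lv u v w e * m e ∂μ = ∫ e, u e * Lv m v w e ∂μ := by
  rw [Lv, wb, Wi_ibp μ (hu.W _ v) hm hc, Wi_ibp μ hu (hm.W _ w) (hasCompactSupport_Wi hc _ _),
    neg_neg]
  simp only [← Lv_comm hm]

/-- The polarised Monge-Ampere integration by parts. -/
theorem MA_ibp {u u' m : F → ℂ} (hu : Sm u) (hu' : Sm u') (hm : Sm m) (hc : HasCompactSupport m)
    (a b c d : F) :
    ∫ e, m e * ((Lv u a b e * Lv u c d e - Lv u a d e * Lv u c b e) -
      (Lv u' a b e * Lv u' c d e - Lv u' a d e * Lv u' c b e)) ∂μ =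
    (1/2) * ∫ e, (u e - u' e) * (Lv m a b e * (Lv u c d e + Lv u' c d e)
      + Lv m c d e * (Lv u a b e + Lv u' a b e) - Lv m a d e * (Lv u c b e + Lv u' c b e)
      - Lv m c b e * (Lv u a d e + Lv u' a d e)) ∂μ := by
  set φ : F → ℂ := fun e => u e - u' e with hφ
  set sg : F → ℂ := fun e => u e + u' e with hsg
  have sφ : Sm φ := hu.sub hu'
  have ssg : Sm sg := hu.add hu'
  have eφ : ∀ v w e, Lv u v w e - Lv u' v w e = Lv φ v w e := fun v w e => (Lv_sub hu hu' v w e).symm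
  have esg : ∀ v w e, Lv u v w e + Lv u' v w e = Lv sg v w e := fun v w e => (Lv_add hu hu' v w e).symm
  simp only [esg]
  have e1 : ∀ e, m e * ((Lv u a b e * Lv u c d e - Lv u a d e * Lv u c b e) -
      (Lv u' a b e * Lv u' c d e - Lv u' a d e * Lv u' c b e)) =
      (1/2) * (Lv φ a b e * (Lv sg c d e * m e) + Lv φ c d e * (Lv sg a b e * m e)
       - Lv φ a d e * (Lv sg c b e * m e) - Lv φ c b e * (Lv sg a d e * m e)) := by
    intro e; simp only [← eφ, ← esg]; ring
  simp only [e1]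
  rw [integral_const_mul]
  congr 1
  have sP : ∀ v w, Sm (fun e => Lv sg v w e * m e) := fun v w => (ssg.Lv v w).mul hm
  have cP : ∀ v w, HasCompactSupport (fun e => Lv sg v w e * m e) := fun v w => hc.mul_left
  have int1 : ∀ v w v' w', Integrable (fun e => Lv φ v w e * (Lv sg v' w' e * m e)) μ :=
    fun v w v' w' => ((sφ.Lv v w).continuous.mul (sP v' w').continuous).integrable_of_hasCompactSupport
      (cP v' w').mul_left
  have int2 : ∀ v w v' w', Integrable (fun e => φ e * Lv (fun e => Lv sg v w e * m e) v' w' e) μ :=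
    fun v w v' w' => (sφ.continuous.mul ((sP v w).Lv v' w').continuous).integrable_of_hasCompactSupport
      (hasCompactSupport_Wi (hasCompactSupport_Wi (cP v w) _ _) _ _).mul_left
  rw [integral_comb4 (int1 _ _ _ _) (int1 _ _ _ _) (int1 _ _ _ _) (int1 _ _ _ _)]
  rw [Lv_ibp μ sφ (sP _ _) (cP _ _), Lv_ibp μ sφ (sP _ _) (cP _ _), Lv_ibp μ sφ (sP _ _) (cP _ _),
    Lv_ibp μ sφ (sP _ _) (cP _ _)]
  rw [← integral_comb4 (int2 _ _ _ _) (int2 _ _ _ _) (int2 _ _ _ _) (int2 _ _ _ _)]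
  congr 1
  funext e
  simp only [Lv_mul (ssg.Lv _ _) hm]
  have q4 : Lv (Lv sg a d) c b = Lv (Lv sg c d) a b :=
    congrArg (wb b) (Lv_T1 ssg c a d)
  have q2 : Lv (Lv sg a b) c d = Lv (Lv sg c d) a b := by
    rw [← Lv_comm (ssg.Lv _ _), Lv_T2 ssg d a b, Lv_comm (ssg.Lv _ _), q4]
  have q3 : Lv (Lv sg c b) a d = Lv (Lv sg c d) a b := by
    rw [← Lv_comm (ssg.Lv _ _), Lv_T2 ssg d c b, Lv_comm (ssg.Lv _ _)]
  rw [q2, q3, q4, Lv_T1 ssg a c d, Lv_T1 ssg c a b, Lv_T2 ssg d a b, Lv_T2 ssg d c b]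
  ring

end LeviDef
end

noncomputable section


section LogForms

variable {F : Type*} [NormedAddCommGroup F] [NormedSpace ℂ F] [NormedSpace ℝ F]
  [IsScalarTower ℝ ℂ F] [FiniteDimensional ℂ F] [ProperSpace F]

theorem sm_of_entire {h : F → ℂ} (hh : Differentiable ℂ h) : Sm h :=
  (contDiff_of_entire hh).restrict_scalars ℝ

/-- `s + |h₁|² + |h₂|²` -/
def SS (s : ℝ) (h₁ h₂ : F → ℂ) (e : F) : ℝ := s + ‖h₁ e‖ ^ 2 + ‖h₂ e‖ ^ 2

theorem SS_pos {s : ℝ} (hs : 0 < s) (h₁ h₂ : F → ℂ) (e : F) : 0 < SS s h₁ h₂ e := by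
  unfold SS; positivity

theorem SS_coe (s : ℝ) (h₁ h₂ : F → ℂ) (e : F) : ((SS s h₁ h₂ e : ℝ) : ℂ) =
    s + h₁ e * (starRingEnd ℂ) (h₁ e) + h₂ e * (starRingEnd ℂ) (h₂ e) := by
  simp [SS, Complex.mul_conj, Complex.normSq_eq_norm_sq]

theorem SS_smooth (s : ℝ) {h₁ h₂ : F → ℂ} (d₁ : Differentiable ℂ h₁) (d₂ : Differentiable ℂ h₂) :
    ContDiff ℝ (⊤ : ℕ∞) (SS s h₁ h₂) :=
  (contDiff_const.add ((sm_of_entire d₁).norm_sq ℝ)).add ((sm_of_entire d₂).norm_sq ℝ)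

theorem wd_mul_conj {h : F → ℂ} (d : Differentiable ℂ h) (v e : F) :
    wd v (fun e => h e * (starRingEnd ℂ) (h e)) e = fderiv ℂ h e v * (starRingEnd ℂ) (h e) := by
  have sh := sm_of_entire d
  rw [wd, Wi_mul _ _ (sh.diff e) (sh.conj.diff e)]
  have := wd_conj (sh.diff e) v
  rw [wb_holo (d e)] at this
  rw [wd] at this
  rw [this]
  have := wd_holo (d e) v
  rw [wd] at this
  rw [this]; simp

theorem wb_mul_conj {h : F → ℂ} (d : Differentiable ℂ h) (v e : F) :
    wb v (fun e => h e * (starRingEnd ℂ) (h e)) e = h e * (starRingEnd ℂ) (fderiv ℂ h e v) := by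
  have sh := sm_of_entire d
  rw [wb, Wi_mul _ _ (sh.diff e) (sh.conj.diff e)]
  have := wb_conj (sh.diff e) v
  rw [wd_holo (d e)] at this
  rw [wb] at this
  rw [this]
  have := wb_holo (d e) v
  rw [wb] at this
  rw [this]; simp

theorem Lv_mul_conj {h : F → ℂ} (d : Differentiable ℂ h) (v w e : F) :
    Lv (fun e => h e * (starRingEnd ℂ) (h e)) v w e =
      fderiv ℂ h e v * (starRingEnd ℂ) (fderiv ℂ h e w) := by
  have sh := sm_of_entire d
  have e1 : wd v (fun e => h e * (starRingEnd ℂ) (h e)) =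
    fun e => fderiv ℂ h e v * (starRingEnd ℂ) (h e) := funext fun e => wd_mul_conj d v e
  have d' := differentiable_fderiv_apply_entire d v
  rw [Lv, e1, wb, Wi_mul _ _ ((sm_of_entire d').diff e) (sh.conj.diff e)]
  have := wb_conj (sh.diff e) w
  rw [wd_holo (d e)] at this
  rw [wb] at this
  rw [this]
  have := wb_holo (d' e) w
  rw [wb] at this
  rw [this]; simp

theorem SS_fun_eq (s : ℝ) (h₁ h₂ : F → ℂ) : (fun e => ((SS s h₁ h₂ e : ℝ) : ℂ)) =
    fun e => (fun e => (s : ℂ) + h₁ e * (starRingEnd ℂ) (h₁ e)) e + h₂ e * (starRingEnd ℂ) (h₂ e) :=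
  funext fun e => SS_coe s h₁ h₂ e

theorem Wi_SS (σ : ℂ) (s : ℝ) {h₁ h₂ : F → ℂ} (d₁ : Differentiable ℂ h₁) (d₂ : Differentiable ℂ h₂)
    (v e : F) : Wi σ v (fun e => ((SS s h₁ h₂ e : ℝ) : ℂ)) e =
      Wi σ v (fun e => h₁ e * (starRingEnd ℂ) (h₁ e)) e +
      Wi σ v (fun e => h₂ e * (starRingEnd ℂ) (h₂ e)) e := by
  have s1 := sm_of_entire d₁
  have s2 := sm_of_entire d₂
  rw [SS_fun_eq, Wi_add _ _ (Sm.diff (contDiff_const.add (s1.mul s1.conj)) e)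
    (Sm.diff (s2.mul s2.conj) e),
    Wi_add _ _ (differentiableAt_const _) (Sm.diff (s1.mul s1.conj) e), Wi_const, zero_add]

theorem Lv_SS (s : ℝ) {h₁ h₂ : F → ℂ} (d₁ : Differentiable ℂ h₁) (d₂ : Differentiable ℂ h₂)
    (v w e : F) : Lv (fun e => ((SS s h₁ h₂ e : ℝ) : ℂ)) v w e =
      fderiv ℂ h₁ e v * (starRingEnd ℂ) (fderiv ℂ h₁ e w) +
      fderiv ℂ h₂ e v * (starRingEnd ℂ) (fderiv ℂ h₂ e w) := by
  have s1 := sm_of_entire d₁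
  have s2 := sm_of_entire d₂
  rw [SS_fun_eq, Lv_add (contDiff_const.add (s1.mul s1.conj) : Sm _) (s2.mul s2.conj),
    Lv_add contDiff_const (s1.mul s1.conj), Lv_mul_conj d₁, Lv_mul_conj d₂]
  have : Lv (fun e : F => (s : ℂ)) v w e = 0 := by
    have : wd v (fun e : F => (s : ℂ)) = fun _ => 0 := funext fun e => Wi_const _ _ _ _
    rw [Lv, this]; exact Wi_const _ _ _ _
  rw [this, zero_add]

/-- `log (s + |h₁|² + |h₂|²)` -/
def LS (s : ℝ) (h₁ h₂ : F → ℂ) (e : F) : ℂ := ((Real.log (SS s h₁ h₂ e) : ℝ) : ℂ)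

theorem LS_smooth {s : ℝ} (hs : 0 < s) {h₁ h₂ : F → ℂ} (d₁ : Differentiable ℂ h₁)
    (d₂ : Differentiable ℂ h₂) : Sm (LS s h₁ h₂) :=
  Complex.ofRealCLM.contDiff.comp ((SS_smooth s d₁ d₂).log fun e => (SS_pos hs h₁ h₂ e).ne')

theorem wd_LS {s : ℝ} (hs : 0 < s) {h₁ h₂ : F → ℂ} (d₁ : Differentiable ℂ h₁)
    (d₂ : Differentiable ℂ h₂) (v e : F) : wd v (LS s h₁ h₂) e =
      (fderiv ℂ h₁ e v * (starRingEnd ℂ) (h₁ e) + fderiv ℂ h₂ e v * (starRingEnd ℂ) (h₂ e)) /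
        (SS s h₁ h₂ e) := by
  have := Wi_real_comp (-Complex.I) v ((SS_smooth s d₁ d₂).differentiable (by simp) e)
    (Real.hasDerivAt_log (SS_pos hs h₁ h₂ e).ne')
  rw [wd]
  refine this.trans ?_
  rw [Wi_SS _ _ d₁ d₂]
  have a1 := wd_mul_conj d₁ v e
  have a2 := wd_mul_conj d₂ v e
  rw [wd] at a1 a2
  rw [a1, a2]; push_cast; rw [div_eq_inv_mul]

theorem Lv_LS {s : ℝ} (hs : 0 < s) {h₁ h₂ : F → ℂ} (d₁ : Differentiable ℂ h₁)
    (d₂ : Differentiable ℂ h₂) (v w e : F) : Lv (LS s h₁ h₂) v w e =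
      (SS s h₁ h₂ e * (fderiv ℂ h₁ e v * (starRingEnd ℂ) (fderiv ℂ h₁ e w) +
        fderiv ℂ h₂ e v * (starRingEnd ℂ) (fderiv ℂ h₂ e w)) -
      (fderiv ℂ h₁ e v * (starRingEnd ℂ) (h₁ e) + fderiv ℂ h₂ e v * (starRingEnd ℂ) (h₂ e)) *
      (h₁ e * (starRingEnd ℂ) (fderiv ℂ h₁ e w) + h₂ e * (starRingEnd ℂ) (fderiv ℂ h₂ e w))) /
      (SS s h₁ h₂ e) ^ 2 := by
  have key := Lv_real_comp (SS_smooth s d₁ d₂) (φ := Real.log) (φ' := fun x => x⁻¹)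
    (φ'' := fun x => -(x ^ 2)⁻¹) (fun e => Real.hasDerivAt_log (SS_pos hs h₁ h₂ e).ne')
    (fun e => hasDerivAt_inv (SS_pos hs h₁ h₂ e).ne') v w e
  refine Eq.trans key ?_
  rw [Lv_SS _ d₁ d₂, wb, wd, Wi_SS _ _ d₁ d₂, Wi_SS _ _ d₁ d₂]
  have a1 := wd_mul_conj d₁ v e
  have a2 := wd_mul_conj d₂ v e
  have b1 := wb_mul_conj d₁ w e
  have b2 := wb_mul_conj d₂ w e
  rw [wd] at a1 a2
  rw [wb] at b1 b2
  rw [a1, a2, b1, b2]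
  have : ((SS s h₁ h₂ e : ℝ) : ℂ) ≠ 0 := by exact_mod_cast (SS_pos hs h₁ h₂ e).ne'
  push_cast
  field_simp
  ring

/-- Cubic kernel. -/
def LC (h : F → ℂ) (e : F) : ℂ :=
  ((Real.log (SS 1 h (fun _ => 0) e) - (SS 1 h (fun _ => 0) e)⁻¹ : ℝ) : ℂ)

theorem LC_smooth {h : F → ℂ} (d : Differentiable ℂ h) : Sm (LC h) := by
  have h0 : Differentiable ℂ (fun _ : F => (0:ℂ)) := differentiable_const _
  exact Complex.ofRealCLM.contDiff.comp
    (((SS_smooth 1 d h0).log fun e => (SS_pos one_pos h _ e).ne').sub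
      ((SS_smooth 1 d h0).inv fun e => (SS_pos one_pos h _ e).ne'))

theorem Lv_LC {h : F → ℂ} (d : Differentiable ℂ h) (v w e : F) : Lv (LC h) v w e =
    2 * (fderiv ℂ h e v * (starRingEnd ℂ) (fderiv ℂ h e w)) / (SS 1 h (fun _ => 0) e) ^ 3 := by
  have h0 : Differentiable ℂ (fun _ : F => (0:ℂ)) := differentiable_const _
  have hp := SS_pos one_pos h (fun _ : F => (0:ℂ))
  have key := Lv_real_comp (SS_smooth 1 d h0) (φ := fun x => Real.log x - x⁻¹)
    (φ' := fun x => x⁻¹ - (- (x ^ 2)⁻¹))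
    (φ'' := fun x => -(x ^ 2)⁻¹ - 2 * (x ^ 3)⁻¹)
    (fun e => (Real.hasDerivAt_log (hp e).ne').sub (hasDerivAt_inv (hp e).ne'))
    (fun e => by
      have h1 := hasDerivAt_inv (hp e).ne'
      have h2 := ((hasDerivAt_pow 2 (SS 1 h (fun _ => 0) e)).inv (pow_pos (hp e) 2).ne').neg
      refine (h1.sub h2).congr_deriv ?_
      have := (hp e).ne'
      field_simp; ring) v w e
  refine Eq.trans key ?_
  rw [Lv_SS _ d h0, wb, wd, Wi_SS _ _ d h0, Wi_SS _ _ d h0]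
  have a1 := wd_mul_conj d v e
  have b1 := wb_mul_conj d w e
  rw [wd] at a1
  rw [wb] at b1
  rw [a1, b1]
  have h3 : ((SS 1 h (fun _ => 0) e : ℝ) : ℂ) ≠ 0 := by exact_mod_cast (hp e).ne'
  have h4 := SS_coe 1 h (fun _ => 0) e
  simp only [zero_mul, Wi_const, fderiv_fun_const, Pi.zero_apply, ContinuousLinearMap.zero_apply, add_zero]
  push_cast at h4 ⊢
  have h5 : h e * (starRingEnd ℂ) (h e) = ((SS 1 h (fun _ => 0) e : ℝ) : ℂ) - 1 := by
    rw [h4]; simp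
  generalize ((SS 1 h (fun _ => 0) e : ℝ) : ℂ) = S at *
  field_simp
  linear_combination (-(S+2) * (fderiv ℂ h e v) * (starRingEnd ℂ) (fderiv ℂ h e w)) * h5

theorem Lv_LS_one {h : F → ℂ} (d : Differentiable ℂ h) (v w e : F) :
    Lv (LS 1 h (fun _ => 0)) v w e =
    (fderiv ℂ h e v * (starRingEnd ℂ) (fderiv ℂ h e w)) / (SS 1 h (fun _ => 0) e) ^ 2 := by
  have h0 : Differentiable ℂ (fun _ : F => (0:ℂ)) := differentiable_const _
  rw [Lv_LS one_pos d h0, SS_coe]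
  simp; ring

theorem Lv_LS_det {s : ℝ} (hs : 0 < s) {h₁ h₂ : F → ℂ} (d₁ : Differentiable ℂ h₁)
    (d₂ : Differentiable ℂ h₂) (v w e : F) :
    Lv (LS s h₁ h₂) v v e * Lv (LS s h₁ h₂) w w e - Lv (LS s h₁ h₂) v w e * Lv (LS s h₁ h₂) w v e =
      ((s * ‖fderiv ℂ h₁ e v * fderiv ℂ h₂ e w - fderiv ℂ h₂ e v * fderiv ℂ h₁ e w‖ ^ 2 /
        (SS s h₁ h₂ e) ^ 3 : ℝ) : ℂ) := by
  have h3 : ((SS s h₁ h₂ e : ℝ) : ℂ) ≠ 0 := by exact_mod_cast (SS_pos hs h₁ h₂ e).ne'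
  have h4 := SS_coe s h₁ h₂ e
  have nn : ∀ z : ℂ, ((‖z‖ : ℝ) : ℂ) ^ 2 = z * (starRingEnd ℂ) z := fun z => (Complex.mul_conj' z).symm
  simp only [Lv_LS hs d₁ d₂]
  push_cast
  rw [nn]
  simp only [map_sub, map_mul]
  have h5 : (s : ℂ) = SS s h₁ h₂ e - h₁ e * (starRingEnd ℂ) (h₁ e) -
      h₂ e * (starRingEnd ℂ) (h₂ e) := by rw [h4]; ring
  rw [h5]
  generalize ((SS s h₁ h₂ e : ℝ) : ℂ) = S at *
  field_simp
  ring

end LogForms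
end

noncomputable section


section PshSec

variable {F : Type*} [NormedAddCommGroup F] [NormedSpace ℂ F] [NormedSpace ℝ F]
  [IsScalarTower ℝ ℂ F]

/-- Smooth functions with positive Levi form. -/
structure Psh (u : F → ℂ) : Prop where
  sm : Sm u
  herm : ∀ v w e, Lv u w v e = (starRingEnd ℂ) (Lv u v w e)
  nonneg : ∀ v e, 0 ≤ (Lv u v v e).re

theorem Psh.norm_le {u : F → ℂ} (hu : Psh u) (v w e : F) :
    ‖Lv u v w e‖ ≤ (1/2) * ((Lv u v v e).re + (Lv u w w e).re) := by
  set L := Lv u v w e with hL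
  by_cases h0 : L = 0
  · rw [h0, norm_zero]; have := hu.nonneg v e; have := hu.nonneg w e; linarith
  have hn : ‖L‖ ≠ 0 := norm_ne_zero_iff.2 h0
  set c : ℂ := -(L / ‖L‖) with hc
  have h1 := hu.nonneg (v + c • w) e
  rw [Lv_dir_left_add hu.sm, Lv_dir_right_add, Lv_dir_right_add, Lv_dir_right_smul,
    Lv_dir_left_smul hu.sm, Lv_dir_left_smul hu.sm, Lv_dir_right_smul, hu.herm v w e, ← hL] at h1
  have e1 : (starRingEnd ℂ) c * L = -(‖L‖ : ℂ) := by
    have : (starRingEnd ℂ) L * L = (‖L‖ : ℂ) ^ 2 := Complex.conj_mul' L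
    have hn' : (‖L‖ : ℂ) ≠ 0 := by exact_mod_cast hn
    simp only [hc, map_neg, map_div₀, Complex.conj_ofReal]
    field_simp
    linear_combination -this
  have e2 : c * (starRingEnd ℂ) L = -(‖L‖ : ℂ) := by
    have := congrArg (starRingEnd ℂ) e1
    simpa using this
  have e3 : c * ((starRingEnd ℂ) c * Lv u w w e) = Lv u w w e := by
    have : c * (starRingEnd ℂ) c = 1 := by
      rw [Complex.mul_conj']; simp [hc, hn]
    rw [← mul_assoc, this, one_mul]
  rw [e1, e2, e3] at h1
  simp at h1
  linarith

theorem Psh.const_mul {u : F → ℂ} (hu : Psh u) {r : ℝ} (hr : 0 ≤ r) :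
    Psh (fun e => (r : ℂ) * u e) where
  sm := contDiff_const.mul hu.sm
  herm v w e := by rw [Lv_const_mul _ hu.sm, Lv_const_mul _ hu.sm, hu.herm v w]; simp
  nonneg v e := by
    rw [Lv_const_mul _ hu.sm]; simp; exact mul_nonneg hr (hu.nonneg v e)

theorem Psh_LS [FiniteDimensional ℂ F] [ProperSpace F]
    {s : ℝ} (hs : 0 < s) {h₁ h₂ : F → ℂ} (d₁ : Differentiable ℂ h₁)
    (d₂ : Differentiable ℂ h₂) : Psh (LS s h₁ h₂) where
  sm := LS_smooth hs d₁ d₂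
  herm v w e := by
    rw [Lv_LS hs d₁ d₂, Lv_LS hs d₁ d₂]
    simp only [map_div₀, map_sub, map_mul, map_add, map_pow, Complex.conj_conj, Complex.conj_ofReal]
    ring
  nonneg v e := by
    rw [Lv_LS hs d₁ d₂]
    set a := fderiv ℂ h₁ e v
    set b := fderiv ℂ h₂ e v
    have e1 : ((SS s h₁ h₂ e : ℝ) : ℂ) * (a * (starRingEnd ℂ) a + b * (starRingEnd ℂ) b) -
      (a * (starRingEnd ℂ) (h₁ e) + b * (starRingEnd ℂ) (h₂ e)) *
      (h₁ e * (starRingEnd ℂ) a + h₂ e * (starRingEnd ℂ) b) =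
      ((s * (‖a‖ ^ 2 + ‖b‖ ^ 2) + ‖a * h₂ e - b * h₁ e‖ ^ 2 : ℝ) : ℂ) := by
      have nn : ∀ z : ℂ, ((‖z‖ : ℝ) : ℂ) ^ 2 = z * (starRingEnd ℂ) z :=
        fun z => (Complex.mul_conj' z).symm
      push_cast
      rw [nn, nn, nn, SS_coe]
      simp only [map_sub, map_mul]
      ring
    rw [e1]
    norm_cast
    positivity

end PshSec

section MA
open MeasureTheory

variable {F : Type*} [NormedAddCommGroup F] [NormedSpace ℂ F] [NormedSpace ℝ F]
  [IsScalarTower ℝ ℂ F] [MeasurableSpace F] [BorelSpace F] [FiniteDimensional ℝ F]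
  (μ : MeasureTheory.Measure F) [μ.IsAddHaarMeasure]

/-- Smooth cutoff equal to one on the ball of radius `M`. -/
theorem exists_cutoff (F : Type*) [NormedAddCommGroup F] [NormedSpace ℝ F] [FiniteDimensional ℝ F]
    {M : ℝ} (hM : 0 < M) : ∃ χ : F → ℝ, ContDiff ℝ (⊤ : ℕ∞) χ ∧
    HasCompactSupport χ ∧ (∀ e, 0 ≤ χ e) ∧ (∀ e, χ e ≤ 1) ∧ (∀ e, ‖e‖ ≤ M → χ e = 1) ∧
    (∀ e, M + 1 ≤ ‖e‖ → χ e = 0) := by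
  let b : ContDiffBump (0 : F) := ⟨M, M + 1, hM, by linarith⟩
  refine ⟨b, b.contDiff, b.hasCompactSupport, fun e => b.nonneg, fun e => b.le_one, fun e he => ?_, fun e he => ?_⟩
  · exact b.one_of_mem_closedBall (by simpa using he)
  · exact b.zero_of_le_dist (by simpa using he)

theorem exists_ball_of_compactSupport {m : F → ℂ} (hc : HasCompactSupport m) :
    ∃ M : ℝ, 0 < M ∧ ∀ e, M < ‖e‖ → e ∉ tsupport m := by
  obtain ⟨M, hM⟩ := hc.isBounded.subset_closedBall (0 : F)
  refine ⟨max M 1, by positivity, fun e he h => ?_⟩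
  have := hM h
  simp at this
  exact absurd (lt_of_le_of_lt (le_max_left M 1) he) (not_lt.2 this)

theorem Wi_zero_of_notMem {m : F → ℂ} {e : F} (he : e ∉ tsupport m) (s : ℂ) (v : F) :
    Wi s v m e = 0 := by
  have : fderiv ℝ m e = 0 := by
    by_contra h
    exact he (support_fderiv_subset ℝ h)
  simp [Wi, this]

theorem tsupport_Wi_subset (m : F → ℂ) (s : ℂ) (v : F) : tsupport (Wi s v m) ⊆ tsupport m :=
  closure_minimal (fun e he => by by_contra h; exact he (Wi_zero_of_notMem h s v))
    (isClosed_tsupport m)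

theorem Lv_zero_of_notMem {m : F → ℂ} {e : F} (he : e ∉ tsupport m) (v w : F) : Lv m v w e = 0 :=
  Wi_zero_of_notMem (fun h => he (tsupport_Wi_subset _ _ _ h)) _ _

theorem psh_mass_bound {χ : F → ℝ} (hχ : ContDiff ℝ (⊤ : ℕ∞) χ) (hc : HasCompactSupport χ)
    (v : F) {M : ℝ} (hM : ∀ e, M < ‖e‖ → e ∉ tsupport (fun e => ((χ e : ℝ) : ℂ))) :
    ∃ K : ℝ, 0 ≤ K ∧ ∀ u : F → ℂ, Psh u → ∀ B : ℝ, (∀ e, ‖e‖ ≤ M → ‖u e‖ ≤ B) →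
      ∫ e, (Lv u v v e).re * χ e ∂μ ≤ B * K := by
  set χ' : F → ℂ := fun e => ((χ e : ℝ) : ℂ)
  have sχ : Sm χ' := Complex.ofRealCLM.contDiff.comp hχ
  have cχ : HasCompactSupport χ' := hc.comp_left (g := fun x : ℝ => (x : ℂ)) (by simp)
  have cL : HasCompactSupport (Lv χ' v v) := hasCompactSupport_Wi (hasCompactSupport_Wi cχ _ _) _ _
  have iL : Integrable (Lv χ' v v) μ := (sχ.Lv v v).continuous.integrable_of_hasCompactSupport cL
  refine ⟨∫ e, ‖Lv χ' v v e‖ ∂μ, integral_nonneg fun _ => norm_nonneg _, fun u hu B hB => ?_⟩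
  have h1 := Lv_ibp μ hu.sm sχ cχ v v
  have i1 : Integrable (fun e => Lv u v v e * χ' e) μ :=
    ((hu.sm.Lv v v).continuous.mul sχ.continuous).integrable_of_hasCompactSupport cχ.mul_left
  have h2 : ∫ e, (Lv u v v e).re * χ e ∂μ = (∫ e, Lv u v v e * χ' e ∂μ).re := by
    have := integral_re i1
    simp only [RCLike.re_eq_complex_re] at this
    rw [← this]
    congr 1; funext e; simp [χ']
  rw [h2, h1]
  refine (Complex.re_le_norm _).trans ((norm_integral_le_integral_norm _).trans ?_)
  rw [← integral_const_mul]
  refine integral_mono ?_ (iL.norm.const_mul B) ?_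
  · exact ((hu.sm.continuous.mul (sχ.Lv v v).continuous).integrable_of_hasCompactSupport
      cL.mul_left).norm
  · intro e
    simp only [norm_mul]
    by_cases he : ‖e‖ ≤ M
    · exact mul_le_mul_of_nonneg_right (hB e he) (norm_nonneg _)
    · rw [Lv_zero_of_notMem (hM e (not_le.1 he))]; simp

theorem MA_convergence {u u' : ℕ → F → ℂ} (hu : ∀ n, Psh (u n)) (hu' : ∀ n, Psh (u' n))
    (bu : ∀ M : ℝ, ∃ K, ∀ n e, ‖e‖ ≤ M → ‖u n e‖ ≤ K)
    (bu' : ∀ M : ℝ, ∃ K, ∀ n e, ‖e‖ ≤ M → ‖u' n e‖ ≤ K)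
    (hd : ∀ M : ℝ, ∃ δ : ℕ → ℝ, Tendsto δ atTop (𝓝 0) ∧ ∀ n e, ‖e‖ ≤ M → ‖u n e - u' n e‖ ≤ δ n)
    {m : F → ℂ} (hm : Sm m) (hc : HasCompactSupport m) (a b c d : F) :
    Tendsto (fun n => ∫ e, m e * ((Lv (u n) a b e * Lv (u n) c d e - Lv (u n) a d e * Lv (u n) c b e) -
      (Lv (u' n) a b e * Lv (u' n) c d e - Lv (u' n) a d e * Lv (u' n) c b e)) ∂μ) atTop (𝓝 0) := by
  obtain ⟨M, hM0, hM⟩ := exists_ball_of_compactSupport hc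
  obtain ⟨χ, sχ, cχ, χ0, χ1, χone, χzero⟩ := exists_cutoff F hM0
  have hχs : ∀ e, M + 1 < ‖e‖ → e ∉ tsupport (fun e => ((χ e : ℝ) : ℂ)) := by
    intro e he
    rw [notMem_tsupport_iff_eventuallyEq]
    filter_upwards [(isOpen_lt continuous_const continuous_norm).mem_nhds he] with y hy
    simp [χzero y (le_of_lt hy)]
  obtain ⟨K, hK⟩ := bu (M + 1)
  obtain ⟨K', hK'⟩ := bu' (M + 1)
  obtain ⟨δ, hδ, hδ'⟩ := hd M
  have hδ0 : ∀ n, 0 ≤ δ n := fun n => (norm_nonneg _).trans (hδ' n 0 (by simpa using hM0.le))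
  have hmass : ∀ v : F, ∃ B : ℝ, ∀ n, ∫ e, (Lv (u n) v v e).re * χ e ∂μ +
      ∫ e, (Lv (u' n) v v e).re * χ e ∂μ ≤ B := by
    intro v
    obtain ⟨Q, hQ0, hQ⟩ := psh_mass_bound μ sχ cχ v hχs
    exact ⟨K * Q + K' * Q, fun n => add_le_add (hQ _ (hu n) K (hK n)) (hQ _ (hu' n) K' (hK' n))⟩
  choose B hB using hmass
  have hbd : ∀ v w : F, ∃ Q : ℝ, 0 ≤ Q ∧ ∀ e, ‖Lv m v w e‖ ≤ Q := by
    intro v w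
    obtain ⟨Q, hQ⟩ := (hasCompactSupport_Wi (hasCompactSupport_Wi hc (-Complex.I) v)
      Complex.I w).exists_bound_of_continuous (hm.Lv v w).continuous
    exact ⟨Q, (norm_nonneg _).trans (hQ 0), hQ⟩
  choose Q hQ0 hQ using hbd
  set T : F → ℕ → F → ℝ := fun v n e => (Lv (u n) v v e).re * χ e + (Lv (u' n) v v e).re * χ e with hT
  have iT : ∀ v n, Integrable (T v n) μ := by
    intro v n
    have : Continuous (T v n) := by
      have c1 := (Complex.continuous_re.comp ((hu n).sm.Lv v v).continuous)
      have c2 := (Complex.continuous_re.comp ((hu' n).sm.Lv v v).continuous)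
      exact (c1.mul sχ.continuous).add (c2.mul sχ.continuous)
    refine this.integrable_of_hasCompactSupport ?_
    exact (cχ.mul_left (f := fun e => (Lv (u n) v v e).re)).add
      (cχ.mul_left (f := fun e => (Lv (u' n) v v e).re))
  have iT' : ∀ v n, ∫ e, T v n e ∂μ ≤ B v := by
    intro v n
    refine le_trans (le_of_eq ?_) (hB v n)
    refine integral_add ?_ ?_
    · exact ((Complex.continuous_re.comp ((hu n).sm.Lv v v).continuous).mul
        sχ.continuous).integrable_of_hasCompactSupport cχ.mul_left
    · exact ((Complex.continuous_re.comp ((hu' n).sm.Lv v v).continuous).mul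
        sχ.continuous).integrable_of_hasCompactSupport cχ.mul_left
  have T0 : ∀ v n e, 0 ≤ T v n e := fun v n e =>
    add_nonneg (mul_nonneg ((hu n).nonneg v e) (χ0 e)) (mul_nonneg ((hu' n).nonneg v e) (χ0 e))
  set q : ℝ := Q a b + Q c d + Q a d + Q c b with hq
  have hq0 : 0 ≤ q := by have := hQ0; simp only [hq]; linarith [hQ0 a b, hQ0 c d, hQ0 a d, hQ0 c b]
  refine squeeze_zero_norm (a := fun n => δ n * (q * (B a + B b + B c + B d))) (fun n => ?_) ?_
  swap
  · simpa using hδ.mul_const (q * (B a + B b + B c + B d))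
  rw [MA_ibp μ (hu n).sm (hu' n).sm hm hc, norm_mul]
  have hhalf : ‖(1/2 : ℂ)‖ = 1/2 := by simp
  rw [hhalf]
  have hsum : ∀ v w e, ‖e‖ ≤ M → ‖Lv (u n) v w e + Lv (u' n) v w e‖ ≤ T v n e + T w n e := by
    intro v w e he
    refine (norm_add_le _ _).trans ?_
    have h1 := (hu n).norm_le v w e
    have h2 := (hu' n).norm_le v w e
    simp only [hT, χone e he, mul_one]
    linarith [(hu n).nonneg v e, (hu n).nonneg w e, (hu' n).nonneg v e, (hu' n).nonneg w e]
  have hpt : ∀ e, ‖(u n e - u' n e) * (Lv m a b e * (Lv (u n) c d e + Lv (u' n) c d e)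
      + Lv m c d e * (Lv (u n) a b e + Lv (u' n) a b e)
      - Lv m a d e * (Lv (u n) c b e + Lv (u' n) c b e)
      - Lv m c b e * (Lv (u n) a d e + Lv (u' n) a d e))‖ ≤
      δ n * (q * (T a n e + T b n e + T c n e + T d n e)) := by
    intro e
    by_cases he : ‖e‖ ≤ M
    · rw [norm_mul]
      refine mul_le_mul (hδ' n e he) ?_ (norm_nonneg _) (hδ0 n)
      set τ := T a n e + T b n e + T c n e + T d n e with hτ
      have ta := T0 a n e
      have tb := T0 b n e
      have tc := T0 c n e
      have td := T0 d n e
      have k : ∀ v w v' w', T v' n e + T w' n e ≤ τ →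
          ‖Lv m v w e * (Lv (u n) v' w' e + Lv (u' n) v' w' e)‖ ≤ Q v w * τ := by
        intro v w v' w' h
        rw [norm_mul]
        exact mul_le_mul (hQ v w e) ((hsum v' w' e he).trans h) (norm_nonneg _) (hQ0 v w)
      have k1 := k a b c d (by linarith)
      have k2 := k c d a b (by linarith)
      have k3 := k a d c b (by linarith)
      have k4 := k c b a d (by linarith)
      refine (norm_sub_le _ _).trans ?_
      have j1 := norm_sub_le (Lv m a b e * (Lv (u n) c d e + Lv (u' n) c d e)
        + Lv m c d e * (Lv (u n) a b e + Lv (u' n) a b e))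
        (Lv m a d e * (Lv (u n) c b e + Lv (u' n) c b e))
      have j2 := norm_add_le (Lv m a b e * (Lv (u n) c d e + Lv (u' n) c d e))
        (Lv m c d e * (Lv (u n) a b e + Lv (u' n) a b e))
      have : q * τ = Q a b * τ + Q c d * τ + Q a d * τ + Q c b * τ := by rw [hq]; ring
      linarith
    · have h := hM e (not_le.1 he)
      simp only [Lv_zero_of_notMem h]
      simp only [zero_mul, add_zero, sub_zero, mul_zero, norm_zero]
      have := hδ0 n
      have ta := T0 a n e
      have tb := T0 b n e
      have tc := T0 c n e
      have td := T0 d n e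
      positivity
  have iS : Integrable (fun e => δ n * (q * (T a n e + T b n e + T c n e + T d n e))) μ :=
    (((((iT a n).add (iT b n)).add (iT c n)).add (iT d n)).const_mul q).const_mul (δ n)
  have hI : ∫ e, δ n * (q * (T a n e + T b n e + T c n e + T d n e)) ∂μ ≤
      δ n * (q * (B a + B b + B c + B d)) := by
    rw [integral_const_mul, integral_const_mul]
    have : ∫ e, (T a n e + T b n e + T c n e + T d n e) ∂μ =
        (∫ e, T a n e ∂μ) + (∫ e, T b n e ∂μ) + (∫ e, T c n e ∂μ) + ∫ e, T d n e ∂μ := by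
      have h1 := integral_add (iT a n) (iT b n)
      have h2 := integral_add ((iT a n).add (iT b n)) (iT c n)
      have h3 := integral_add (((iT a n).add (iT b n)).add (iT c n)) (iT d n)
      simp only [Pi.add_apply] at h1 h2 h3
      rw [h3, h2, h1]
    rw [this]
    refine mul_le_mul_of_nonneg_left (mul_le_mul_of_nonneg_left ?_ hq0) (hδ0 n)
    linarith [iT' a n, iT' b n, iT' c n, iT' d n]
  have hfin := (norm_integral_le_of_norm_le iS (Eventually.of_forall hpt)).trans hI
  have := norm_nonneg (∫ e, (u n e - u' n e) * (Lv m a b e * (Lv (u n) c d e + Lv (u' n) c d e)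
      + Lv m c d e * (Lv (u n) a b e + Lv (u' n) a b e)
      - Lv m a d e * (Lv (u n) c b e + Lv (u' n) c b e)
      - Lv m c b e * (Lv (u n) a d e + Lv (u' n) a d e)) ∂μ)
  linarith

end MA
end

noncomputable section


/-- Growth and cone estimates for a composition of Henon maps. -/
structure Est0 (f : ℂ × ℂ → ℂ × ℂ) (d : ℕ) (R C c : ℝ) : Prop where
  hd : 2 ≤ d
  R1 : 1 ≤ R
  C1 : 1 ≤ C
  c0 : 0 < c
  c1 : c ≤ 1
  diff : Differentiable ℂ f
  ub : ∀ z, ‖f z‖ ≤ C * max 1 ‖z‖ ^ d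
  dub : ∀ z, ‖fderiv ℂ f z‖ ≤ C * max 1 ‖z‖ ^ (d - 1)
  lower : ∀ z, R ≤ ‖z.1‖ → ‖z.2‖ ≤ ‖z.1‖ → c * ‖z.1‖ ^ d ≤ ‖(f z).1‖
  hor : ∀ z, R ≤ ‖z.1‖ → ‖z.2‖ ≤ ‖z.1‖ → ‖(f z).2‖ ≤ (1/2) * ‖(f z).1‖
  Dt : ∀ z, R ≤ ‖z.1‖ → ‖z.2‖ ≤ ‖z.1‖ → ∀ v,
    ‖(fderiv ℂ f z v).1 / (f z).1 - d * v.1 / z.1‖ ≤ C * ‖v‖ / ‖z.1‖ ^ 2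
  Dh : ∀ z, R ≤ ‖z.1‖ → ‖z.2‖ ≤ ‖z.1‖ → ∀ v, ‖v.2‖ ≤ ‖v.1‖ →
    ‖(fderiv ℂ f z v).2‖ ≤ ‖(fderiv ℂ f z v).1‖
  Dv : ∀ z, R ≤ ‖z.1‖ → ‖z.2‖ ≤ ‖z.1‖ → ∀ v,
    ‖(fderiv ℂ f z v).1‖ < ‖(fderiv ℂ f z v).2‖ → ‖fderiv ℂ f z v‖ ≤ C / ‖z.1‖ * ‖v‖

theorem Est0.mono {f : ℂ × ℂ → ℂ × ℂ} {d : ℕ} {R C c R' C' c' : ℝ} (h : Est0 f d R C c)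
    (hR : R ≤ R') (hC : C ≤ C') (hc : c' ≤ c) (hc0 : 0 < c') : Est0 f d R' C' c' where
  hd := h.hd
  R1 := h.R1.trans hR
  C1 := h.C1.trans hC
  c0 := hc0
  c1 := hc.trans h.c1
  diff := h.diff
  ub z := (h.ub z).trans (by gcongr)
  dub z := (h.dub z).trans (by gcongr)
  lower z h1 h2 := le_trans (by gcongr) (h.lower z (hR.trans h1) h2)
  hor z h1 h2 := h.hor z (hR.trans h1) h2
  Dt z h1 h2 v := (h.Dt z (hR.trans h1) h2 v).trans (by gcongr)
  Dh z h1 h2 := h.Dh z (hR.trans h1) h2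
  Dv z h1 h2 v h3 := (h.Dv z (hR.trans h1) h2 v h3).trans (by gcongr)

theorem Est0.comp {f g : ℂ × ℂ → ℂ × ℂ} {d e : ℕ} {R C c : ℝ} (hf : Est0 f d R C c)
    (hg : Est0 g e R C c) : ∃ R' C' c', Est0 (f ∘ g) (d * e) R' C' c' := by
  have c0 := hf.c0
  have c1 := hf.c1
  have C1 := hf.C1
  have R1 := hf.R1
  have hRc : R ≤ R / c := by rw [le_div_iff₀ c0]; nlinarith
  have key : ∀ z : ℂ × ℂ, R / c ≤ ‖z.1‖ → ‖z.2‖ ≤ ‖z.1‖ →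
      R ≤ ‖z.1‖ ∧ R ≤ ‖(g z).1‖ ∧ ‖(g z).2‖ ≤ ‖(g z).1‖ ∧ c * ‖z.1‖ ^ e ≤ ‖(g z).1‖ := by
    intro z h1 h2
    have h3 := hRc.trans h1
    have l := hg.lower z h3 h2
    have hh := hg.hor z h3 h2
    refine ⟨h3, ?_, by linarith [norm_nonneg (g z).1], l⟩
    refine le_trans ?_ l
    have hx1 : 1 ≤ ‖z.1‖ := R1.trans h3
    have : ‖z.1‖ ^ 1 ≤ ‖z.1‖ ^ e := pow_le_pow_right₀ hx1 (by have := hg.hd; omega)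
    rw [div_le_iff₀ c0] at h1
    nlinarith
  have hchain : ∀ z v, fderiv ℂ (f ∘ g) z v = fderiv ℂ f (g z) (fderiv ℂ g z v) := by
    intro z v
    rw [fderiv_comp z (hf.diff _) (hg.diff _)]; rfl
  have mg : ∀ z, max 1 ‖g z‖ ≤ C * max 1 ‖z‖ ^ e := by
    intro z
    refine max_le ?_ (hg.ub z)
    have : 1 ≤ max 1 ‖z‖ ^ e := one_le_pow₀ (le_max_left _ _)
    nlinarith
  refine ⟨R / c, C ^ (d + 1) + C ^ 2 / c ^ 2 + d * C + C ^ 2, c * c ^ d, ?_⟩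
  have p1 : 0 ≤ C ^ (d + 1) := by positivity
  have p1' : 1 ≤ C ^ (d + 1) := one_le_pow₀ C1
  have p2 : 0 ≤ C ^ 2 / c ^ 2 := by positivity
  have p3 : 0 ≤ d * C := by positivity
  have p4 : 0 ≤ C ^ 2 := by positivity
  constructor
  · have := hf.hd; have := hg.hd; nlinarith
  · exact R1.trans hRc
  · linarith
  · positivity
  · exact mul_le_one₀ c1 (by positivity) (pow_le_one₀ c0.le c1)
  · exact hf.diff.comp hg.diff
  · intro z
    have h1 := hf.ub (g z)
    have : C * max 1 ‖g z‖ ^ d ≤ C ^ (d + 1) * max 1 ‖z‖ ^ (d * e) := by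
      calc C * max 1 ‖g z‖ ^ d ≤ C * (C * max 1 ‖z‖ ^ e) ^ d := by gcongr; exact mg z
        _ = _ := by rw [mul_pow, ← pow_mul, pow_succ, mul_comm d e]; ring
    refine h1.trans (this.trans ?_)
    gcongr; linarith
  · intro z
    rw [fderiv_comp z (hf.diff _) (hg.diff _)]
    refine (ContinuousLinearMap.opNorm_comp_le _ _).trans ?_
    have h1 := hf.dub (g z)
    have h2 := hg.dub z
    calc _ ≤ (C * max 1 ‖g z‖ ^ (d - 1)) * (C * max 1 ‖z‖ ^ (e - 1)) := by gcongr
      _ ≤ (C * (C * max 1 ‖z‖ ^ e) ^ (d - 1)) * (C * max 1 ‖z‖ ^ (e - 1)) := by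
          gcongr; exact mg z
      _ = C ^ (d + 1) * max 1 ‖z‖ ^ (d * e - 1) := by
          obtain ⟨k, rfl⟩ : ∃ k, d = k + 1 := ⟨d - 1, by have := hf.hd; omega⟩
          obtain ⟨l, rfl⟩ : ∃ l, e = l + 1 := ⟨e - 1, by have := hg.hd; omega⟩
          have : (k + 1) * (l + 1) - 1 = (l + 1) * k + l := by
            have : (k + 1) * (l + 1) = (l + 1) * k + l + 1 := by ring
            omega
          rw [this]
          simp only [Nat.add_sub_cancel]
          rw [mul_pow, ← pow_mul, pow_add]; ring
      _ ≤ _ := by gcongr; linarith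
  · intro z h1 h2
    obtain ⟨k1, k2, k3, k4⟩ := key z h1 h2
    have := hf.lower (g z) k2 k3
    refine le_trans ?_ this
    calc c * c ^ d * ‖z.1‖ ^ (d * e) = c * (c * ‖z.1‖ ^ e) ^ d := by
          rw [mul_pow, ← pow_mul, mul_comm d e]; ring
      _ ≤ _ := by gcongr
  · intro z h1 h2
    obtain ⟨k1, k2, k3, k4⟩ := key z h1 h2
    exact hf.hor (g z) k2 k3
  · intro z h1 h2 v
    obtain ⟨k1, k2, k3, k4⟩ := key z h1 h2
    rw [hchain]
    set u := fderiv ℂ g z v with hu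
    have t1 := hf.Dt (g z) k2 k3 u
    have t2 := hg.Dt z k1 h2 v
    rw [← hu] at t2
    have hx1 : 1 ≤ ‖z.1‖ := R1.trans k1
    have hz : max 1 ‖z‖ = ‖z.1‖ := by
      rw [Prod.norm_def, max_eq_left h2, max_eq_right hx1]
    have hu' : ‖u‖ ≤ C * ‖z.1‖ ^ (e - 1) * ‖v‖ := by
      refine (ContinuousLinearMap.le_opNorm _ _).trans ?_
      have := hg.dub z
      rw [hz] at this
      gcongr
    have t3 : C * ‖u‖ / ‖(g z).1‖ ^ 2 ≤ C ^ 2 / c ^ 2 * ‖v‖ / ‖z.1‖ ^ 2 := by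
      have q1 : (c * ‖z.1‖ ^ e) ^ 2 ≤ ‖(g z).1‖ ^ 2 := by gcongr
      have hx0 : 0 < ‖z.1‖ := by linarith
      calc C * ‖u‖ / ‖(g z).1‖ ^ 2 ≤ C * (C * ‖z.1‖ ^ (e - 1) * ‖v‖) / (c * ‖z.1‖ ^ e) ^ 2 := by
            gcongr
        _ = C ^ 2 / c ^ 2 * ‖v‖ / (‖z.1‖ ^ (e + 1)) := by
            obtain ⟨l, rfl⟩ : ∃ l, e = l + 1 := ⟨e - 1, by have := hg.hd; omega⟩
            simp only [Nat.add_sub_cancel]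
            field_simp
            ring
        _ ≤ C ^ 2 / c ^ 2 * ‖v‖ / ‖z.1‖ ^ 2 := by
            have : 2 ≤ e + 1 := by have := hg.hd; omega
            gcongr
    have t4 : ‖(d : ℂ) * (u.1 / (g z).1 - e * v.1 / z.1)‖ ≤ d * (C * ‖v‖ / ‖z.1‖ ^ 2) := by
      rw [norm_mul]; simp; gcongr
    have : (fderiv ℂ f (g z) u).1 / ((f ∘ g) z).1 - (d * e : ℕ) * v.1 / z.1 =
        ((fderiv ℂ f (g z) u).1 / (f (g z)).1 - d * u.1 / (g z).1) +
        (d : ℂ) * (u.1 / (g z).1 - e * v.1 / z.1) := by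
      simp only [comp_apply]; push_cast; ring
    rw [this]
    refine (norm_add_le _ _).trans ((add_le_add (t1.trans t3) t4).trans ?_)
    have hn : 0 ≤ ‖v‖ / ‖z.1‖ ^ 2 := by positivity
    have : C ^ 2 / c ^ 2 * ‖v‖ / ‖z.1‖ ^ 2 + d * (C * ‖v‖ / ‖z.1‖ ^ 2) =
      (C ^ 2 / c ^ 2 + d * C) * (‖v‖ / ‖z.1‖ ^ 2) := by ring
    rw [this, mul_div_assoc]
    exact mul_le_mul_of_nonneg_right (by linarith) hn
  · intro z h1 h2 v h3
    obtain ⟨k1, k2, k3, k4⟩ := key z h1 h2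
    rw [hchain]
    exact hf.Dh _ k2 k3 _ (hg.Dh z k1 h2 v h3)
  · intro z h1 h2 v h3
    obtain ⟨k1, k2, k3, k4⟩ := key z h1 h2
    rw [hchain] at h3 ⊢
    have h4 : ‖(fderiv ℂ g z v).1‖ < ‖(fderiv ℂ g z v).2‖ := by
      by_contra hh
      exact absurd (hf.Dh _ k2 k3 _ (not_lt.1 hh)) (not_le.2 h3)
    have a1 := hf.Dv _ k2 k3 _ h3
    have a2 := hg.Dv z k1 h2 v h4
    have hW : 1 ≤ ‖(g z).1‖ := R1.trans k2
    refine a1.trans ?_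
    have hx0 : 0 < ‖z.1‖ := by linarith
    have hCW : C / ‖(g z).1‖ ≤ C := div_le_self (by linarith) hW
    calc C / ‖(g z).1‖ * ‖fderiv ℂ g z v‖ ≤ C * (C / ‖z.1‖ * ‖v‖) := by gcongr
      _ = C ^ 2 / ‖z.1‖ * ‖v‖ := by ring
      _ ≤ _ := by gcongr; linarith

theorem poly_bound (q : Polynomial ℂ) {n : ℕ} (hn : q.natDegree ≤ n) :
    ∃ K : ℝ, 0 ≤ K ∧ ∀ x : ℂ, ‖q.eval x‖ ≤ K * max 1 ‖x‖ ^ n := by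
  refine ⟨∑ i ∈ Finset.range (n + 1), ‖q.coeff i‖, Finset.sum_nonneg fun _ _ => norm_nonneg _,
    fun x => ?_⟩
  rw [Polynomial.eval_eq_sum_range' (Nat.lt_succ_of_le hn), Finset.sum_mul]
  refine (norm_sum_le _ _).trans (Finset.sum_le_sum fun i hi => ?_)
  rw [norm_mul, norm_pow]
  gcongr
  calc ‖x‖ ^ i ≤ max 1 ‖x‖ ^ i := by gcongr; exact le_max_right _ _
    _ ≤ _ := pow_le_pow_right₀ (le_max_left _ _) (by simp at hi; omega)

theorem henon_hasFDerivAt (p : Polynomial ℂ) (a : ℂ) (z : ℂ × ℂ) :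
    HasFDerivAt (fun z : ℂ × ℂ => (p.eval z.1 - a * z.2, z.1))
      (((p.derivative.eval z.1) • ContinuousLinearMap.fst ℂ ℂ ℂ -
        a • ContinuousLinearMap.snd ℂ ℂ ℂ).prod (ContinuousLinearMap.fst ℂ ℂ ℂ)) z := by
  have h1 : HasFDerivAt (fun z : ℂ × ℂ => z.1) (ContinuousLinearMap.fst ℂ ℂ ℂ) z := hasFDerivAt_fst
  have h2 : HasFDerivAt (fun z : ℂ × ℂ => z.2) (ContinuousLinearMap.snd ℂ ℂ ℂ) z := hasFDerivAt_snd
  have h3 := (p.hasDerivAt z.1).comp_hasFDerivAt z h1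
  exact (h3.sub (h2.const_mul a)).prodMk h1

theorem henon_est (p : Polynomial ℂ) (a : ℂ) (hp : 2 ≤ p.natDegree) :
    ∃ R C c, Est0 (fun z : ℂ × ℂ => (p.eval z.1 - a * z.2, z.1)) p.natDegree R C c := by
  obtain ⟨m, hm⟩ : ∃ m, p.natDegree = m + 2 := ⟨p.natDegree - 2, by omega⟩
  have hfd : ∀ z v, fderiv ℂ (fun z : ℂ × ℂ => (p.eval z.1 - a * z.2, z.1)) z v =
      (p.derivative.eval z.1 * v.1 - a * v.2, v.1) := by
    intro z v
    rw [(henon_hasFDerivAt p a z).fderiv]; simp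
  set α := p.leadingCoeff with hα
  have hα0 : 0 < ‖α‖ := by
    rw [norm_pos_iff, hα, Polynomial.leadingCoeff_ne_zero]; rintro rfl; simp at hp
  have hdec : p = p.eraseLead + Polynomial.monomial (m + 2) α := by
    rw [hα, ← hm]; exact (p.eraseLead_add_monomial_natDegree_leadingCoeff).symm
  have hel : p.eraseLead.natDegree ≤ m + 1 := by
    have := p.eraseLead_natDegree_le; omega
  obtain ⟨K1, K1n, hK1⟩ := poly_bound p.eraseLead hel
  obtain ⟨K2, K2n, hK2⟩ := poly_bound p.eraseLead.derivative (n := m)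
    ((Polynomial.natDegree_derivative_le _).trans (by omega))
  obtain ⟨K3, K3n, hK3⟩ := poly_bound p (n := m + 2) hm.le
  obtain ⟨K4, K4n, hK4⟩ := poly_bound p.derivative (n := m + 1)
    ((Polynomial.natDegree_derivative_le _).trans (by omega))
  set A := ‖a‖ with hA
  have A0 : 0 ≤ A := norm_nonneg a
  have e1 : ∀ x : ℂ, 1 ≤ ‖x‖ → ‖p.eval x - α * x ^ (m + 2)‖ ≤ K1 * ‖x‖ ^ (m + 1) := by
    intro x hx
    have : p.eval x - α * x ^ (m + 2) = p.eraseLead.eval x := by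
      conv_lhs => rw [hdec]
      simp
    rw [this]
    have := hK1 x
    rwa [max_eq_right hx] at this
  have e2 : ∀ x : ℂ, 1 ≤ ‖x‖ → ‖p.derivative.eval x - (m + 2) * α * x ^ (m + 1)‖ ≤ K2 * ‖x‖ ^ m := by
    intro x hx
    have : p.derivative.eval x - (m + 2) * α * x ^ (m + 1) = p.eraseLead.derivative.eval x := by
      conv_lhs => rw [hdec]
      simp [Polynomial.derivative_monomial]; ring
    rw [this]
    have := hK2 x
    rwa [max_eq_right hx] at this
  clear_value α
  clear hdec hel hK1 hK2
  set R := 1 + (4 + 2 * K1 + 2 * K2 + 4 * A) / ‖α‖ with hR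
  have R1 : 1 ≤ R := by rw [hR]; have : 0 ≤ (4 + 2 * K1 + 2 * K2 + 4 * A) / ‖α‖ := by positivity
                        linarith
  have Rα : ∀ x : ℂ, R ≤ ‖x‖ → 4 + 2 * K1 + 2 * K2 + 4 * A ≤ ‖α‖ * ‖x‖ := by
    intro x hx
    have : (4 + 2 * K1 + 2 * K2 + 4 * A) / ‖α‖ ≤ ‖x‖ := by linarith
    rw [div_le_iff₀ hα0] at this
    linarith
  have e3 : ∀ z : ℂ × ℂ, R ≤ ‖z.1‖ → ‖z.2‖ ≤ ‖z.1‖ →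
      ‖p.eval z.1 - a * z.2 - α * z.1 ^ (m + 2)‖ ≤ (K1 + A) * ‖z.1‖ ^ (m + 1) := by
    intro z h1 h2
    have hx1 : 1 ≤ ‖z.1‖ := R1.trans h1
    have : p.eval z.1 - a * z.2 - α * z.1 ^ (m + 2) = (p.eval z.1 - α * z.1 ^ (m + 2)) - a * z.2 := by
      ring
    rw [this]
    refine (norm_sub_le _ _).trans ?_
    have := e1 z.1 hx1
    have h3 : ‖a * z.2‖ ≤ A * ‖z.1‖ ^ (m + 1) := by
      rw [norm_mul]
      have : ‖z.1‖ ^ 1 ≤ ‖z.1‖ ^ (m + 1) := pow_le_pow_right₀ hx1 (by omega)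
      rw [pow_one] at this
      gcongr
      linarith
    linarith
  have e4 : ∀ z : ℂ × ℂ, R ≤ ‖z.1‖ → ‖z.2‖ ≤ ‖z.1‖ →
      ‖α‖ / 2 * ‖z.1‖ ^ (m + 2) ≤ ‖p.eval z.1 - a * z.2‖ := by
    intro z h1 h2
    have := e3 z h1 h2
    have t := norm_sub_norm_le (α * z.1 ^ (m + 2)) (α * z.1 ^ (m + 2) - (p.eval z.1 - a * z.2))
    rw [sub_sub_cancel, norm_sub_rev (α * z.1 ^ (m + 2)), norm_mul, norm_pow] at t
    have r := Rα z.1 h1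
    have : (K1 + A) * ‖z.1‖ ^ (m + 1) ≤ ‖α‖ * ‖z.1‖ / 2 * ‖z.1‖ ^ (m + 1) := by gcongr; linarith
    have e : ‖α‖ * ‖z.1‖ ^ (m + 2) = ‖α‖ * ‖z.1‖ * ‖z.1‖ ^ (m + 1) := by ring
    have e' : ‖α‖ / 2 * ‖z.1‖ ^ (m + 2) = ‖α‖ * ‖z.1‖ / 2 * ‖z.1‖ ^ (m + 1) := by ring
    rw [e'] ; rw [e] at t
    linarith
  have e5 : ∀ x : ℂ, R ≤ ‖x‖ → ‖α‖ * ‖x‖ + 1 + A ≤ ‖p.derivative.eval x‖ := by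
    intro x h1
    have hx1 : 1 ≤ ‖x‖ := R1.trans h1
    have := e2 x hx1
    have t := norm_sub_norm_le ((m + 2) * α * x ^ (m + 1)) ((m + 2) * α * x ^ (m + 1) - p.derivative.eval x)
    rw [sub_sub_cancel, norm_sub_rev ((m + 2) * α * x ^ (m + 1)), norm_mul, norm_mul, norm_pow] at t
    have hm2 : ‖(m + 2 : ℂ)‖ = m + 2 := by
      have : (m + 2 : ℂ) = ((m + 2 : ℕ) : ℂ) := by push_cast; rfl
      rw [this, Complex.norm_natCast]; push_cast; rfl
    rw [hm2] at t
    have r := Rα x h1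
    have hxm : 1 ≤ ‖x‖ ^ m := one_le_pow₀ hx1
    have hm0 : (0 : ℝ) ≤ m := Nat.cast_nonneg m
    have : (‖α‖ * ‖x‖ + 1 + A) * 1 ≤ (2 * ‖α‖ * ‖x‖ - K2) * ‖x‖ ^ m := by
      apply mul_le_mul _ hxm zero_le_one
      · nlinarith
      · linarith
    have h5 : (2 * ‖α‖ * ‖x‖ - K2) * ‖x‖ ^ m + K2 * ‖x‖ ^ m + m * ‖α‖ * ‖x‖ ^ (m + 1) = (m + 2) * ‖α‖ * ‖x‖ ^ (m + 1) := by
      ring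
    have h6 : 0 ≤ m * ‖α‖ * ‖x‖ ^ (m + 1) := by positivity
    linarith
  rw [hm]
  obtain ⟨CC, hCC⟩ : ∃ CC, CC = 1 + K3 + A + K4 + 2 * (K2 + (m + 2) * (K1 + A) + A) / ‖α‖ + A / ‖α‖ :=
    ⟨_, rfl⟩
  refine ⟨R, CC, min 1 (‖α‖ / 2), ?_⟩
  have q1 : 0 ≤ 2 * (K2 + (m + 2) * (K1 + A) + A) / ‖α‖ := by positivity
  have q2 : 0 ≤ A / ‖α‖ := by positivity
  have q3 : 0 ≤ CC := by linarith
  constructor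
  · omega
  · exact R1
  · linarith
  · exact lt_min one_pos (by positivity)
  · exact min_le_left _ _
  · exact fun z => (henon_hasFDerivAt p a z).differentiableAt
  · intro z
    set M := max 1 ‖z‖ with hM
    have M1 : 1 ≤ M := le_max_left _ _
    have Mz : ‖z‖ ≤ M := le_max_right _ _
    have h1 : max 1 ‖z.1‖ ≤ M := max_le_max le_rfl (norm_fst_le z)
    have hMp : M ^ 1 ≤ M ^ (m + 2) := pow_le_pow_right₀ M1 (by omega)
    rw [pow_one] at hMp
    have h2 : ‖p.eval z.1 - a * z.2‖ ≤ (K3 + A) * M ^ (m + 2) := by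
      refine (norm_sub_le _ _).trans ?_
      have t1 : ‖p.eval z.1‖ ≤ K3 * M ^ (m + 2) := (hK3 z.1).trans (by gcongr)
      have t2 : ‖a * z.2‖ ≤ A * M ^ (m + 2) := by
        rw [norm_mul]; gcongr; exact (norm_snd_le z).trans (Mz.trans hMp)
      linarith
    rw [Prod.norm_def]
    refine max_le (h2.trans (by gcongr; linarith)) ?_
    have : ‖z.1‖ ≤ 1 * M ^ (m + 2) := by linarith [norm_fst_le z]
    exact this.trans (by gcongr; linarith)
  · intro z
    refine ContinuousLinearMap.opNorm_le_bound _ (by positivity) fun v => ?_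
    rw [hfd]
    set M := max 1 ‖z‖ with hM
    have M1 : 1 ≤ M := le_max_left _ _
    have h1 : max 1 ‖z.1‖ ≤ M := max_le_max le_rfl (norm_fst_le z)
    have hMp : 1 ≤ M ^ (m + 2 - 1) := one_le_pow₀ M1
    rw [Prod.norm_def]
    have t1 : ‖p.derivative.eval z.1‖ ≤ K4 * M ^ (m + 2 - 1) := (hK4 z.1).trans (by
      simp only [Nat.add_succ_sub_one]; gcongr)
    refine max_le ?_ ?_
    · refine (norm_sub_le _ _).trans ?_
      rw [norm_mul, norm_mul]
      have t2 : ‖p.derivative.eval z.1‖ * ‖v.1‖ ≤ K4 * M ^ (m + 2 - 1) * ‖v‖ := by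
        gcongr; exact norm_fst_le v
      have t3 : ‖a‖ * ‖v.2‖ ≤ A * M ^ (m + 2 - 1) * ‖v‖ := by
        have : ‖v.2‖ ≤ M ^ (m + 2 - 1) * ‖v‖ := by
          have := norm_snd_le v
          nlinarith [norm_nonneg v]
        rw [mul_assoc]; gcongr
      have : K4 * M ^ (m + 2 - 1) * ‖v‖ + A * M ^ (m + 2 - 1) * ‖v‖ = (K4 + A) * M ^ (m + 2 - 1) * ‖v‖ := by ring
      calc _ ≤ (K4 + A) * M ^ (m + 2 - 1) * ‖v‖ := by linarith
        _ ≤ _ := by gcongr; linarith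
    · calc ‖v.1‖ ≤ 1 * 1 * ‖v‖ := by rw [one_mul, one_mul]; exact norm_fst_le v
        _ ≤ _ := by gcongr; linarith
  · intro z h1 h2
    refine le_trans ?_ (e4 z h1 h2)
    gcongr; exact min_le_right _ _
  · intro z h1 h2
    have := e4 z h1 h2
    have r := Rα z.1 h1
    have hx1 : 1 ≤ ‖z.1‖ := R1.trans h1
    have hxm : 1 ≤ ‖z.1‖ ^ m := one_le_pow₀ hx1
    have : 2 * ‖z.1‖ * 1 ≤ (‖α‖ * ‖z.1‖ / 2 * ‖z.1‖) * ‖z.1‖ ^ m := by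
      apply mul_le_mul _ hxm zero_le_one (by positivity)
      nlinarith
    have e' : ‖α‖ / 2 * ‖z.1‖ ^ (m + 2) = (‖α‖ * ‖z.1‖ / 2 * ‖z.1‖) * ‖z.1‖ ^ m := by ring
    simp only
    linarith
  · intro z h1 h2 v
    rw [hfd]
    simp only
    have hx1 : 1 ≤ ‖z.1‖ := R1.trans h1
    have hx0 : 0 < ‖z.1‖ := by linarith
    have h4 := e4 z h1 h2
    have hh0 : 0 < ‖p.eval z.1 - a * z.2‖ := lt_of_lt_of_le (by positivity) h4
    set H := p.eval z.1 - a * z.2 with hH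
    have hHn : H ≠ 0 := norm_pos_iff.1 hh0
    have hxn : z.1 ≠ 0 := norm_pos_iff.1 hx0
    set P := p.derivative.eval z.1 with hP
    have e : (P * v.1 - a * v.2) / H - ((m + 2 : ℕ) : ℂ) * v.1 / z.1 =
        (z.1 * (P - (m + 2) * α * z.1 ^ (m + 1)) * v.1 - (m + 2) * (H - α * z.1 ^ (m + 2)) * v.1
          - a * z.1 * v.2) / (H * z.1) := by
      push_cast
      field_simp
      ring
    have hm2 : ‖(m + 2 : ℂ)‖ = m + 2 := by
      have : (m + 2 : ℂ) = ((m + 2 : ℕ) : ℂ) := by push_cast; rfl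
      rw [this, Complex.norm_natCast]; push_cast; rfl
    have s1 : ‖z.1 * (P - (m + 2) * α * z.1 ^ (m + 1)) * v.1‖ ≤ K2 * ‖z.1‖ ^ (m + 1) * ‖v‖ := by
      rw [norm_mul, norm_mul]
      calc _ ≤ ‖z.1‖ * (K2 * ‖z.1‖ ^ m) * ‖v‖ := by gcongr; exact e2 _ hx1; exact norm_fst_le v
        _ = _ := by ring
    have s2 : ‖(m + 2) * (H - α * z.1 ^ (m + 2)) * v.1‖ ≤ (m + 2) * (K1 + A) * ‖z.1‖ ^ (m + 1) * ‖v‖ := by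
      rw [norm_mul, norm_mul, hm2]
      calc _ ≤ (m + 2) * ((K1 + A) * ‖z.1‖ ^ (m + 1)) * ‖v‖ := by
            gcongr; exact e3 z h1 h2; exact norm_fst_le v
        _ = _ := by ring
    have s3 : ‖a * z.1 * v.2‖ ≤ A * ‖z.1‖ ^ (m + 1) * ‖v‖ := by
      rw [norm_mul, norm_mul]
      have : ‖z.1‖ ^ 1 ≤ ‖z.1‖ ^ (m + 1) := pow_le_pow_right₀ hx1 (by omega)
      rw [pow_one] at this
      gcongr; exact norm_snd_le v
    rw [e, norm_div, norm_mul H]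
    have s4 := (norm_sub_le (z.1 * (P - (m + 2) * α * z.1 ^ (m + 1)) * v.1 - (m + 2) * (H - α * z.1 ^ (m + 2)) * v.1)
      (a * z.1 * v.2)).trans (add_le_add (norm_sub_le _ _) le_rfl)
    calc _ ≤ ((K2 + (m + 2) * (K1 + A) + A) * ‖z.1‖ ^ (m + 1) * ‖v‖) / ((‖α‖ / 2 * ‖z.1‖ ^ (m + 2)) * ‖z.1‖) := by
          gcongr
          linarith
      _ = 2 * (K2 + (m + 2) * (K1 + A) + A) / ‖α‖ * ‖v‖ / ‖z.1‖ ^ 2 := by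
          field_simp
          ring
      _ ≤ _ := by gcongr; linarith
  · intro z h1 h2 v hv
    rw [hfd]
    simp only
    have h5 := e5 z.1 h1
    have t := norm_sub_norm_le (p.derivative.eval z.1 * v.1) (a * v.2)
    rw [norm_mul, norm_mul] at t
    have : ‖a‖ * ‖v.2‖ ≤ A * ‖v.1‖ := by gcongr
    have hx1 : 0 ≤ ‖α‖ * ‖z.1‖ := by positivity
    have : (1 + A) * ‖v.1‖ ≤ ‖p.derivative.eval z.1‖ * ‖v.1‖ := by gcongr; linarith
    linarith
  · intro z h1 h2 v hv
    rw [hfd] at hv ⊢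
    simp only at hv
    have hx0 : 0 < ‖z.1‖ := by linarith
    rw [Prod.norm_def]
    simp only
    rw [max_eq_right hv.le]
    have h5 := e5 z.1 h1
    have t := norm_sub_norm_le (p.derivative.eval z.1 * v.1) (a * v.2)
    rw [norm_mul, norm_mul] at t
    have i1 : ‖a‖ * ‖v.2‖ ≤ A * ‖v‖ := by gcongr; exact norm_snd_le v
    have i2 : (‖α‖ * ‖z.1‖ + 1 + A) * ‖v.1‖ ≤ ‖p.derivative.eval z.1‖ * ‖v.1‖ := by gcongr
    have i3 : ‖α‖ * ‖z.1‖ * ‖v.1‖ ≤ A * ‖v‖ := by nlinarith [norm_nonneg v.1]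
    calc ‖v.1‖ ≤ A * ‖v‖ / (‖α‖ * ‖z.1‖) := by
          rw [le_div_iff₀ (by positivity)]; linarith
      _ = A / ‖α‖ / ‖z.1‖ * ‖v‖ := by field_simp
      _ ≤ _ := by gcongr; linarith

/-- The swap map. -/
def sw (z : ℂ × ℂ) : ℂ × ℂ := (z.2, z.1)

/-- A pair of inverse maps with estimates for both. -/
structure HP (f g : ℂ × ℂ → ℂ × ℂ) (d : ℕ) (R C c : ℝ) : Prop where
  F : Est0 f d R C c
  G : Est0 (fun z => sw (g (sw z))) d R C c
  hR : 2 * C ≤ c ^ 2 * R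
  fg : ∀ z, f (g z) = z
  gf : ∀ z, g (f z) = z

theorem HP.symm {f g : ℂ × ℂ → ℂ × ℂ} {d : ℕ} {R C c : ℝ} (h : HP f g d R C c) :
    HP (fun z => sw (g (sw z))) (fun z => sw (f (sw z))) d R C c where
  F := h.G
  G := by
    have : (fun z => sw (sw (f (sw (sw z))))) = f := by funext z; simp [sw]
    rw [this]; exact h.F
  hR := h.hR
  fg z := by simp [sw, h.gf]
  gf z := by simp [sw, h.fg]

/-- Same degree version of the estimate for a Henon map and its inverse. -/
theorem Est0.exists_HP {f g : ℂ × ℂ → ℂ × ℂ} {d : ℕ} {R C c R' C' c' : ℝ} (h : Est0 f d R C c)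
    (h' : Est0 (fun z => sw (g (sw z))) d R' C' c') (fg : ∀ z, f (g z) = z)
    (gf : ∀ z, g (f z) = z) : ∃ R C c, HP f g d R C c := by
  set c₀ := min c c'
  set C₀ := max C C'
  have c0 : 0 < c₀ := lt_min h.c0 h'.c0
  refine ⟨max (max R R') (2 * C₀ / c₀ ^ 2), C₀, c₀, h.mono ?_ (le_max_left _ _) (min_le_left _ _) c0,
    h'.mono ?_ (le_max_right _ _) (min_le_right _ _) c0, ?_, fg, gf⟩
  · exact (le_max_left _ _).trans (le_max_left _ _)
  · exact (le_max_right _ _).trans (le_max_left _ _)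
  · have : 2 * C₀ / c₀ ^ 2 ≤ max (max R R') (2 * C₀ / c₀ ^ 2) := le_max_right _ _
    rw [div_le_iff₀ (by positivity)] at this
    linarith

theorem HP.comp {f g f' g' : ℂ × ℂ → ℂ × ℂ} {d d' : ℕ} {R C c R' C' c' : ℝ}
    (h : HP f g d R C c) (h' : HP f' g' d' R' C' c') :
    ∃ R C c, HP (f ∘ f') (g' ∘ g) (d * d') R C c := by
  set c₀ := min c c'
  set C₀ := max C C'
  set R₀ := max R R'
  have c0 : 0 < c₀ := lt_min h.F.c0 h'.F.c0
  have a1 := h.F.mono (le_max_left R R') (le_max_left C C') (min_le_left c c') c0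
  have a2 := h.G.mono (le_max_left R R') (le_max_left C C') (min_le_left c c') c0
  have a3 := h'.F.mono (le_max_right R R') (le_max_right C C') (min_le_right c c') c0
  have a4 := h'.G.mono (le_max_right R R') (le_max_right C C') (min_le_right c c') c0
  obtain ⟨_, _, _, e1⟩ := a1.comp a3
  obtain ⟨_, _, _, e2⟩ := a4.comp a2
  rw [mul_comm d' d] at e2
  have : ((fun z => sw (g' (sw z))) ∘ fun z => sw (g (sw z))) = fun z => sw ((g' ∘ g) (sw z)) := by
    funext z; simp [sw]
  rw [this] at e2
  exact e1.exists_HP e2 (fun z => by simp [h'.fg, h.fg]) (fun z => by simp [h'.gf, h.gf])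

theorem henon_HP {h : ℂ × ℂ → ℂ × ℂ} (hh : IsHenon h) : ∃ g d R C c, HP h g d R C c := by
  obtain ⟨p, a, ha, hp, hdef⟩ := hh
  obtain rfl : h = fun z : ℂ × ℂ => (p.eval z.1 - a * z.2, z.1) := funext hdef
  have hn : (Polynomial.C a⁻¹ * p).natDegree = p.natDegree :=
    Polynomial.natDegree_C_mul (inv_ne_zero ha)
  obtain ⟨_, _, _, e1⟩ := henon_est p a hp
  obtain ⟨_, _, _, e2⟩ := henon_est (Polynomial.C a⁻¹ * p) a⁻¹ (by rw [hn]; exact hp)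
  rw [hn] at e2
  have e3 : (fun z : ℂ × ℂ => ((Polynomial.C a⁻¹ * p).eval z.1 - a⁻¹ * z.2, z.1)) =
      fun z => sw ((fun z : ℂ × ℂ => (z.2, a⁻¹ * (p.eval z.2 - z.1))) (sw z)) := by
    funext z; simp [sw, mul_sub]
  rw [e3] at e2
  refine ⟨fun z => (z.2, a⁻¹ * (p.eval z.2 - z.1)), p.natDegree, e1.exists_HP e2 ?_ ?_⟩
  · intro z; ext <;> simp [ha]
  · intro z; ext <;> simp [ha]

theorem list_HP (hs : List (ℂ × ℂ → ℂ × ℂ)) (hne : hs ≠ []) (hh : ∀ h ∈ hs, IsHenon h) :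
    ∃ g d R C c, HP (hs.foldr (fun h acc => h ∘ acc) id) g d R C c := by
  induction hs with
  | nil => exact absurd rfl hne
  | cons h t ih =>
    obtain ⟨g, d, R, C, c, e⟩ := henon_HP (hh h (by simp))
    by_cases ht : t = []
    · subst ht; exact ⟨g, d, R, C, c, by simpa using e⟩
    · obtain ⟨g', d', R', C', c', e'⟩ := ih ht (fun k hk => hh k (by simp [hk]))
      obtain ⟨_, _, _, e''⟩ := e.comp e'
      exact ⟨_, _, _, _, _, e''⟩
end

noncomputable section


/-- The region where the first coordinate dominates. -/
def Vs (R : ℝ) (z : ℂ × ℂ) : Prop := R ≤ ‖z.1‖ ∧ ‖z.2‖ ≤ ‖z.1‖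

theorem Vs.norm {R : ℝ} {z : ℂ × ℂ} (h : Vs R z) : ‖z‖ = ‖z.1‖ := by
  rw [Prod.norm_def, max_eq_left h.2]

section Dyn
variable {f g : ℂ × ℂ → ℂ × ℂ} {d : ℕ} {R C c : ℝ}

theorem HP.cR (H : HP f g d R C c) : 2 * C / c ≤ c * R := by
  rw [div_le_iff₀ H.F.c0]; have := H.hR; nlinarith

theorem HP.cR2 (H : HP f g d R C c) : 2 ≤ c * R := by
  refine le_trans ?_ H.cR
  rw [le_div_iff₀ H.F.c0]; have := H.F.C1; have := H.F.c1; linarith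

theorem HP.step (H : HP f g d R C c) {z : ℂ × ℂ} (hz : Vs R z) :
    Vs R (f z) ∧ 2 * ‖z.1‖ ≤ ‖(f z).1‖ ∧ 2 * C / c * ‖z.1‖ ≤ ‖(f z).1‖ := by
  have l := H.F.lower z hz.1 hz.2
  have hh := H.F.hor z hz.1 hz.2
  have hx1 : 1 ≤ ‖z.1‖ := H.F.R1.trans hz.1
  have c0 := H.F.c0
  have p : ‖z.1‖ ^ 2 ≤ ‖z.1‖ ^ d := pow_le_pow_right₀ hx1 H.F.hd
  have q : c * R * ‖z.1‖ ≤ ‖(f z).1‖ := by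
    calc c * R * ‖z.1‖ ≤ c * ‖z.1‖ * ‖z.1‖ := by gcongr; exact hz.1
      _ = c * ‖z.1‖ ^ 2 := by ring
      _ ≤ c * ‖z.1‖ ^ d := by gcongr
      _ ≤ _ := l
  have q2 : 2 * ‖z.1‖ ≤ ‖(f z).1‖ := le_trans (by gcongr; exact H.cR2) q
  refine ⟨⟨by have := hz.1; linarith, by linarith [norm_nonneg (f z).1]⟩, q2, le_trans (by gcongr; exact H.cR) q⟩

theorem HP.notV (H : HP f g d R C c) {z : ℂ × ℂ} (hz : ¬ Vs R (f z)) :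
    ‖f z‖ ≤ max R ‖z‖ := by
  by_contra hcon
  rw [not_le, max_lt_iff] at hcon
  obtain ⟨h1, h2⟩ := hcon
  rcases le_total ‖(f z).2‖ ‖(f z).1‖ with h | h
  · apply hz
    refine ⟨?_, h⟩
    rw [Prod.norm_def, max_eq_left h] at h1; exact h1.le
  · have hn : ‖f z‖ = ‖(f z).2‖ := by rw [Prod.norm_def, max_eq_right h]
    rw [hn] at h1 h2
    have := (H.symm.step (z := sw (f z)) ⟨h1.le, h⟩).2.1
    simp [sw, H.gf] at this
    have := norm_snd_le z
    linarith [norm_nonneg (f z).2]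

theorem HP.Viter (H : HP f g d R C c) {z : ℂ × ℂ} (hz : Vs R z) (n : ℕ) :
    Vs R (f^[n] z) ∧ 2 ^ n * ‖z.1‖ ≤ ‖(f^[n] z).1‖ ∧ (2 * C / c) ^ n * ‖z.1‖ ≤ ‖(f^[n] z).1‖ := by
  induction n with
  | zero => simpa using hz
  | succ n ih =>
    rw [iterate_succ_apply']
    obtain ⟨a, b, e⟩ := H.step ih.1
    have : 0 ≤ 2 * C / c := by have := H.F.c0; have := H.F.C1; positivity
    refine ⟨a, ?_, ?_⟩
    · rw [pow_succ]; linarith [ih.2.1]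
    · rw [pow_succ]; have := mul_le_mul_of_nonneg_left ih.2.2 this; linarith

theorem HP.Vmono (H : HP f g d R C c) {z : ℂ × ℂ} {i n : ℕ} (hin : i ≤ n) (hz : Vs R (f^[i] z)) :
    Vs R (f^[n] z) ∧ ‖(f^[i] z).1‖ ≤ ‖(f^[n] z).1‖ := by
  obtain ⟨k, rfl⟩ := Nat.exists_eq_add_of_le hin
  rw [add_comm, iterate_add_apply]
  obtain ⟨a, b, e⟩ := H.Viter hz k
  refine ⟨a, le_trans ?_ b⟩
  have : (1 : ℝ) ≤ 2 ^ k := one_le_pow₀ (by norm_num)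
  nlinarith [norm_nonneg (f^[i] z).1]

theorem HP.notViter (H : HP f g d R C c) {z : ℂ × ℂ} {n : ℕ} (hz : ¬ Vs R (f^[n] z)) :
    ∀ i ≤ n, ‖f^[i] z‖ ≤ max R ‖z‖ := by
  intro i
  induction i with
  | zero => intro _; simp
  | succ i ih =>
    intro hi
    have h1 : ¬ Vs R (f^[i + 1] z) := fun h => hz (H.Vmono hi h).1
    rw [iterate_succ_apply'] at h1 ⊢
    exact (H.notV h1).trans (max_le (le_max_left _ _) (ih (by omega)))

theorem HP.orbit (H : HP f g d R C c) (z : ℂ × ℂ) {i n : ℕ} (hi : i ≤ n) :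
    ‖f^[i] z‖ ≤ max (max R ‖z‖) ‖(f^[n] z).1‖ := by
  by_cases h : Vs R (f^[i] z)
  · rw [h.norm]; exact (H.Vmono hi h).2.trans (le_max_right _ _)
  · exact (H.notViter h i le_rfl).trans (le_max_left _ _)

theorem HP.y_bound (H : HP f g d R C c) {z : ℂ × ℂ} {M : ℝ} (hz : ‖z‖ ≤ M) (n : ℕ) :
    ‖(f^[n] z).2‖ ≤ (1/2) * ‖(f^[n] z).1‖ + C * max R M ^ d := by
  have C1 := H.F.C1
  have m1 : 1 ≤ max R M := H.F.R1.trans (le_max_left _ _)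
  cases n with
  | zero =>
    simp only [iterate_zero, id]
    have h2 : max R M ^ 1 ≤ max R M ^ d := pow_le_pow_right₀ m1 (by have := H.F.hd; omega)
    rw [pow_one] at h2
    have : M ≤ max R M := le_max_right _ _
    have : 1 * max R M ^ d ≤ C * max R M ^ d := by gcongr
    linarith [norm_snd_le z, norm_nonneg z.1]
  | succ n =>
    rw [iterate_succ_apply']
    by_cases h : Vs R (f^[n] z)
    · have := H.F.hor _ h.1 h.2
      have : 0 ≤ C * max R M ^ d := by positivity
      linarith
    · have h1 := H.notViter h n le_rfl
      have h2 := H.F.ub (f^[n] z)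
      have h3 : max 1 ‖f^[n] z‖ ≤ max R M :=
        max_le m1 (h1.trans (max_le_max le_rfl hz))
      have h4 : ‖f (f^[n] z)‖ ≤ C * max R M ^ d := h2.trans (by gcongr)
      linarith [norm_snd_le (f (f^[n] z)), norm_nonneg (f (f^[n] z)).1]

theorem fderiv_iterate_succ (hf : Differentiable ℂ f) (n : ℕ) (z v : ℂ × ℂ) :
    fderiv ℂ (f^[n + 1]) z v = fderiv ℂ f (f^[n] z) (fderiv ℂ (f^[n]) z v) := by
  rw [iterate_succ', fderiv_comp z (hf _) (hf.iterate n z)]; rfl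

theorem Est0.deriv_bdd (H : Est0 f d R C c) {z : ℂ × ℂ} {K : ℝ} (hK : 1 ≤ K) (n : ℕ)
    (hz : ∀ i < n, ‖f^[i] z‖ ≤ K) (v : ℂ × ℂ) : ‖fderiv ℂ (f^[n]) z v‖ ≤ (C * K ^ d) ^ n * ‖v‖ := by
  have C1 := H.C1
  induction n with
  | zero =>
    have : fderiv ℂ (f^[0]) z v = v := by simp [iterate_zero]
    rw [this]; simp
  | succ n ih =>
    rw [fderiv_iterate_succ H.diff]
    refine (ContinuousLinearMap.le_opNorm _ _).trans ?_
    have h1 := ih (fun i hi => hz i (by omega))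
    have h2 := H.dub (f^[n] z)
    have h3 : max 1 ‖f^[n] z‖ ≤ K := max_le hK (hz n (by omega))
    have h4 : C * max 1 ‖f^[n] z‖ ^ (d - 1) ≤ C * K ^ d := by
      calc _ ≤ C * K ^ (d - 1) := by gcongr
        _ ≤ _ := by gcongr; omega
    calc _ ≤ (C * K ^ d) * ((C * K ^ d) ^ n * ‖v‖) := by
          gcongr; exact h2.trans h4
      _ = _ := by ring

theorem HP.Dn (H : HP f g d R C c) {z : ℂ × ℂ} {K : ℝ} (hKR : R ≤ K) (hKz : ‖z‖ ≤ K) (n : ℕ)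
    (v : ℂ × ℂ) : ‖fderiv ℂ (f^[n]) z v‖ ≤ (C * K ^ d / c) ^ n * max 1 ‖(f^[n] z).1‖ * ‖v‖ := by
  have C1 := H.F.C1
  have c0 := H.F.c0
  have c1 := H.F.c1
  have K1 : 1 ≤ K := H.F.R1.trans hKR
  have hd : C * K ^ d ≤ C * K ^ d / c := by
    rw [le_div_iff₀ c0]
    have : 0 ≤ C * K ^ d := by positivity
    nlinarith
  have bd : ∀ n, (∀ i < n, ‖f^[i] z‖ ≤ K) →
      ‖fderiv ℂ (f^[n]) z v‖ ≤ (C * K ^ d / c) ^ n * max 1 ‖(f^[n] z).1‖ * ‖v‖ := by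
    intro n hn
    refine (H.F.deriv_bdd K1 n hn v).trans ?_
    calc _ ≤ (C * K ^ d / c) ^ n * 1 * ‖v‖ := by rw [mul_one]; gcongr
      _ ≤ _ := by gcongr; exact le_max_left _ _
  induction n with
  | zero => exact bd 0 (by simp)
  | succ n ih =>
    by_cases h : Vs R (f^[n] z)
    · rw [fderiv_iterate_succ H.F.diff]
      refine (ContinuousLinearMap.le_opNorm _ _).trans ?_
      have hx1 : 1 ≤ ‖(f^[n] z).1‖ := H.F.R1.trans h.1
      have h2 := H.F.dub (f^[n] z)
      rw [h.norm, max_eq_right hx1] at h2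
      rw [max_eq_right hx1] at ih
      have l := H.F.lower _ h.1 h.2
      have l' : ‖(f^[n] z).1‖ ^ d ≤ max 1 ‖(f (f^[n] z)).1‖ / c := by
        rw [le_div_iff₀ c0, mul_comm]; exact l.trans (le_max_right _ _)
      obtain ⟨k, rfl⟩ : ∃ k, d = k + 1 := ⟨d - 1, by have := H.F.hd; omega⟩
      rw [iterate_succ_apply']
      set Q := (C * K ^ (k + 1) / c) with hQ
      have hK' : 1 ≤ K ^ (k + 1) := one_le_pow₀ K1
      calc _ ≤ (C * ‖(f^[n] z).1‖ ^ (k + 1 - 1)) * (Q ^ n * ‖(f^[n] z).1‖ * ‖v‖) := by gcongr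
        _ = C * Q ^ n * ‖v‖ * ‖(f^[n] z).1‖ ^ (k + 1) := by
            simp only [Nat.add_sub_cancel]; ring
        _ ≤ C * Q ^ n * ‖v‖ * (max 1 ‖(f (f^[n] z)).1‖ / c) := by gcongr
        _ = (C * 1 / c) * Q ^ n * max 1 ‖(f (f^[n] z)).1‖ * ‖v‖ := by ring
        _ ≤ Q * Q ^ n * max 1 ‖(f (f^[n] z)).1‖ * ‖v‖ := by
            have : C * 1 / c ≤ Q := by rw [hQ]; gcongr
            gcongr
        _ = _ := by ring
    · exact bd _ fun i hi => (H.notViter h i (by omega)).trans (max_le hKR hKz)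

/-- Approximate Green function. -/
def AG (f : ℂ × ℂ → ℂ × ℂ) (d n : ℕ) (z : ℂ × ℂ) : ℝ :=
  (1 / (2 * (d : ℝ) ^ n)) * Real.log (1 + ‖(f^[n] z).1‖ ^ 2)

/-- Green function. -/
def GG (f : ℂ × ℂ → ℂ × ℂ) (d : ℕ) (z : ℂ × ℂ) : ℝ := limUnder atTop (fun n => AG f d n z)

theorem AG_nonneg (n : ℕ) (z : ℂ × ℂ) : 0 ≤ AG f d n z := by
  unfold AG
  have : 0 ≤ Real.log (1 + ‖(f^[n] z).1‖ ^ 2) := Real.log_nonneg (by nlinarith [norm_nonneg (f^[n] z).1])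
  positivity

theorem HP.dpos (H : HP f g d R C c) : (0 : ℝ) < d := by
  have := H.F.hd
  exact_mod_cast (by omega : 0 < d)

theorem HP.d2 (H : HP f g d R C c) : (2 : ℝ) ≤ d := by
  exact_mod_cast H.F.hd

theorem HP.AG_step (H : HP f g d R C c) (M : ℝ) : ∃ K : ℝ, 0 ≤ K ∧ ∀ z, ‖z‖ ≤ M → ∀ n,
    dist (AG f d n z) (AG f d (n + 1) z) ≤ K * (1 / 2) ^ n := by
  have C1 := H.F.C1
  have c0 := H.F.c0
  set K := max R M with hK
  have K1 : 1 ≤ K := H.F.R1.trans (le_max_left _ _)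
  set Q := 1 + C ^ 2 * K ^ (2 * d) + 2 ^ d / c ^ 2 + (1 + K ^ 2) ^ d with hQ
  have t1 : 0 ≤ C ^ 2 * K ^ (2 * d) := by positivity
  have t2 : 0 ≤ 2 ^ d / c ^ 2 := by positivity
  have t3 : 0 ≤ (1 + K ^ 2) ^ d := by positivity
  have Q1 : 1 ≤ Q := by rw [hQ]; linarith
  have hd2 := H.d2
  have hdp := H.dpos
  refine ⟨Real.log Q, Real.log_nonneg Q1, fun z hz n => ?_⟩
  set x := ‖(f^[n] z).1‖ with hx
  obtain ⟨y, hy⟩ : ∃ y, y = ‖(f^[n + 1] z).1‖ := ⟨_, rfl⟩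
  have x0 : 0 ≤ x := norm_nonneg _
  have y0 : 0 ≤ y := by rw [hy]; exact norm_nonneg _
  have hb : 1 + y ^ 2 ≤ Q * (1 + x ^ 2) ^ d ∧ (1 + x ^ 2) ^ d ≤ Q * (1 + y ^ 2) := by
    rw [iterate_succ_apply' f n z] at hy
    have u := H.F.ub (f^[n] z)
    have hyu : y ≤ C * max 1 ‖f^[n] z‖ ^ d := by rw [hy]; exact (norm_fst_le _).trans u
    by_cases h : Vs R (f^[n] z)
    · have x1 : 1 ≤ x := H.F.R1.trans h.1
      rw [h.norm, max_eq_right x1] at hyu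
      have l := H.F.lower _ h.1 h.2
      rw [← hy] at l
      have hxp : (x ^ d) ^ 2 ≤ (1 + x ^ 2) ^ d := by
        rw [← pow_mul, mul_comm, pow_mul]; gcongr; linarith
      constructor
      · have a1 : y ^ 2 ≤ C ^ 2 * (1 + x ^ 2) ^ d := by
          calc y ^ 2 ≤ (C * x ^ d) ^ 2 := by gcongr
            _ = C ^ 2 * (x ^ d) ^ 2 := by ring
            _ ≤ _ := by gcongr
        have a2 : 1 ≤ (1 + x ^ 2) ^ d := one_le_pow₀ (by nlinarith)
        have a3 : 1 ≤ K ^ (2 * d) := one_le_pow₀ K1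
        have : 1 + C ^ 2 ≤ Q := by rw [hQ]; nlinarith [sq_nonneg C]
        nlinarith
      · have a1 : (1 + x ^ 2) ^ d ≤ 2 ^ d * (x ^ d) ^ 2 := by
          rw [← pow_mul, mul_comm d 2, pow_mul, ← mul_pow]; gcongr; nlinarith
        have a2 : c ^ 2 * (x ^ d) ^ 2 ≤ y ^ 2 := by
          rw [← mul_pow]; gcongr
        have a3 : 2 ^ d * (x ^ d) ^ 2 = 2 ^ d / c ^ 2 * (c ^ 2 * (x ^ d) ^ 2) := by field_simp
        calc _ ≤ 2 ^ d / c ^ 2 * (c ^ 2 * (x ^ d) ^ 2) := by rw [← a3]; exact a1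
          _ ≤ Q * (1 + y ^ 2) := by
            gcongr
            · rw [hQ]; linarith
            · linarith
    · have h1 : ‖f^[n] z‖ ≤ K := (H.notViter h n le_rfl).trans (max_le_max le_rfl hz)
      have h2 : max 1 ‖f^[n] z‖ ≤ K := max_le K1 h1
      have hy' : y ≤ C * K ^ d := hyu.trans (by gcongr)
      have hx' : x ≤ K := (norm_fst_le _).trans h1
      constructor
      · have a1 : y ^ 2 ≤ C ^ 2 * K ^ (2 * d) := by
          calc y ^ 2 ≤ (C * K ^ d) ^ 2 := by gcongr
            _ = _ := by rw [mul_pow, ← pow_mul, mul_comm d 2]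
        have a2 : 1 ≤ (1 + x ^ 2) ^ d := one_le_pow₀ (by nlinarith)
        calc _ ≤ Q * 1 := by rw [hQ]; linarith
          _ ≤ _ := by gcongr
      · calc (1 + x ^ 2) ^ d ≤ (1 + K ^ 2) ^ d := by gcongr
          _ ≤ Q * 1 := by rw [hQ]; linarith
          _ ≤ _ := by gcongr; nlinarith
  have lx : 0 < 1 + x ^ 2 := by positivity
  have ly : 0 < 1 + y ^ 2 := by positivity
  have l1 : Real.log (1 + y ^ 2) ≤ Real.log Q + d * Real.log (1 + x ^ 2) := by
    rw [← Real.log_pow, ← Real.log_mul (by positivity) (by positivity)]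
    exact Real.log_le_log ly hb.1
  have l2 : d * Real.log (1 + x ^ 2) ≤ Real.log Q + Real.log (1 + y ^ 2) := by
    rw [← Real.log_pow, ← Real.log_mul (by positivity) (by positivity)]
    exact Real.log_le_log (by positivity) hb.2
  have e : AG f d n z - AG f d (n + 1) z = (1 / (2 * (d : ℝ) ^ (n + 1))) *
      (d * Real.log (1 + x ^ 2) - Real.log (1 + y ^ 2)) := by
    unfold AG; rw [← hx, ← hy, pow_succ]; field_simp; ring
  rw [Real.dist_eq, e, abs_mul, abs_of_nonneg (by positivity)]
  have l3 : |d * Real.log (1 + x ^ 2) - Real.log (1 + y ^ 2)| ≤ Real.log Q :=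
    abs_le.2 ⟨by linarith, by linarith⟩
  have l4 : 1 / (2 * (d : ℝ) ^ (n + 1)) ≤ (1 / 2) ^ n := by
    rw [one_div_pow]
    apply one_div_le_one_div_of_le (by positivity)
    calc (2 : ℝ) ^ n ≤ d ^ n := by gcongr
      _ ≤ 2 * (d : ℝ) ^ (n + 1) := by
        have : (0 : ℝ) < d ^ n := by positivity
        rw [pow_succ]; nlinarith
  have := Real.log_nonneg Q1
  calc _ ≤ (1 / 2) ^ n * Real.log Q := by gcongr
    _ = _ := mul_comm _ _

theorem HP.AG_conv (H : HP f g d R C c) (M : ℝ) : ∃ K : ℝ, 0 ≤ K ∧ ∀ z, ‖z‖ ≤ M → ∀ n,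
    |AG f d n z - GG f d z| ≤ K * (1 / 2) ^ n := by
  obtain ⟨K, hK0, hK⟩ := H.AG_step M
  refine ⟨K * 2, by positivity, fun z hz n => ?_⟩
  have hc : CauchySeq fun n => AG f d n z :=
    cauchySeq_of_le_geometric (1/2) K (by norm_num) (hK z hz)
  have ht : Tendsto (fun n => AG f d n z) atTop (𝓝 (GG f d z)) := hc.tendsto_limUnder
  have := dist_le_of_le_geometric_of_tendsto (1/2) K (by norm_num) (hK z hz) ht n
  rw [Real.dist_eq] at this
  refine this.trans (le_of_eq ?_)
  ring

theorem HP.AG_tendsto (H : HP f g d R C c) (z : ℂ × ℂ) :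
    Tendsto (fun n => AG f d n z) atTop (𝓝 (GG f d z)) := by
  obtain ⟨K, hK0, hK⟩ := H.AG_conv ‖z‖
  rw [tendsto_iff_dist_tendsto_zero]
  refine squeeze_zero (fun _ => dist_nonneg) (fun n => ?_) (g := fun n => K * (1/2 : ℝ) ^ n) ?_
  · rw [Real.dist_eq]; exact hK z le_rfl n
  · simpa using (tendsto_pow_atTop_nhds_zero_of_lt_one (by norm_num : (0:ℝ) ≤ 1/2) (by norm_num)).const_mul K

theorem AG_continuous (hf : Differentiable ℂ f) (n : ℕ) : Continuous (AG f d n) := by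
  unfold AG
  have h1 : Continuous (f^[n]) := hf.continuous.iterate n
  refine continuous_const.mul (Continuous.log ?_ ?_)
  · fun_prop
  · intro z; positivity

theorem HP.GG_continuous (H : HP f g d R C c) : Continuous (GG f d) := by
  have : TendstoLocallyUniformly (fun n => AG f d n) (GG f d) atTop := by
    rw [Metric.tendstoLocallyUniformly_iff]
    intro ε hε z
    obtain ⟨K, hK0, hK⟩ := H.AG_conv (‖z‖ + 1)
    refine ⟨Metric.ball z 1, Metric.ball_mem_nhds z one_pos, ?_⟩
    have ht : Tendsto (fun n => K * (1/2 : ℝ) ^ n) atTop (𝓝 0) := by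
      simpa using (tendsto_pow_atTop_nhds_zero_of_lt_one (by norm_num : (0:ℝ) ≤ 1/2) (by norm_num)).const_mul K
    filter_upwards [ht.eventually_lt_const hε] with n hn y hy
    rw [dist_comm, Real.dist_eq]
    refine (hK y ?_ n).trans_lt hn
    rw [mem_ball_iff_norm] at hy
    have := norm_sub_norm_le y z
    linarith
  exact this.continuous (Frequently.of_forall fun n => AG_continuous H.F.diff n)

theorem HP.GG_nonneg (H : HP f g d R C c) (z : ℂ × ℂ) : 0 ≤ GG f d z :=
  ge_of_tendsto' (H.AG_tendsto z) fun n => AG_nonneg n z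

theorem HP.GG_f (H : HP f g d R C c) (z : ℂ × ℂ) : GG f d (f z) = d * GG f d z := by
  have h1 := H.AG_tendsto (f z)
  have h2 := ((H.AG_tendsto z).comp (tendsto_add_atTop_nat 1)).const_mul (d : ℝ)
  refine tendsto_nhds_unique h1 (h2.congr fun n => ?_)
  simp only [comp_apply, AG, iterate_succ_apply]
  have := H.dpos
  rw [pow_succ]
  field_simp

theorem HP.log_x (H : HP f g d R C c) {z : ℂ × ℂ} (hz : Vs R z) (n : ℕ) :
    (d : ℝ) ^ n * (Real.log ‖z.1‖ + Real.log c) ≤ Real.log ‖(f^[n] z).1‖ + Real.log c := by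
  induction n with
  | zero => simp
  | succ n ih =>
    rw [iterate_succ_apply']
    obtain ⟨h, _⟩ := H.Viter hz n
    have hx : 0 < ‖(f^[n] z).1‖ := by have := H.F.R1.trans h.1; linarith
    have l := Real.log_le_log (by have := H.F.c0; positivity) (H.F.lower _ h.1 h.2)
    rw [Real.log_mul H.F.c0.ne' (by positivity), Real.log_pow] at l
    have lc := Real.log_nonpos H.F.c0.le H.F.c1
    have hd := H.d2
    have : (d : ℝ) * (d ^ n * (Real.log ‖z.1‖ + Real.log c)) ≤ d * (Real.log ‖(f^[n] z).1‖ + Real.log c) := by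
      gcongr
    rw [pow_succ]
    nlinarith

theorem HP.log_x' (H : HP f g d R C c) {z : ℂ × ℂ} (hz : Vs R z) (n : ℕ) :
    (d : ℝ) ^ n * (Real.log ‖z.1‖ + Real.log c) ≤ Real.log ‖(f^[n] z).1‖ := by
  have := H.log_x hz n
  have lc := Real.log_nonpos H.F.c0.le H.F.c1
  linarith

theorem HP.GG_V (H : HP f g d R C c) {z : ℂ × ℂ} (hz : Vs R z) :
    Real.log ‖z.1‖ + Real.log c ≤ GG f d z := by
  refine ge_of_tendsto' (H.AG_tendsto z) fun n => ?_
  have h := H.log_x' hz n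
  obtain ⟨h', _⟩ := H.Viter hz n
  have hx : 0 < ‖(f^[n] z).1‖ := by have := H.F.R1.trans h'.1; linarith
  unfold AG
  have l : Real.log (‖(f^[n] z).1‖ ^ 2) ≤ Real.log (1 + ‖(f^[n] z).1‖ ^ 2) :=
    Real.log_le_log (by positivity) (by linarith)
  rw [Real.log_pow] at l
  have hd := H.dpos
  have hdn : (0 : ℝ) < d ^ n := by positivity
  rw [one_div, inv_mul_eq_div, le_div_iff₀ (by positivity)]
  push_cast at l
  linarith

theorem HP.GG_zero_orbit (H : HP f g d R C c) {z : ℂ × ℂ} (hz : GG f d z = 0) (n : ℕ) :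
    ¬ Vs R (f^[n] z) ∧ ‖f^[n] z‖ ≤ max R ‖z‖ := by
  have h0 : ∀ n, GG f d (f^[n] z) = 0 := by
    intro n
    induction n with
    | zero => exact hz
    | succ n ih => rw [iterate_succ_apply', H.GG_f, ih, mul_zero]
  have h1 : ¬ Vs R (f^[n] z) := by
    intro h
    have h2 := H.GG_V h
    rw [h0 n] at h2
    have R1 := H.F.R1
    have c0 := H.F.c0
    have hx : 0 < ‖(f^[n] z).1‖ := by have := R1.trans h.1; linarith
    rw [← Real.log_mul hx.ne' c0.ne'] at h2
    have h3 : 0 < Real.log (‖(f^[n] z).1‖ * c) := by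
      apply Real.log_pos
      have := H.cR2
      have := h.1
      nlinarith
    linarith
  exact ⟨h1, H.notViter h1 n le_rfl⟩

/-- An entire function vanishing on a slice of the filled Julia set vanishes. -/
theorem HP.lemma_h (H : HP f g d R C c) {h : ℂ → ℂ} (hh : Differentiable ℂ h) (y : ℂ)
    (hv : ∀ x, GG f d (x, y) = 0 → h x = 0) (x : ℂ) : h x = 0 := by
  by_contra hx1
  wlog hnorm : h x = 1 generalizing h
  · refine this (h := fun w => h w / h x) (hh.div_const _) ?_ ?_ ?_
    · intro w hw; simp [hv w hw]
    · simp [hx1]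
    · simp [hx1]
  clear hx1
  set g₀ := GG f d (x, y) with hg0
  have g0n : 0 ≤ g₀ := H.GG_nonneg _
  have hd := H.d2
  obtain ⟨ρ, hρ1, hρ2, hρ3, hρ4⟩ : ∃ ρ, ‖x‖ < ρ ∧ R ≤ ρ ∧ ‖y‖ ≤ ρ ∧ g₀ + 2 ≤ Real.log ρ + Real.log c := by
    have h1 := (Real.tendsto_log_atTop).eventually_ge_atTop (g₀ + 2 - Real.log c)
    obtain ⟨ρ, a1, a2, a3, a4⟩ := (((eventually_gt_atTop ‖x‖).and ((eventually_ge_atTop R).and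
      ((eventually_ge_atTop ‖y‖).and h1)))).exists
    exact ⟨ρ, a1, a2, a3, by linarith⟩
  obtain ⟨M, hM⟩ := (isCompact_closedBall (0 : ℂ) ρ).exists_bound_of_continuousOn hh.continuous.continuousOn
  have M1 : 1 ≤ M := by
    have := hM x (by simpa using hρ1.le)
    rwa [hnorm, norm_one] at this
  obtain ⟨j, hj⟩ : ∃ j : ℕ, Real.log M ≤ (d : ℝ) ^ j :=
    ((tendsto_pow_atTop_atTop_of_one_lt (by linarith : (1 : ℝ) < d)).eventually_ge_atTop (Real.log M)).exists
  set δ := Real.exp (-((d : ℝ) ^ j * (g₀ + 1))) with hδ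
  have δ0 : 0 < δ := Real.exp_pos _
  have δ1 : δ < 1 := by
    rw [hδ, Real.exp_lt_one_iff, neg_lt_zero]
    have : (0 : ℝ) < d ^ j := by positivity
    positivity
  set S : Set ℂ := Metric.closedBall 0 ρ ∩ {w | δ ≤ ‖h w‖} with hS
  have cS : IsCompact S := (isCompact_closedBall _ _).inter_right (isClosed_le continuous_const hh.continuous.norm)
  have xS : x ∈ S := ⟨by simpa using hρ1.le, by simp [hnorm, δ1.le]⟩
  have cG : Continuous fun w : ℂ => GG f d (w, y) := H.GG_continuous.comp (by fun_prop)
  obtain ⟨w₀, hw₀, hmin⟩ := cS.exists_isMinOn ⟨x, xS⟩ cG.continuousOn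
  set γ := GG f d (w₀, y) with hγ
  have γ0 : 0 < γ := by
    refine lt_of_le_of_ne (H.GG_nonneg _) fun e => ?_
    have := hv w₀ e.symm
    have h2 := hw₀.2
    simp [this] at h2
    linarith
  obtain ⟨K, K0, hK⟩ := H.AG_conv (max ρ ‖y‖)
  have hKt : Tendsto (fun n => K * (1/2 : ℝ) ^ n) atTop (𝓝 0) := by
    simpa using (tendsto_pow_atTop_nhds_zero_of_lt_one (by norm_num : (0:ℝ) ≤ 1/2) (by norm_num)).const_mul K
  have hdt := (tendsto_pow_atTop_atTop_of_one_lt (by linarith : (1 : ℝ) < d)).eventually_ge_atTop (1 / γ)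
  obtain ⟨n, hnj, hn1, hn2, hn3⟩ := ((eventually_ge_atTop j).and ((hKt.eventually_lt_const (half_pos γ0)).and
    ((hKt.eventually_lt_const one_half_pos).and hdt))).exists
  have hnorm2 : ∀ w ∈ Metric.closedBall (0 : ℂ) ρ, ‖((w, y) : ℂ × ℂ)‖ ≤ max ρ ‖y‖ := by
    intro w hw
    rw [Prod.norm_def]
    exact max_le_max (by simpa using hw) le_rfl
  set X : ℂ → ℂ := fun w => (f^[n] (w, y)).1 with hX
  have dX : Differentiable ℂ X := by
    have : Differentiable ℂ (f^[n]) := H.F.diff.iterate n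
    exact (this.comp (by fun_prop : Differentiable ℂ fun w : ℂ => (w, y))).fst
  have Xne : ∀ w ∈ S, X w ≠ 0 := by
    intro w hw e
    have h1 := hK (w, y) (hnorm2 w hw.1) n
    have h2 : AG f d n (w, y) = 0 := by
      unfold AG
      have : (f^[n] (w, y)).1 = 0 := e
      rw [this]; simp
    have h3 : γ ≤ GG f d (w, y) := hmin hw
    rw [h2, zero_sub, abs_neg, abs_of_nonneg (H.GG_nonneg _)] at h1
    linarith
  set m := d ^ (n - j) with hm
  set U : Set ℂ := Metric.ball 0 ρ ∩ {w | δ < ‖h w‖} with hU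
  have oU : IsOpen U := Metric.isOpen_ball.inter (isOpen_lt continuous_const hh.continuous.norm)
  have clU : closure U ⊆ S := by
    refine closure_minimal ?_ cS.isClosed
    rintro w ⟨h1, h2⟩
    exact ⟨Metric.ball_subset_closedBall h1, (mem_setOf.1 h2).le⟩
  have bU : Bornology.IsBounded U := Metric.isBounded_ball.subset inter_subset_left
  have hfront : ∀ w ∈ frontier U, ‖h w ^ m / X w‖ ≤ Real.exp (-((d : ℝ) ^ n * (g₀ + 1))) := by
    intro w hw
    have hwS : w ∈ S := clU hw.1
    have hwU : w ∉ U := by rw [oU.frontier_eq] at hw; exact hw.2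
    have hdm : (m : ℝ) * d ^ j = d ^ n := by
      rw [hm]; push_cast; rw [← pow_add]; congr 1; omega
    rw [norm_div, norm_pow]
    by_cases hball : w ∈ Metric.ball (0 : ℂ) ρ
    · have hle : ‖h w‖ ≤ δ := by
        by_contra hc
        exact hwU ⟨hball, not_le.1 hc⟩
      have h1 := hK (w, y) (hnorm2 w hwS.1) n
      have h3 : γ ≤ GG f d (w, y) := hmin hwS
      have h4 : γ / 2 ≤ AG f d n (w, y) := by rw [abs_le] at h1; linarith
      have hXX : 1 ≤ ‖X w‖ := by
        unfold AG at h4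
        have hdn : (0 : ℝ) < d ^ n := by positivity
        rw [one_div, inv_mul_eq_div, le_div_iff₀ (by positivity)] at h4
        rw [div_le_iff₀ γ0] at hn3
        have h5 : 1 ≤ Real.log (1 + ‖X w‖ ^ 2) := by
          simp only [hX]; linarith
        by_contra hlt
        have h6 : 1 + ‖X w‖ ^ 2 ≤ 2 := by
          have := norm_nonneg (X w)
          nlinarith
        have h7 := Real.log_le_log (by positivity) h6
        have := Real.log_two_lt_d9
        linarith
      calc ‖h w‖ ^ m / ‖X w‖ ≤ ‖h w‖ ^ m := div_le_self (by positivity) hXX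
        _ ≤ δ ^ m := by gcongr
        _ = _ := by
          rw [hδ, ← Real.exp_nat_mul]; congr 1; rw [← hdm]; ring
    · have hwρ : ‖w‖ = ρ := by
        have h1 := hwS.1
        simp at h1 hball
        linarith
      have hV : Vs R ((w, y) : ℂ × ℂ) := ⟨by simpa [hwρ] using hρ2, by simpa [hwρ] using hρ3⟩
      have hl := H.log_x' hV n
      simp only [hwρ] at hl
      have hX0 : 0 < ‖X w‖ := norm_pos_iff.2 (Xne w hwS)
      have hl2 : Real.exp ((d : ℝ) ^ n * (g₀ + 2)) ≤ ‖X w‖ := by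
        rw [← Real.le_log_iff_exp_le hX0]
        refine le_trans ?_ hl
        gcongr
      have hM' : ‖h w‖ ^ m ≤ Real.exp (d ^ n) := by
        calc ‖h w‖ ^ m ≤ M ^ m := by gcongr; exact hM w hwS.1
          _ = Real.exp (m * Real.log M) := by rw [Real.exp_nat_mul, Real.exp_log (by linarith)]
          _ ≤ _ := by rw [Real.exp_le_exp, ← hdm]; gcongr
      calc _ ≤ Real.exp (d ^ n) / Real.exp ((d : ℝ) ^ n * (g₀ + 2)) := by gcongr
        _ = _ := by rw [← Real.exp_sub]; congr 1; ring
  have hdc : DiffContOnCl ℂ (fun w => h w ^ m / X w) U := by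
    refine DifferentiableOn.diffContOnCl fun w hw => ?_
    exact (((hh w).pow m).div (dX w) (Xne w (clU hw))).differentiableWithinAt
  have hxU : x ∈ U := ⟨by simpa using hρ1, by simp [hnorm, δ1]⟩
  have hfin := Complex.norm_le_of_forall_mem_frontier_norm_le bU hdc hfront (subset_closure hxU)
  simp only [hnorm, one_pow, norm_div, norm_one] at hfin
  have hX0 : 0 < ‖X x‖ := norm_pos_iff.2 (Xne x xS)
  rw [Real.exp_neg, ← one_div, one_div_le_one_div hX0 (Real.exp_pos _),
    ← Real.le_log_iff_exp_le hX0] at hfin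
  have h1 := hK (x, y) (hnorm2 x xS.1) n
  have h2 : g₀ + 1 ≤ AG f d n (x, y) := by
    unfold AG
    have hdn : (0 : ℝ) < d ^ n := by positivity
    rw [one_div, inv_mul_eq_div, le_div_iff₀ (by positivity)]
    have l : Real.log (‖X x‖ ^ 2) ≤ Real.log (1 + ‖X x‖ ^ 2) :=
      Real.log_le_log (by positivity) (by linarith)
    rw [Real.log_pow] at l
    push_cast at l
    simp only [hX] at l hfin
    linarith
  rw [abs_le] at h1
  linarith

end Dyn
end

noncomputable section


/-- local uniform convergence, quantitative form -/
def LU {F : Type*} [NormedAddCommGroup F] (u : ℕ → F → ℂ) (U : F → ℂ) : Prop :=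
  ∀ M : ℝ, ∃ δ : ℕ → ℝ, Tendsto δ atTop (𝓝 0) ∧ ∀ n e, ‖e‖ ≤ M → ‖u n e - U e‖ ≤ δ n

section
variable {F : Type*} [NormedAddCommGroup F] [NormedSpace ℂ F] [NormedSpace ℝ F]
  [IsScalarTower ℝ ℂ F] [FiniteDimensional ℝ F] [MeasurableSpace F] [BorelSpace F]
  (μ : MeasureTheory.Measure F) [μ.IsAddHaarMeasure]

theorem integral_conv_LU {u : ℕ → F → ℂ} {U L : F → ℂ} (hu : ∀ n, Continuous (u n))
    (hU : Continuous U) (hL : Continuous L) (hc : HasCompactSupport L) (h : LU u U) :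
    Tendsto (fun n => ∫ e, u n e * L e ∂μ) atTop (𝓝 (∫ e, U e * L e ∂μ)) := by
  obtain ⟨M, hM, hM'⟩ := exists_ball_of_compactSupport hc
  obtain ⟨δ, hδ, hb⟩ := h M
  have iL : MeasureTheory.Integrable (fun e => ‖L e‖) μ :=
    (hL.integrable_of_hasCompactSupport hc).norm
  have i1 : ∀ n, MeasureTheory.Integrable (fun e => u n e * L e) μ := fun n =>
    ((hu n).mul hL).integrable_of_hasCompactSupport hc.mul_left
  have i2 : MeasureTheory.Integrable (fun e => U e * L e) μ :=
    (hU.mul hL).integrable_of_hasCompactSupport hc.mul_left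
  rw [tendsto_iff_norm_sub_tendsto_zero]
  refine squeeze_zero (g := fun n => δ n * ∫ e, ‖L e‖ ∂μ) (fun n => norm_nonneg _) ?_
    (by simpa using hδ.mul_const (∫ e, ‖L e‖ ∂μ))
  intro n
  rw [← MeasureTheory.integral_sub (i1 n) i2, ← MeasureTheory.integral_const_mul]
  refine MeasureTheory.norm_integral_le_of_norm_le (iL.const_mul _) (Eventually.of_forall ?_)
  intro e
  rw [← sub_mul, norm_mul]
  by_cases he : ‖e‖ ≤ M
  · exact mul_le_mul_of_nonneg_right (hb n e he) (norm_nonneg _)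
  · have : L e = 0 := image_eq_zero_of_notMem_tsupport (hM' e (not_le.1 he))
    simp [this]

theorem Lv_conv {u : ℕ → F → ℂ} {U m : F → ℂ} (hu : ∀ n, Sm (u n)) (hU : Continuous U)
    (hm : Sm m) (hc : HasCompactSupport m) (h : LU u U) (v w : F) :
    Tendsto (fun n => ∫ e, Lv (u n) v w e * m e ∂μ) atTop (𝓝 (∫ e, U e * Lv m v w e ∂μ)) := by
  simp only [Lv_ibp μ (hu _) hm hc]
  exact integral_conv_LU μ (fun n => (hu n).continuous) hU (hm.Lv v w).continuous
    (hasCompactSupport_Wi (hasCompactSupport_Wi hc _ _) _ _) h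

end

abbrev EE := ℂ × ℂ

instance haarEE : (MeasureTheory.volume : MeasureTheory.Measure EE).IsAddHaarMeasure :=
  MeasureTheory.Measure.prod.instIsAddHaarMeasure _ _

theorem integral_sum4 {α : Type*} [MeasurableSpace α] {μ : MeasureTheory.Measure α}
    {A B C D : α → ℂ} (hA : MeasureTheory.Integrable A μ) (hB : MeasureTheory.Integrable B μ)
    (hC : MeasureTheory.Integrable C μ) (hD : MeasureTheory.Integrable D μ) :
    ∫ e, (A e + B e + C e + D e) ∂μ =
      (∫ e, A e ∂μ) + (∫ e, B e ∂μ) + (∫ e, C e ∂μ) + ∫ e, D e ∂μ := by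
  have h1 := MeasureTheory.integral_add hA hB
  have h2 := MeasureTheory.integral_add (hA.add hB) hC
  have h3 := MeasureTheory.integral_add ((hA.add hB).add hC) hD
  simp only [Pi.add_apply] at h1 h2 h3
  rw [h3, h2, h1]

theorem EE_decomp (x : EE) : x = x.1 • ((1, 0) : EE) + x.2 • ((0, 1) : EE) := by
  ext <;> simp

theorem Lv_XX {u : EE → ℂ} (hu : Sm u) (x e : EE) : Lv u x x e =
    Lv u (1,0) (1,0) e * (x.1 * (starRingEnd ℂ) x.1) + Lv u (1,0) (0,1) e * (x.1 * (starRingEnd ℂ) x.2)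
    + Lv u (0,1) (1,0) e * (x.2 * (starRingEnd ℂ) x.1) + Lv u (0,1) (0,1) e * (x.2 * (starRingEnd ℂ) x.2) := by
  conv_lhs => rw [EE_decomp x]
  rw [Lv_dir_left_add hu, Lv_dir_right_add, Lv_dir_right_add, Lv_dir_left_smul hu, Lv_dir_left_smul hu,
    Lv_dir_left_smul hu, Lv_dir_left_smul hu, Lv_dir_right_smul, Lv_dir_right_smul, Lv_dir_right_smul,
    Lv_dir_right_smul]
  ring

/-- test function `χ a conj b` -/
def mf (χ : EE → ℝ) (a b : EE → ℂ) (e : EE) : ℂ := (χ e : ℂ) * (a e * (starRingEnd ℂ) (b e))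

theorem mf_sm {χ : EE → ℝ} (hχ : ContDiff ℝ (⊤ : ℕ∞) χ) {a b : EE → ℂ} (ha : Differentiable ℂ a)
    (hb : Differentiable ℂ b) : Sm (mf χ a b) :=
  (Complex.ofRealCLM.contDiff.comp hχ).mul ((sm_of_entire ha).mul (sm_of_entire hb).conj)

theorem mf_cs {χ : EE → ℝ} (hχ : HasCompactSupport χ) (a b : EE → ℂ) : HasCompactSupport (mf χ a b) :=
  (hχ.comp_left (g := fun x : ℝ => (x : ℂ)) (by simp)).mul_right

open MeasureTheory in
def Qf (U : EE → ℂ) (X : EE → EE) (χ : EE → ℝ) : ℂ :=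
  (∫ e, U e * Lv (mf χ (fun z => (X z).1) (fun z => (X z).1)) (1,0) (1,0) e) +
  (∫ e, U e * Lv (mf χ (fun z => (X z).1) (fun z => (X z).2)) (1,0) (0,1) e) +
  (∫ e, U e * Lv (mf χ (fun z => (X z).2) (fun z => (X z).1)) (0,1) (1,0) e) +
  (∫ e, U e * Lv (mf χ (fun z => (X z).2) (fun z => (X z).2)) (0,1) (0,1) e)

theorem LvX_int {X : EE → EE} (hX : Differentiable ℂ X) {χ : EE → ℝ}
    (hχ : ContDiff ℝ (⊤ : ℕ∞) χ) (hc : HasCompactSupport χ) {u : EE → ℂ} (hu : Sm u) :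
    ∫ e, (χ e : ℂ) * Lv u (X e) (X e) e =
    (∫ e, Lv u (1,0) (1,0) e * mf χ (fun z => (X z).1) (fun z => (X z).1) e) +
    (∫ e, Lv u (1,0) (0,1) e * mf χ (fun z => (X z).1) (fun z => (X z).2) e) +
    (∫ e, Lv u (0,1) (1,0) e * mf χ (fun z => (X z).2) (fun z => (X z).1) e) +
    (∫ e, Lv u (0,1) (0,1) e * mf χ (fun z => (X z).2) (fun z => (X z).2) e) := by
  have h1 : Differentiable ℂ (fun z => (X z).1) := hX.fst
  have h2 : Differentiable ℂ (fun z => (X z).2) := hX.snd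
  have ii : ∀ (v w : EE) (a b : EE → ℂ), Differentiable ℂ a → Differentiable ℂ b →
      MeasureTheory.Integrable (fun e => Lv u v w e * mf χ a b e) := fun v w a b ha hb =>
    ((hu.Lv v w).continuous.mul (mf_sm hχ ha hb).continuous).integrable_of_hasCompactSupport
      (mf_cs hc a b).mul_left
  rw [← integral_sum4 (ii _ _ _ _ h1 h1) (ii _ _ _ _ h1 h2) (ii _ _ _ _ h2 h1) (ii _ _ _ _ h2 h2)]
  congr 1; funext e
  rw [Lv_XX hu]; simp only [mf]; ring

theorem LvX_conv {X : EE → EE} (hX : Differentiable ℂ X) {χ : EE → ℝ}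
    (hχ : ContDiff ℝ (⊤ : ℕ∞) χ) (hc : HasCompactSupport χ) {u : ℕ → EE → ℂ} {U : EE → ℂ}
    (hu : ∀ n, Sm (u n)) (hU : Continuous U) (h : LU u U) :
    Tendsto (fun n => ∫ e, (χ e : ℂ) * Lv (u n) (X e) (X e) e) atTop (𝓝 (Qf U X χ)) := by
  simp only [LvX_int hX hχ hc (hu _)]
  have h1 : Differentiable ℂ (fun z => (X z).1) := hX.fst
  have h2 : Differentiable ℂ (fun z => (X z).2) := hX.snd
  exact (((Lv_conv MeasureTheory.volume hu hU (mf_sm hχ h1 h1) (mf_cs hc _ _) h _ _).add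
    (Lv_conv MeasureTheory.volume hu hU (mf_sm hχ h1 h2) (mf_cs hc _ _) h _ _)).add
    (Lv_conv MeasureTheory.volume hu hU (mf_sm hχ h2 h1) (mf_cs hc _ _) h _ _)).add
    (Lv_conv MeasureTheory.volume hu hU (mf_sm hχ h2 h2) (mf_cs hc _ _) h _ _)

/-- kernel -/
def Kq (X : EE → EE) (p : EE → ℂ) (k : ℕ) (z : EE) : ℝ :=
  ‖fderiv ℂ p z (X z)‖ ^ 2 / (1 + ‖p z‖ ^ 2) ^ k

def px (f : EE → EE) (n : ℕ) (z : EE) : ℂ := (f^[n] z).1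

/-- mass integrals -/
def II (f : EE → EE) (d : ℕ) (X : EE → EE) (k n : ℕ) (χ : EE → ℝ) : ℝ :=
  (1 / (2 * (d : ℝ) ^ n)) * ∫ e, χ e * Kq X (px f n) k e

/-- The vanishing condition. -/
def HH (f : EE → EE) (d : ℕ) (X : EE → EE) : Prop :=
  ∀ χ : EE → ℝ, ContDiff ℝ (⊤ : ℕ∞) χ → HasCompactSupport χ → (∀ e, 0 ≤ χ e) →
    Tendsto (fun n => II f d X 2 n χ) atTop (𝓝 0)

theorem SS_one (p : EE → ℂ) (e : EE) : SS 1 p (fun _ => 0) e = 1 + ‖p e‖ ^ 2 := by simp [SS]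

theorem Qf_const_mul (c : ℂ) (U : EE → ℂ) (X : EE → EE) (χ : EE → ℝ) :
    Qf (fun e => c * U e) X χ = c * Qf U X χ := by
  simp only [Qf, mul_assoc, MeasureTheory.integral_const_mul]; ring

theorem px_diff {f : EE → EE} (hf : Differentiable ℂ f) (n : ℕ) : Differentiable ℂ (px f n) :=
  (hf.iterate n).fst

theorem HP.II2 {f g : EE → EE} {d : ℕ} {R C c : ℝ} (H : HP f g d R C c) {X : EE → EE}
    (hX : Differentiable ℂ X) {χ : EE → ℝ} (hχ : ContDiff ℝ (⊤ : ℕ∞) χ) (hc : HasCompactSupport χ) :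
    Tendsto (fun n => ((II f d X 2 n χ : ℝ) : ℂ)) atTop (𝓝 (Qf (fun e => (GG f d e : ℂ)) X χ)) := by
  have hp := fun n => px_diff H.F.diff n
  have h0 : Differentiable ℂ (fun _ : EE => (0:ℂ)) := differentiable_const _
  have sm : ∀ n, Sm (LS 1 (px f n) (fun _ => 0)) := fun n => LS_smooth one_pos (hp n) h0
  have := LvX_conv hX hχ hc (u := fun n e => ((1 / (2 * (d : ℝ) ^ n) : ℝ) : ℂ) * LS 1 (px f n) (fun _ => 0) e)
    (U := fun e => (GG f d e : ℂ)) (fun n => contDiff_const.mul (sm n))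
    (Complex.continuous_ofReal.comp H.GG_continuous) ?_
  · refine this.congr fun n => ?_
    simp only [Lv_const_mul _ (sm n), Lv_LS_one (hp n), II, SS_one]
    rw [← MeasureTheory.integral_const_mul, ← integral_complex_ofReal]
    congr 1; funext e
    simp only [Kq]; push_cast
    rw [← Complex.mul_conj' (fderiv ℂ (px f n) e (X e))]; ring
  · intro M
    obtain ⟨K, hK, hb⟩ := H.AG_conv M
    refine ⟨fun n => K * (1/2)^n, by simpa using (tendsto_pow_atTop_nhds_zero_of_lt_one (r := (1/2:ℝ)) (by norm_num) (by norm_num)).const_mul K, fun n e he => ?_⟩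
    have := hb e he n
    simp only [LS, SS_one]
    rw [← Complex.ofReal_mul, ← Complex.ofReal_sub, Complex.norm_real]
    exact this

theorem HP.II3 {f g : EE → EE} {d : ℕ} {R C c : ℝ} (H : HP f g d R C c) {X : EE → EE}
    (hX : Differentiable ℂ X) {χ : EE → ℝ} (hχ : ContDiff ℝ (⊤ : ℕ∞) χ) (hc : HasCompactSupport χ) :
    Tendsto (fun n => ((II f d X 3 n χ : ℝ) : ℂ)) atTop
      (𝓝 ((1/2) * Qf (fun e => (GG f d e : ℂ)) X χ)) := by
  rw [← Qf_const_mul]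
  have hp := fun n => px_diff H.F.diff n
  have sm : ∀ n, Sm (LC (px f n)) := fun n => LC_smooth (hp n)
  have := LvX_conv hX hχ hc (u := fun n e => ((1 / (4 * (d : ℝ) ^ n) : ℝ) : ℂ) * LC (px f n) e)
    (U := fun e => (1/2) * (GG f d e : ℂ)) (fun n => contDiff_const.mul (sm n))
    (continuous_const.mul (Complex.continuous_ofReal.comp H.GG_continuous)) ?_
  · refine this.congr fun n => ?_
    simp only [Lv_const_mul _ (sm n), Lv_LC (hp n), II, SS_one]
    rw [← MeasureTheory.integral_const_mul, ← integral_complex_ofReal]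
    congr 1; funext e
    have : (d:ℂ)^n ≠ 0 := by
      have := pow_pos H.dpos n
      exact_mod_cast this.ne'
    simp only [Kq]; push_cast
    rw [← Complex.mul_conj' (fderiv ℂ (px f n) e (X e))]; field_simp; ring
  · intro M
    obtain ⟨K, hK, hb⟩ := H.AG_conv M
    refine ⟨fun n => (K + 1) * (1/2)^n, by simpa using (tendsto_pow_atTop_nhds_zero_of_lt_one (r := (1/2:ℝ)) (by norm_num) (by norm_num)).const_mul (K + 1), fun n e he => ?_⟩
    have h1 := hb e he n
    simp only [LC, SS_one]
    have h2 : ((1/2 : ℂ)) * (GG f d e : ℂ) = ((1/2 * GG f d e : ℝ) : ℂ) := by push_cast; ring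
    rw [h2, ← Complex.ofReal_mul, ← Complex.ofReal_sub, Complex.norm_real, Real.norm_eq_abs]
    have h3 : (2:ℝ)^n ≤ (d:ℝ)^n := pow_le_pow_left₀ (by norm_num) (by exact_mod_cast H.F.hd) n
    have h4 : 1 / (4 * (d : ℝ)^n) ≤ (1/2)^n := by
      rw [one_div_pow]; apply one_div_le_one_div_of_le (by positivity)
      have : (0:ℝ) < 2^n := by positivity
      linarith
    have hs : 1 ≤ 1 + ‖px f n e‖^2 := by nlinarith [sq_nonneg ‖px f n e‖]
    have h5 : (1 + ‖px f n e‖^2)⁻¹ ≤ 1 := inv_le_one_of_one_le₀ hs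
    have h6 : 0 ≤ (1 + ‖px f n e‖^2)⁻¹ := by positivity
    have e1 : 1 / (4 * (d : ℝ) ^ n) * (Real.log (1 + ‖px f n e‖ ^ 2) - (1 + ‖px f n e‖ ^ 2)⁻¹) - 1 / 2 * GG f d e
      = 1/2 * (AG f d n e - GG f d e) - 1 / (4 * (d : ℝ) ^ n) * (1 + ‖px f n e‖ ^ 2)⁻¹ := by
      simp only [AG, px]
      have := (pow_pos H.dpos n).ne'
      field_simp; ring
    rw [e1]
    refine (abs_sub _ _).trans ?_
    rw [abs_mul, abs_mul, abs_of_nonneg h6]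
    have h7 : (0:ℝ) < 1 / (4 * (d : ℝ) ^ n) := by have := pow_pos H.dpos n; positivity
    rw [abs_of_pos h7]
    have h8 : (0:ℝ) < (1/2)^n := by positivity
    have h9 : |(1/2:ℝ)| = 1/2 := by norm_num
    rw [h9]
    have h10 : 1 / (4 * (d : ℝ) ^ n) * (1 + ‖px f n e‖ ^ 2)⁻¹ ≤ (1/2)^n * 1 := by gcongr
    nlinarith [mul_nonneg hK h8.le]

theorem II_nonneg (f : EE → EE) (d : ℕ) (X : EE → EE) (k n : ℕ) {χ : EE → ℝ} (h : ∀ e, 0 ≤ χ e) :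
    0 ≤ II f d X k n χ := by
  refine mul_nonneg (by positivity) (MeasureTheory.integral_nonneg fun e => ?_)
  have := h e
  simp only [Kq, Pi.zero_apply]; positivity

theorem HP.notHH {f g : EE → EE} {d : ℕ} {R C c : ℝ} (H : HP f g d R C c) {X : EE → EE}
    (hX : Differentiable ℂ X) (h : ¬ HH f d X) :
    ∃ χ : EE → ℝ, ContDiff ℝ (⊤ : ℕ∞) χ ∧ HasCompactSupport χ ∧ (∀ e, 0 ≤ χ e) ∧
      ∃ q : ℝ, 0 < q ∧ Tendsto (fun n => II f d X 3 n χ) atTop (𝓝 q) := by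
  simp only [HH] at h
  push Not at h
  obtain ⟨χ, h1, h2, h3, h4⟩ := h
  refine ⟨χ, h1, h2, h3, ?_⟩
  have t2 := (Complex.continuous_re.tendsto _).comp (H.II2 hX h1 h2)
  have t3 := (Complex.continuous_re.tendsto _).comp (H.II3 hX h1 h2)
  simp only [Function.comp_def, Complex.ofReal_re] at t2 t3
  refine ⟨_, ?_, t3⟩
  have e : ((1/2 : ℂ) * Qf (fun e => (GG f d e : ℂ)) X χ).re = 1/2 * (Qf (fun e => (GG f d e : ℂ)) X χ).re := by
    have : (1/2 : ℂ) = ((1/2 : ℝ) : ℂ) := by push_cast; ring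
    rw [this, Complex.re_ofReal_mul]
  rw [e]
  have n0 : 0 ≤ (Qf (fun e => (GG f d e : ℂ)) X χ).re :=
    ge_of_tendsto' t2 fun n => II_nonneg f d X 2 n h3
  rcases n0.lt_or_eq with h5 | h5
  · linarith
  · rw [← h5] at t2; exact absurd t2 h4
end

noncomputable section


abbrev E4 := EE × EE

instance haarE4 : (MeasureTheory.volume : MeasureTheory.Measure E4).IsAddHaarMeasure :=
  MeasureTheory.Measure.prod.instIsAddHaarMeasure _ _

def ba (i : Fin 2) : E4 := (![((1,0) : EE), (0,1)] i, 0)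
def bb (i : Fin 2) : E4 := (0, ![((1,0) : EE), (0,1)] i)
def cf (x : EE) (i : Fin 2) : ℂ := ![x.1, x.2] i

/-- determinant of the Levi form on two vectors -/
def DD (u : E4 → ℂ) (v w e : E4) : ℂ := Lv u v v e * Lv u w w e - Lv u v w e * Lv u w v e

theorem Lv_exp2 {u : E4 → ℂ} (hu : Sm u) (a b : Fin 2 → E4) (x y : Fin 2 → ℂ) (e : E4) :
    Lv u (x 0 • a 0 + x 1 • a 1) (y 0 • b 0 + y 1 • b 1) e =
      Lv u (a 0) (b 0) e * (x 0 * (starRingEnd ℂ) (y 0)) + Lv u (a 0) (b 1) e * (x 0 * (starRingEnd ℂ) (y 1))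
      + Lv u (a 1) (b 0) e * (x 1 * (starRingEnd ℂ) (y 0)) + Lv u (a 1) (b 1) e * (x 1 * (starRingEnd ℂ) (y 1)) := by
  rw [Lv_dir_left_add hu, Lv_dir_right_add, Lv_dir_right_add, Lv_dir_left_smul hu, Lv_dir_left_smul hu,
    Lv_dir_left_smul hu, Lv_dir_left_smul hu, Lv_dir_right_smul, Lv_dir_right_smul, Lv_dir_right_smul,
    Lv_dir_right_smul]
  ring

theorem inl_exp (x : EE) : ((x, 0) : E4) = cf x 0 • ba 0 + cf x 1 • ba 1 := by
  ext <;> simp [cf, ba]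
theorem inr_exp (x : EE) : ((0, x) : E4) = cf x 0 • bb 0 + cf x 1 • bb 1 := by
  ext <;> simp [cf, bb]

abbrev I4 := Fin 2 × Fin 2 × Fin 2 × Fin 2

def wt (x y : EE) (t : I4) : ℂ := cf x t.1 * (starRingEnd ℂ) (cf x t.2.1) * (cf y t.2.2.1 *
  (starRingEnd ℂ) (cf y t.2.2.2))

def dt (u : E4 → ℂ) (t : I4) (e : E4) : ℂ :=
  Lv u (ba t.1) (ba t.2.1) e * Lv u (bb t.2.2.1) (bb t.2.2.2) e -
    Lv u (ba t.1) (bb t.2.2.2) e * Lv u (bb t.2.2.1) (ba t.2.1) e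

theorem DD_exp {u : E4 → ℂ} (hu : Sm u) (x y : EE) (e : E4) :
    DD u (x, 0) (0, y) e = ∑ t : I4, wt x y t * dt u t e := by
  rw [DD, inl_exp, inr_exp, Lv_exp2 hu, Lv_exp2 hu, Lv_exp2 hu, Lv_exp2 hu]
  simp only [Fintype.sum_prod_type, Fin.sum_univ_two, wt, dt]
  ring

theorem cf_diff {X : EE → EE} (hX : Differentiable ℂ X) (i : Fin 2) : Differentiable ℂ (fun z => cf (X z) i) := by
  fin_cases i
  · exact hX.fst
  · exact hX.snd

def mtf (χ χ' : EE → ℝ) (X Y : EE → EE) (t : I4) (e : E4) : ℂ :=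
  ((χ e.1 : ℝ) : ℂ) * ((χ' e.2 : ℝ) : ℂ) * wt (X e.1) (Y e.2) t

theorem cs_prod {χ χ' : EE → ℝ} (h : HasCompactSupport χ) (h' : HasCompactSupport χ') :
    HasCompactSupport (fun e : E4 => ((χ e.1 : ℝ) : ℂ) * ((χ' e.2 : ℝ) : ℂ)) := by
  refine HasCompactSupport.intro (K := tsupport χ ×ˢ tsupport χ') (h.prod h') ?_
  intro e he
  rw [Set.mem_prod, not_and_or] at he
  rcases he with he | he
  · simp [image_eq_zero_of_notMem_tsupport he]
  · simp [image_eq_zero_of_notMem_tsupport he]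

theorem mtf_cs {χ χ' : EE → ℝ} (h : HasCompactSupport χ) (h' : HasCompactSupport χ') (X Y : EE → EE) (t : I4) :
    HasCompactSupport (mtf χ χ' X Y t) := (cs_prod h h').mul_right

theorem chi_sm {χ χ' : EE → ℝ} (h : ContDiff ℝ (⊤ : ℕ∞) χ) (h' : ContDiff ℝ (⊤ : ℕ∞) χ') :
    Sm (fun e : E4 => ((χ e.1 : ℝ) : ℂ) * ((χ' e.2 : ℝ) : ℂ)) :=
  (Complex.ofRealCLM.contDiff.comp (h.comp contDiff_fst)).mul
    (Complex.ofRealCLM.contDiff.comp (h'.comp contDiff_snd))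

theorem mtf_sm {χ χ' : EE → ℝ} (h : ContDiff ℝ (⊤ : ℕ∞) χ) (h' : ContDiff ℝ (⊤ : ℕ∞) χ') {X Y : EE → EE}
    (hX : Differentiable ℂ X) (hY : Differentiable ℂ Y) (t : I4) : Sm (mtf χ χ' X Y t) := by
  have sX : ∀ i, Sm (fun e : E4 => cf (X e.1) i) := fun i =>
    (sm_of_entire (cf_diff hX i)).comp contDiff_fst
  have sY : ∀ i, Sm (fun e : E4 => cf (Y e.2) i) := fun i =>
    (sm_of_entire (cf_diff hY i)).comp contDiff_snd
  exact (chi_sm h h').mul (((sX _).mul (sX _).conj).mul ((sY _).mul (sY _).conj))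

theorem MA_XY {u u' : ℕ → E4 → ℂ} (hu : ∀ n, Psh (u n)) (hu' : ∀ n, Psh (u' n))
    (bu : ∀ M : ℝ, ∃ K, ∀ n e, ‖e‖ ≤ M → ‖u n e‖ ≤ K)
    (bu' : ∀ M : ℝ, ∃ K, ∀ n e, ‖e‖ ≤ M → ‖u' n e‖ ≤ K)
    (hd : ∀ M : ℝ, ∃ δ : ℕ → ℝ, Tendsto δ atTop (𝓝 0) ∧ ∀ n e, ‖e‖ ≤ M → ‖u n e - u' n e‖ ≤ δ n)
    {χ χ' : EE → ℝ} (h : ContDiff ℝ (⊤ : ℕ∞) χ) (h' : ContDiff ℝ (⊤ : ℕ∞) χ')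
    (hc : HasCompactSupport χ) (hc' : HasCompactSupport χ') {X Y : EE → EE}
    (hX : Differentiable ℂ X) (hY : Differentiable ℂ Y) :
    Tendsto (fun n => ∫ e : E4, ((χ e.1 : ℝ) : ℂ) * ((χ' e.2 : ℝ) : ℂ) *
      (DD (u n) (X e.1, 0) (0, Y e.2) e - DD (u' n) (X e.1, 0) (0, Y e.2) e)) atTop (𝓝 0) := by
  have key : ∀ t : I4, Tendsto (fun n => ∫ e : E4, mtf χ χ' X Y t e * (dt (u n) t e - dt (u' n) t e)) atTop (𝓝 0) :=
    fun t => MA_convergence MeasureTheory.volume hu hu' bu bu' hd (mtf_sm h h' hX hY t) (mtf_cs hc hc' X Y t) _ _ _ _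
  have := tendsto_finset_sum (Finset.univ : Finset I4) fun t _ => key t
  rw [Finset.sum_const_zero] at this
  refine this.congr fun n => ?_
  have sdt : ∀ t {v : E4 → ℂ}, Psh v → Continuous (dt v t) := fun t v hv =>
    ((hv.sm.Lv _ _).continuous.mul (hv.sm.Lv _ _).continuous).sub
      ((hv.sm.Lv _ _).continuous.mul (hv.sm.Lv _ _).continuous)
  rw [← MeasureTheory.integral_finset_sum]
  · congr 1; funext e
    rw [DD_exp (hu n).sm, DD_exp (hu' n).sm, ← Finset.sum_sub_distrib, Finset.mul_sum]
    refine Finset.sum_congr rfl fun t _ => ?_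
    rw [mtf]; ring
  · intro t _
    exact ((mtf_sm h h' hX hY t).continuous.mul ((sdt t (hu n)).sub (sdt t (hu' n)))).integrable_of_hasCompactSupport
      (mtf_cs hc hc' X Y t).mul_right

/-- the comparison weight -/
theorem DD_prod {p q : EE → ℂ} (hp : Differentiable ℂ p) (hq : Differentiable ℂ q) (x y : EE) (e : E4) :
    DD (LS 1 (fun e : E4 => p e.1) (fun e : E4 => q e.2)) (x, 0) (0, y) e =
      ((‖fderiv ℂ p e.1 x‖ ^ 2 * ‖fderiv ℂ q e.2 y‖ ^ 2 / (1 + ‖p e.1‖ ^ 2 + ‖q e.2‖ ^ 2) ^ 3 : ℝ) : ℂ) := by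
  have d1 : Differentiable ℂ (fun e : E4 => p e.1) := hp.comp differentiable_fst
  have d2 : Differentiable ℂ (fun e : E4 => q e.2) := hq.comp differentiable_snd
  have f1 : ∀ v : E4, fderiv ℂ (fun e : E4 => p e.1) e v = fderiv ℂ p e.1 v.1 := fun v => by
    have := ((hp e.1).hasFDerivAt.comp e (hasFDerivAt_fst (𝕜 := ℂ))).fderiv
    rw [show (fun e : E4 => p e.1) = p ∘ Prod.fst from rfl, this]; rfl
  have f2 : ∀ v : E4, fderiv ℂ (fun e : E4 => q e.2) e v = fderiv ℂ q e.2 v.2 := fun v => by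
    have := ((hq e.2).hasFDerivAt.comp e (hasFDerivAt_snd (𝕜 := ℂ))).fderiv
    rw [show (fun e : E4 => q e.2) = q ∘ Prod.snd from rfl, this]; rfl
  rw [DD, Lv_LS_det one_pos d1 d2]
  simp only [f1, f2, SS]
  simp [mul_pow]

theorem DD_const_mul (c : ℂ) {u : E4 → ℂ} (hu : Sm u) (v w e : E4) :
    DD (fun e => c * u e) v w e = c ^ 2 * DD u v w e := by
  simp only [DD, Lv_const_mul c hu]; ring
end

noncomputable section


def hA (f f' : EE → EE) (n : ℕ) (e : E4) : ℂ := (f^[n] e.1).1 - (f'^[n] e.2).2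
def hB (f f' : EE → EE) (n : ℕ) (e : E4) : ℂ := (f^[n] e.1).2 - (f'^[n] e.2).1
def rr (f f' : EE → EE) (n : ℕ) (e : E4) : ℝ := ‖f^[n] e.1 - sw (f'^[n] e.2)‖

def ηη (n : ℕ) : ℝ := (1/2) ^ (n * n)
def εε (n : ℕ) : ℝ := ηη n ^ 5

theorem ηη_pos (n : ℕ) : 0 < ηη n := by unfold ηη; positivity
theorem ηη_le (n : ℕ) : ηη n ≤ 1 := pow_le_one₀ (by norm_num) (by norm_num)
theorem εε_pos (n : ℕ) : 0 < εε n := pow_pos (ηη_pos n) 5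
theorem εε_le (n : ℕ) : εε n ≤ 1 := pow_le_one₀ (ηη_pos n).le (ηη_le n)

theorem hA_diff {f f' : EE → EE} (hf : Differentiable ℂ f) (hf' : Differentiable ℂ f') (n : ℕ) :
    Differentiable ℂ (hA f f' n) :=
  ((hf.iterate n).comp differentiable_fst).fst.sub ((hf'.iterate n).comp differentiable_snd).snd

theorem hB_diff {f f' : EE → EE} (hf : Differentiable ℂ f) (hf' : Differentiable ℂ f') (n : ℕ) :
    Differentiable ℂ (hB f f' n) :=
  ((hf.iterate n).comp differentiable_fst).snd.sub ((hf'.iterate n).comp differentiable_snd).fst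

theorem hA_le (f f' : EE → EE) (n : ℕ) (e : E4) : ‖hA f f' n e‖ ≤ rr f f' n e :=
  norm_fst_le (f^[n] e.1 - sw (f'^[n] e.2))
theorem hB_le (f f' : EE → EE) (n : ℕ) (e : E4) : ‖hB f f' n e‖ ≤ rr f f' n e :=
  norm_snd_le (f^[n] e.1 - sw (f'^[n] e.2))
theorem rr_sq (f f' : EE → EE) (n : ℕ) (e : E4) :
    rr f f' n e ^ 2 ≤ ‖hA f f' n e‖ ^ 2 + ‖hB f f' n e‖ ^ 2 := by
  have : rr f f' n e = max ‖hA f f' n e‖ ‖hB f f' n e‖ := rfl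
  rw [this]
  rcases le_total ‖hA f f' n e‖ ‖hB f f' n e‖ with h | h
  · rw [max_eq_right h]; nlinarith [sq_nonneg ‖hA f f' n e‖]
  · rw [max_eq_left h]; nlinarith [sq_nonneg ‖hB f f' n e‖]

theorem E4_fst {e : E4} {M : ℝ} (h : ‖e‖ ≤ M) : ‖e.1‖ ≤ M := (norm_fst_le e).trans h
theorem E4_snd {e : E4} {M : ℝ} (h : ‖e‖ ≤ M) : ‖e.2‖ ≤ M := (norm_snd_le e).trans h

section
variable {f g f' g' : EE → EE} {d : ℕ} {R C c : ℝ}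

theorem C1a (H : HP f g d R C c) (H' : HP f' g' d R C c) {M : ℝ} {e : E4} (he : ‖e‖ ≤ M) (n : ℕ) :
    ‖px f n e.1‖ + ‖px f' n e.2‖ ≤ 4 * rr f f' n e + 4 * (C * max R M ^ d) := by
  have h1 := H.y_bound (E4_fst he) n
  have h2 := H'.y_bound (E4_snd he) n
  have h3 := hA_le f f' n e
  have h4 := hB_le f f' n e
  have h5 : ‖px f n e.1‖ ≤ ‖hA f f' n e‖ + ‖(f'^[n] e.2).2‖ := by
    have := norm_add_le (hA f f' n e) ((f'^[n] e.2).2); simpa [hA, px] using this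
  have h6 : ‖px f' n e.2‖ ≤ ‖hB f f' n e‖ + ‖(f^[n] e.1).2‖ := by
    have := norm_sub_le ((f^[n] e.1).2) (hB f f' n e); simp [hB, px] at this ⊢; linarith
  simp only [px] at *
  linarith

theorem C1b (H : HP f g d R C c) (H' : HP f' g' d R C c) {M : ℝ} {e : E4} (he : ‖e‖ ≤ M) (n : ℕ) :
    |Real.log (SS (εε n ^ 2) (hA f f' n) (hB f f' n) e) -
      Real.log (SS 1 (fun e : E4 => px f n e.1) (fun e : E4 => px f' n e.2) e)| ≤
      Real.log (33 + 32 * (C * max R M ^ d) ^ 2) - 2 * Real.log (εε n) := by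
  have h0 := C1a H H' he n
  have h1 := H.y_bound (E4_fst he) n
  have h2 := H'.y_bound (E4_snd he) n
  have h3 := rr_sq f f' n e
  have h5 : ‖hA f f' n e‖ ≤ ‖px f n e.1‖ + ‖(f'^[n] e.2).2‖ := norm_sub_le _ _
  have h6 : ‖hB f f' n e‖ ≤ ‖(f^[n] e.1).2‖ + ‖px f' n e.2‖ := norm_sub_le _ _
  have e0 := εε_pos n
  have e1 := εε_le n
  have C1 := H.F.C1
  have m1 : 1 ≤ max R M := H.F.R1.trans (le_max_left _ _)
  have k0 : 0 ≤ C * max R M ^ d := by positivity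
  have r0 : 0 ≤ rr f f' n e := norm_nonneg _
  have S0 := SS_pos (pow_pos e0 2) (hA f f' n) (hB f f' n) e
  have T0 := SS_pos one_pos (fun e : E4 => px f n e.1) (fun e : E4 => px f' n e.2) e
  rw [show (f^[n] e.1).1 = px f n e.1 from rfl] at h1
  rw [show (f'^[n] e.2).1 = px f' n e.2 from rfl] at h2
  generalize hKe : C * max R M ^ d = K at *
  have p0 := norm_nonneg (px f n e.1)
  have q0 := norm_nonneg (px f' n e.2)
  have a0 := norm_nonneg (hA f f' n e)
  have b0 := norm_nonneg (hB f f' n e)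
  have key1 : SS (εε n ^ 2) (hA f f' n) (hB f f' n) e ≤
      (33 + 32 * K ^ 2) * SS 1 (fun e : E4 => px f n e.1) (fun e : E4 => px f' n e.2) e := by
    simp only [SS]
    generalize ‖px f n e.1‖ = P at *
    generalize ‖px f' n e.2‖ = Q at *
    generalize ‖hA f f' n e‖ = a at *
    generalize ‖hB f f' n e‖ = b at *
    have ha : a ≤ P + Q + K := by linarith
    have hb : b ≤ P + Q + K := by linarith
    have ha2 : a ^ 2 ≤ (P + Q + K) ^ 2 := by gcongr
    have hb2 : b ^ 2 ≤ (P + Q + K) ^ 2 := by gcongr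
    have e2 : εε n ^ 2 ≤ 1 := pow_le_one₀ e0.le e1
    have : (P + Q + K) ^ 2 ≤ 3 * (P ^ 2 + Q ^ 2 + K ^ 2) := by
      nlinarith [sq_nonneg (P - Q), sq_nonneg (P - K), sq_nonneg (Q - K)]
    nlinarith [mul_nonneg (sq_nonneg K) (sq_nonneg P), mul_nonneg (sq_nonneg K) (sq_nonneg Q), sq_nonneg P, sq_nonneg Q, sq_nonneg K]
  have key2 : εε n ^ 2 * SS 1 (fun e : E4 => px f n e.1) (fun e : E4 => px f' n e.2) e ≤
      (33 + 32 * K ^ 2) * SS (εε n ^ 2) (hA f f' n) (hB f f' n) e := by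
    simp only [SS]
    generalize ‖px f n e.1‖ = P at *
    generalize ‖px f' n e.2‖ = Q at *
    generalize ‖hA f f' n e‖ = a at *
    generalize ‖hB f f' n e‖ = b at *
    generalize rr f f' n e = r at *
    have e2 : εε n ^ 2 ≤ 1 := pow_le_one₀ e0.le e1
    have e3 : 0 < εε n ^ 2 := by positivity
    generalize εε n ^ 2 = s at *
    have h7 : (P + Q) ^ 2 ≤ (4 * r + 4 * K) ^ 2 := by gcongr
    have h8 : 1 + P ^ 2 + Q ^ 2 ≤ (33 + 32 * K ^ 2) * (1 + r ^ 2) := by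
      nlinarith [sq_nonneg (r - K), mul_nonneg p0 q0, mul_nonneg (sq_nonneg K) (sq_nonneg r), sq_nonneg r]
    have h9 : s * (1 + r ^ 2) ≤ s + a ^ 2 + b ^ 2 := by nlinarith [sq_nonneg r]
    calc s * (1 + P ^ 2 + Q ^ 2) ≤ s * ((33 + 32 * K ^ 2) * (1 + r ^ 2)) := by gcongr
      _ = (33 + 32 * K ^ 2) * (s * (1 + r ^ 2)) := by ring
      _ ≤ _ := by gcongr
  have CC0 : 0 < 33 + 32 * K ^ 2 := by positivity
  have l1 := Real.log_le_log S0 key1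
  have l2 := Real.log_le_log (by positivity) key2
  rw [Real.log_mul CC0.ne' T0.ne'] at l1
  rw [Real.log_mul CC0.ne' S0.ne', Real.log_mul (by positivity) T0.ne', Real.log_pow] at l2
  have l3 : Real.log (εε n) ≤ 0 := Real.log_nonpos e0.le e1
  rw [abs_le]
  push_cast at l2
  constructor <;> linarith

theorem εε_log (n : ℕ) : - Real.log (εε n) ≤ 5 * (n : ℝ) ^ 2 := by
  rw [εε, ηη, Real.log_pow, Real.log_pow]
  have h2 : Real.log (1/2) = - Real.log 2 := by rw [one_div, Real.log_inv]
  have h3 : Real.log 2 ≤ 1 := by have := Real.log_two_lt_d9; linarith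
  rw [h2]; push_cast
  nlinarith [sq_nonneg (n:ℝ)]

theorem delta_lim (A : ℝ) : Tendsto (fun n : ℕ => (A + 10 * (n:ℝ) ^ 2) * (1/2) ^ n) atTop (𝓝 0) := by
  have h1 := tendsto_pow_const_mul_const_pow_of_abs_lt_one 2 (r := (1/2:ℝ)) (by rw [abs_of_pos] <;> norm_num)
  have h2 := tendsto_pow_atTop_nhds_zero_of_lt_one (r := (1/2:ℝ)) (by norm_num) (by norm_num)
  have := (h2.const_mul A).add (h1.const_mul 10)
  simp only [mul_zero, add_zero] at this
  refine this.congr fun n => ?_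
  ring

def uu (f f' : EE → EE) (d n : ℕ) (e : E4) : ℂ :=
  ((1 / (2 * (d : ℝ) ^ n) : ℝ) : ℂ) * LS (εε n ^ 2) (hA f f' n) (hB f f' n) e
def vv (f f' : EE → EE) (d n : ℕ) (e : E4) : ℂ :=
  ((1 / (2 * (d : ℝ) ^ n) : ℝ) : ℂ) * LS 1 (fun e : E4 => px f n e.1) (fun e : E4 => px f' n e.2) e

theorem half_le (H : HP f g d R C c) (n : ℕ) : 1 / (2 * (d : ℝ) ^ n) ≤ (1/2) ^ n := by
  have h3 : (2:ℝ)^n ≤ (d:ℝ)^n := pow_le_pow_left₀ (by norm_num) (by exact_mod_cast H.F.hd) n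
  have : (0:ℝ) < 2 ^ n := by positivity
  rw [one_div_pow]; apply one_div_le_one_div_of_le (by positivity)
  linarith

theorem uv_close (H : HP f g d R C c) (H' : HP f' g' d R C c) (M : ℝ) :
    ∃ δ : ℕ → ℝ, Tendsto δ atTop (𝓝 0) ∧ ∀ n e, ‖e‖ ≤ M → ‖uu f f' d n e - vv f f' d n e‖ ≤ δ n := by
  refine ⟨_, delta_lim (Real.log (33 + 32 * (C * max R M ^ d) ^ 2)), fun n e he => ?_⟩
  have h1 := C1b H H' he n
  have h2 := εε_log n
  have h3 := half_le H n
  have h4 : (0:ℝ) < 1 / (2 * (d : ℝ) ^ n) := by have := pow_pos H.dpos n; positivity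
  rw [uu, vv, ← mul_sub, norm_mul, Complex.norm_real, Real.norm_eq_abs, abs_of_pos h4, LS, LS,
    ← Complex.ofReal_sub, Complex.norm_real, Real.norm_eq_abs, mul_comm]
  refine mul_le_mul (h1.trans (by linarith)) h3 h4.le ?_
  have := (abs_nonneg _).trans h1
  linarith

theorem AG_bdd (H : HP f g d R C c) (M : ℝ) : ∃ K : ℝ, ∀ z, ‖z‖ ≤ M → ∀ n, AG f d n z ≤ K := by
  obtain ⟨K, hK, hb⟩ := H.AG_conv M
  refine ⟨2 * K + 1/2 * Real.log (1 + M ^ 2), fun z hz n => ?_⟩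
  have h1 := abs_le.1 (hb z hz n)
  have h2 := abs_le.1 (hb z hz 0)
  have h3 : K * (1/2) ^ n ≤ K * 1 := by gcongr; exact pow_le_one₀ (by norm_num) (by norm_num)
  have h4 : AG f d 0 z ≤ 1/2 * Real.log (1 + M ^ 2) := by
    simp only [AG, pow_zero, mul_one, iterate_zero, id]
    have := norm_fst_le z
    gcongr
    exact this.trans hz
  simp only [pow_zero, mul_one] at h2
  linarith [h1.1, h1.2, h2.1, h2.2]

theorem vv_bdd (H : HP f g d R C c) (H' : HP f' g' d R C c) (M : ℝ) :
    ∃ K : ℝ, ∀ n e, ‖e‖ ≤ M → ‖vv f f' d n e‖ ≤ K := by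
  obtain ⟨K, hK⟩ := AG_bdd H M
  obtain ⟨K', hK'⟩ := AG_bdd H' M
  refine ⟨K + K', fun n e he => ?_⟩
  have h1 := hK _ (E4_fst he) n
  have h2 := hK' _ (E4_snd he) n
  have h4 : (0:ℝ) < 1 / (2 * (d : ℝ) ^ n) := by have := pow_pos H.dpos n; positivity
  have s1 : 1 ≤ SS 1 (fun e : E4 => px f n e.1) (fun e : E4 => px f' n e.2) e := by
    simp only [SS]; nlinarith [sq_nonneg ‖px f n e.1‖, sq_nonneg ‖px f' n e.2‖]
  have s2 : SS 1 (fun e : E4 => px f n e.1) (fun e : E4 => px f' n e.2) e ≤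
     (1 + ‖px f n e.1‖ ^ 2) * (1 + ‖px f' n e.2‖ ^ 2) := by
    simp only [SS]; nlinarith [mul_nonneg (sq_nonneg ‖px f n e.1‖) (sq_nonneg ‖px f' n e.2‖)]
  have l := Real.log_le_log (by linarith) s2
  rw [Real.log_mul (by positivity) (by positivity)] at l
  rw [vv, norm_mul, Complex.norm_real, Real.norm_eq_abs, abs_of_pos h4, LS,
    Complex.norm_real, Real.norm_eq_abs, abs_of_nonneg (Real.log_nonneg s1)]
  have := mul_le_mul_of_nonneg_left l h4.le
  simp only [AG, px] at *
  linarith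

theorem uu_bdd (H : HP f g d R C c) (H' : HP f' g' d R C c) (M : ℝ) :
    ∃ K : ℝ, ∀ n e, ‖e‖ ≤ M → ‖uu f f' d n e‖ ≤ K := by
  obtain ⟨K, hK⟩ := vv_bdd H H' M
  obtain ⟨δ, hδ, hb⟩ := uv_close H H' M
  obtain ⟨B, hB⟩ := hδ.bddAbove_range
  refine ⟨B + K, fun n e he => ?_⟩
  have h1 := hK n e he
  have h2 := hb n e he
  have h3 := hB ⟨n, rfl⟩
  have h4 := norm_add_le (uu f f' d n e - vv f f' d n e) (vv f f' d n e)
  rw [sub_add_cancel] at h4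
  linarith

/-- the determinant -/
def Δd (f f' X Y : EE → EE) (n : ℕ) (e : E4) : ℂ :=
  fderiv ℂ (hA f f' n) e (X e.1, 0) * fderiv ℂ (hB f f' n) e (0, Y e.2) -
    fderiv ℂ (hB f f' n) e (X e.1, 0) * fderiv ℂ (hA f f' n) e (0, Y e.2)

def Aint (f f' X Y : EE → EE) (χ χ' : EE → ℝ) (n : ℕ) : ℝ :=
  ∫ e : E4, χ e.1 * χ' e.2 * (εε n ^ 2 * ‖Δd f f' X Y n e‖ ^ 2 / SS (εε n ^ 2) (hA f f' n) (hB f f' n) e ^ 3)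

theorem partC_assembly (H : HP f g d R C c) (H' : HP f' g' d R C c) {X Y : EE → EE}
    (hX : Differentiable ℂ X) (hY : Differentiable ℂ Y) {χ χ' : EE → ℝ}
    (h : ContDiff ℝ (⊤ : ℕ∞) χ) (h' : ContDiff ℝ (⊤ : ℕ∞) χ')
    (hc : HasCompactSupport χ) (hc' : HasCompactSupport χ') (h0 : ∀ e, 0 ≤ χ e) (h0' : ∀ e, 0 ≤ χ' e)
    {q q' : ℝ} (hq : 0 < q) (hq' : 0 < q') (t : Tendsto (fun n => II f d X 3 n χ) atTop (𝓝 q))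
    (t' : Tendsto (fun n => II f' d Y 3 n χ') atTop (𝓝 q'))
    (hA0 : Tendsto (Aint f f' X Y χ χ') atTop (𝓝 0)) : False := by
  have N0 : ∀ n, (0:ℝ) < 1 / (2 * (d : ℝ) ^ n) := fun n => by have := pow_pos H.dpos n; positivity
  have P1 : ∀ n, Psh (LS (εε n ^ 2) (hA f f' n) (hB f f' n)) := fun n =>
    Psh_LS (pow_pos (εε_pos n) 2) (hA_diff H.F.diff H'.F.diff n) (hB_diff H.F.diff H'.F.diff n)
  have P2 : ∀ n, Psh (LS 1 (fun e : E4 => px f n e.1) (fun e : E4 => px f' n e.2)) := fun n =>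
    Psh_LS one_pos ((px_diff H.F.diff n).comp differentiable_fst) ((px_diff H'.F.diff n).comp differentiable_snd)
  have hu : ∀ n, Psh (uu f f' d n) := fun n => (P1 n).const_mul (N0 n).le
  have hv : ∀ n, Psh (vv f f' d n) := fun n => (P2 n).const_mul (N0 n).le
  have T := MA_XY hu hv (uu_bdd H H') (vv_bdd H H') (uv_close H H') h h' hc hc' hX hY
  let WA : ℕ → E4 → ℝ := fun n e => χ e.1 * χ' e.2 * (εε n ^ 2 * ‖Δd f f' X Y n e‖ ^ 2 / SS (εε n ^ 2) (hA f f' n) (hB f f' n) e ^ 3)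
  let WB : ℕ → E4 → ℝ := fun n e => χ e.1 * χ' e.2 *
    (‖fderiv ℂ (px f n) e.1 (X e.1)‖ ^ 2 * ‖fderiv ℂ (px f' n) e.2 (Y e.2)‖ ^ 2 /
      (1 + ‖px f n e.1‖ ^ 2 + ‖px f' n e.2‖ ^ 2) ^ 3)
  have eA : ∀ n (e : E4), ((χ e.1 : ℝ) : ℂ) * ((χ' e.2 : ℝ) : ℂ) * DD (uu f f' d n) (X e.1, 0) (0, Y e.2) e =
      (((1 / (2 * (d : ℝ) ^ n)) ^ 2 * WA n e : ℝ) : ℂ) := fun n e => by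
    have : DD (uu f f' d n) (X e.1, 0) (0, Y e.2) e = _ := DD_const_mul _ (P1 n).sm _ _ e
    rw [this, DD, Lv_LS_det (pow_pos (εε_pos n) 2) (hA_diff H.F.diff H'.F.diff n) (hB_diff H.F.diff H'.F.diff n)]
    simp only [WA, Δd]; push_cast; ring
  have eB : ∀ n (e : E4), ((χ e.1 : ℝ) : ℂ) * ((χ' e.2 : ℝ) : ℂ) * DD (vv f f' d n) (X e.1, 0) (0, Y e.2) e =
      (((1 / (2 * (d : ℝ) ^ n)) ^ 2 * WB n e : ℝ) : ℂ) := fun n e => by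
    have : DD (vv f f' d n) (X e.1, 0) (0, Y e.2) e = _ := DD_const_mul _ (P2 n).sm _ _ e
    rw [this, DD_prod (px_diff H.F.diff n) (px_diff H'.F.diff n)]
    simp only [WB]; push_cast; ring
  have cX : Continuous X := hX.continuous
  have cY : Continuous Y := hY.continuous
  have cc := (cs_prod hc hc')
  have cpr : HasCompactSupport (fun e : E4 => χ e.1 * χ' e.2) := by
    refine HasCompactSupport.intro (K := tsupport χ ×ˢ tsupport χ') (hc.prod hc') ?_
    intro e he
    rw [Set.mem_prod, not_and_or] at he
    rcases he with he | he
    · simp [image_eq_zero_of_notMem_tsupport he]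
    · simp [image_eq_zero_of_notMem_tsupport he]
  have cchi : Continuous (fun e : E4 => χ e.1 * χ' e.2) :=
    (h.continuous.comp continuous_fst).mul (h'.continuous.comp continuous_snd)
  have cfd : ∀ {G : Type} [NormedAddCommGroup G] [NormedSpace ℂ G] [FiniteDimensional ℂ G] [ProperSpace G]
      {φ : G → ℂ} {Z : G → G}, Differentiable ℂ φ → Continuous Z → Continuous (fun e => fderiv ℂ φ e (Z e)) := by
    intro G _ _ _ _ φ Z hφ hZ
    exact ((contDiff_of_entire hφ).continuous_fderiv (by simp)).clm_apply hZ
  have cA : ∀ n, Continuous (WA n) := fun n => by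
    have dA := hA_diff H.F.diff H'.F.diff n
    have dB := hB_diff H.F.diff H'.F.diff n
    have z1 : Continuous (fun e : E4 => ((X e.1, 0) : E4)) := (cX.comp continuous_fst).prodMk continuous_const
    have z2 : Continuous (fun e : E4 => ((0, Y e.2) : E4)) := continuous_const.prodMk (cY.comp continuous_snd)
    have cΔ : Continuous (Δd f f' X Y n) := ((cfd dA z1).mul (cfd dB z2)).sub ((cfd dB z1).mul (cfd dA z2))
    have cS : Continuous (SS (εε n ^ 2) (hA f f' n) (hB f f' n)) :=
      (continuous_const.add (dA.continuous.norm.pow 2)).add (dB.continuous.norm.pow 2)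
    exact cchi.mul ((continuous_const.mul (cΔ.norm.pow 2)).div (cS.pow 3)
      fun e => (pow_pos (SS_pos (pow_pos (εε_pos n) 2) _ _ e) 3).ne')
  have cB : ∀ n, Continuous (WB n) := fun n => by
    have c1 := (cfd (px_diff H.F.diff n) cX).comp (continuous_fst (X := EE) (Y := EE))
    have c2 := (cfd (px_diff H'.F.diff n) cY).comp (continuous_snd (X := EE) (Y := EE))
    have c3 := (px_diff H.F.diff n).continuous.comp (continuous_fst (X := EE) (Y := EE))
    have c4 := (px_diff H'.F.diff n).continuous.comp (continuous_snd (X := EE) (Y := EE))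
    exact cchi.mul (((c1.norm.pow 2).mul (c2.norm.pow 2)).div
      (((continuous_const.add (c3.norm.pow 2)).add (c4.norm.pow 2)).pow 3) fun e => by positivity)
  have iA : ∀ n, MeasureTheory.Integrable (WA n) := fun n => (cA n).integrable_of_hasCompactSupport cpr.mul_right
  have iB : ∀ n, MeasureTheory.Integrable (WB n) := fun n => (cB n).integrable_of_hasCompactSupport cpr.mul_right
  have T2 : Tendsto (fun n => (1 / (2 * (d : ℝ) ^ n)) ^ 2 * (∫ e, WA n e) - (1 / (2 * (d : ℝ) ^ n)) ^ 2 * (∫ e, WB n e))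
      atTop (𝓝 0) := by
    have := (Complex.continuous_re.tendsto _).comp T
    simp only [Complex.zero_re, Function.comp_def] at this
    refine this.congr fun n => ?_
    simp only [mul_sub, eA, eB, ← Complex.ofReal_sub]
    rw [integral_complex_ofReal, Complex.ofReal_re, ← mul_sub, ← MeasureTheory.integral_sub (iA n) (iB n),
      ← MeasureTheory.integral_const_mul]
    simp only [mul_sub]
  have T3 : Tendsto (fun n => (1 / (2 * (d : ℝ) ^ n)) ^ 2 * (∫ e, WA n e)) atTop (𝓝 0) := by
    have hA0' : Tendsto (fun n => ∫ e, WA n e) atTop (𝓝 0) := hA0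
    refine squeeze_zero (fun n => ?_) (fun n => ?_) hA0'
    · refine mul_nonneg (by positivity) (MeasureTheory.integral_nonneg fun e => ?_)
      have := SS_pos (pow_pos (εε_pos n) 2) (hA f f' n) (hB f f' n) e
      have a := h0 e.1
      have b := h0' e.2
      simp only [WA, Pi.zero_apply]; positivity
    · have i0 : 0 ≤ ∫ e, WA n e := MeasureTheory.integral_nonneg fun e => by
        have := SS_pos (pow_pos (εε_pos n) 2) (hA f f' n) (hB f f' n) e
        have a := h0 e.1
        have b := h0' e.2
        simp only [WA, Pi.zero_apply]; positivity
      have : (1 / (2 * (d : ℝ) ^ n)) ^ 2 ≤ 1 :=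
        pow_le_one₀ (N0 n).le ((half_le H n).trans (pow_le_one₀ (by norm_num) (by norm_num)))
      nlinarith
  have T4 := T3.sub T2
  simp only [sub_sub_cancel, sub_zero] at T4
  have T5 := t.mul t'
  have : q * q' ≤ 0 := by
    refine le_of_tendsto_of_tendsto' T5 T4 fun n => ?_
    have e1 : II f d X 3 n χ * II f' d Y 3 n χ' = (1 / (2 * (d : ℝ) ^ n)) ^ 2 *
      ∫ e : E4, (χ e.1 * Kq X (px f n) 3 e.1) * (χ' e.2 * Kq Y (px f' n) 3 e.2) := by
      have := MeasureTheory.integral_prod_mul (μ := (MeasureTheory.volume : MeasureTheory.Measure EE))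
        (ν := (MeasureTheory.volume : MeasureTheory.Measure EE))
        (fun z => χ z * Kq X (px f n) 3 z) (fun z => χ' z * Kq Y (px f' n) 3 z)
      rw [MeasureTheory.Measure.volume_eq_prod, this, II, II]; ring
    rw [e1]
    refine mul_le_mul_of_nonneg_left ?_ (by positivity)
    refine MeasureTheory.integral_mono_of_nonneg (Eventually.of_forall fun e => ?_) (iB n) (Eventually.of_forall fun e => ?_)
    · have a := h0 e.1
      have b := h0' e.2
      simp only [Kq, Pi.zero_apply]; positivity
    · have a := h0 e.1
      have b := h0' e.2
      have s2 : 1 + ‖px f n e.1‖ ^ 2 + ‖px f' n e.2‖ ^ 2 ≤ (1 + ‖px f n e.1‖ ^ 2) * (1 + ‖px f' n e.2‖ ^ 2) := by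
        nlinarith [mul_nonneg (sq_nonneg ‖px f n e.1‖) (sq_nonneg ‖px f' n e.2‖)]
      simp only [WB, Kq]
      calc _ = χ e.1 * χ' e.2 * (‖fderiv ℂ (px f n) e.1 (X e.1)‖ ^ 2 * ‖fderiv ℂ (px f' n) e.2 (Y e.2)‖ ^ 2 /
          ((1 + ‖px f n e.1‖ ^ 2) * (1 + ‖px f' n e.2‖ ^ 2)) ^ 3) := by
            have x1 : (1 + ‖px f n e.1‖ ^ 2) ≠ 0 := by positivity
            have x2 : (1 + ‖px f' n e.2‖ ^ 2) ≠ 0 := by positivity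
            field_simp
        _ ≤ _ := by gcongr
  nlinarith [mul_pos hq hq']
end
end

noncomputable section


theorem sw_norm (z : EE) : ‖sw z‖ = ‖z‖ := by simp [sw, Prod.norm_def, max_comm]
theorem sw_sub (z w : EE) : sw (z - w) = sw z - sw w := rfl
theorem sw_sw (z : EE) : sw (sw z) = z := rfl

theorem lt_inv_iff_mul {L x : ℝ} (h : 0 < L) : x < L⁻¹ ↔ L * x < 1 := by
  have := lt_inv_mul_iff₀ (a := x) (b := 1) h
  rwa [mul_one] at this

section
variable {f g f' g' : EE → EE} {d : ℕ} {R C c : ℝ}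

theorem Est0.lip (H : Est0 f d R C c) {K : ℝ} (hK : 1 ≤ K) {a b : EE} (ha : ‖a‖ ≤ K) (hb : ‖b‖ ≤ K) :
    ‖f a - f b‖ ≤ C * K ^ d * ‖a - b‖ := by
  have C1 := H.C1
  refine (convex_closedBall (0 : EE) K).norm_image_sub_le_of_norm_fderiv_le (𝕜 := ℂ) (f := f)
    (fun x _ => H.diff x) (fun x hx => ?_) (by simpa using hb) (by simpa using ha)
  have hx' : ‖x‖ ≤ K := by simpa using hx
  calc ‖fderiv ℂ f x‖ ≤ C * max 1 ‖x‖ ^ (d - 1) := H.dub x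
    _ ≤ C * K ^ (d - 1) := by gcongr; exact max_le hK hx'
    _ ≤ C * K ^ d := by gcongr; omega

theorem HP.glip (H : HP f g d R C c) {K : ℝ} (hK : 1 ≤ K) {a b : EE} (ha : ‖a‖ ≤ K) (hb : ‖b‖ ≤ K) :
    ‖g a - g b‖ ≤ C * K ^ d * ‖a - b‖ := by
  have := H.G.lip hK (a := sw a) (b := sw b) (by rwa [sw_norm]) (by rwa [sw_norm])
  simp only [sw_sw, ← sw_sub, sw_norm] at this
  exact this

theorem HP.back_lip (H : HP f g d R C c) {K : ℝ} (hK : 1 ≤ K) {w w' : EE} (n : ℕ)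
    (h : ∀ i ≤ n, ‖f^[i] w‖ ≤ K) (h' : ∀ i ≤ n, ‖f^[i] w'‖ ≤ K) :
    ‖w - w'‖ ≤ (C * K ^ d) ^ n * ‖f^[n] w - f^[n] w'‖ := by
  have C1 := H.F.C1
  induction n with
  | zero => simp
  | succ n ih =>
    have h1 := ih (fun i hi => h i (by omega)) (fun i hi => h' i (by omega))
    have h2 := H.glip hK (h (n+1) le_rfl) (h' (n+1) le_rfl)
    rw [iterate_succ_apply' f n w, iterate_succ_apply' f n w', H.gf, H.gf] at h2
    rw [iterate_succ_apply' f n w, iterate_succ_apply' f n w']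
    calc _ ≤ _ := h1
      _ ≤ (C * K ^ d) ^ n * (C * K ^ d * ‖f (f^[n] w) - f (f^[n] w')‖) := by gcongr
      _ = _ := by ring

theorem Est0.fwd_near (H : Est0 f d R C c) {K : ℝ} (hK : 1 ≤ K) {w w' : EE} (n : ℕ)
    (h : ∀ i ≤ n, ‖f^[i] w‖ ≤ K) (hw : (C * (K + 1) ^ d) ^ n * ‖w - w'‖ ≤ 1) :
    ∀ i ≤ n, ‖f^[i] w - f^[i] w'‖ ≤ (C * (K + 1) ^ d) ^ i * ‖w - w'‖ ∧ ‖f^[i] w'‖ ≤ K + 1 := by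
  have C1 := H.C1
  have L1 : 1 ≤ C * (K + 1) ^ d := by
    have : 1 ≤ (K + 1) ^ d := one_le_pow₀ (by linarith)
    nlinarith
  have aux : ∀ i ≤ n, ‖f^[i] w - f^[i] w'‖ ≤ (C * (K + 1) ^ d) ^ i * ‖w - w'‖ → ‖f^[i] w'‖ ≤ K + 1 := by
    intro i hi hh
    have h1 : (C * (K + 1) ^ d) ^ i * ‖w - w'‖ ≤ (C * (K + 1) ^ d) ^ n * ‖w - w'‖ := by gcongr
    have h2 := norm_sub_le (f^[i] w) (f^[i] w - f^[i] w')
    rw [sub_sub_cancel] at h2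
    linarith [h i hi]
  intro i
  induction i with
  | zero => intro hi; refine ⟨by simp, aux 0 hi (by simp)⟩
  | succ i ih =>
    intro hi
    obtain ⟨h1, h2⟩ := ih (by omega)
    have h3 := H.lip (K := K + 1) (by linarith) ((h i (by omega)).trans (by linarith)) h2
    have : ‖f^[i+1] w - f^[i+1] w'‖ ≤ (C * (K + 1) ^ d) ^ (i+1) * ‖w - w'‖ := by
      rw [iterate_succ_apply' f, iterate_succ_apply' f]
      calc _ ≤ _ := h3
        _ ≤ C * (K + 1) ^ d * ((C * (K + 1) ^ d) ^ i * ‖w - w'‖) := by gcongr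
        _ = _ := by ring
    exact ⟨this, aux _ hi this⟩

theorem HP.pert (H : HP f g d R C c) {K : ℝ} (hK : 1 ≤ K) {w ζ : EE} (n : ℕ)
    (h : ∀ i ≤ n, ‖f^[i] w‖ ≤ K) (hw : (C * (K + 1) ^ d) ^ n * ‖ζ - f^[n] w‖ ≤ 1) :
    ∃ w', f^[n] w' = ζ ∧ ‖w' - w‖ ≤ (C * (K + 1) ^ d) ^ n * ‖ζ - f^[n] w‖ := by
  have C1 := H.F.C1
  have L1 : 1 ≤ C * (K + 1) ^ d := by
    have : 1 ≤ (K + 1) ^ d := one_le_pow₀ (by linarith)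
    nlinarith
  induction n generalizing ζ with
  | zero => exact ⟨ζ, rfl, by simp⟩
  | succ n ih =>
    have n0 := norm_nonneg (ζ - f^[n+1] w)
    have hb : ‖ζ - f^[n+1] w‖ ≤ 1 := by
      have : 1 ≤ (C * (K + 1) ^ d) ^ (n+1) := one_le_pow₀ L1
      nlinarith
    have hζ : ‖ζ‖ ≤ K + 1 := by
      have h2 := norm_add_le (ζ - f^[n+1] w) (f^[n+1] w)
      rw [sub_add_cancel] at h2
      linarith [h (n+1) le_rfl]
    have h3 := H.glip (K := K + 1) (by linarith) hζ ((h (n+1) le_rfl).trans (by linarith))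
    have e1 : g (f^[n+1] w) = f^[n] w := by rw [iterate_succ_apply' f, H.gf]
    rw [e1] at h3
    have h4 : (C * (K + 1) ^ d) ^ n * ‖g ζ - f^[n] w‖ ≤ (C * (K + 1) ^ d) ^ (n+1) * ‖ζ - f^[n+1] w‖ := by
      calc _ ≤ (C * (K + 1) ^ d) ^ n * (C * (K + 1) ^ d * ‖ζ - f^[n+1] w‖) := by gcongr
        _ = _ := by ring
    obtain ⟨w', hw', hw''⟩ := ih (ζ := g ζ) (fun i hi => h i (by omega)) (h4.trans hw)
    refine ⟨w', by rw [iterate_succ_apply' f, hw', H.fg], hw''.trans h4⟩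

/-- push-forward vector -/
def PV (f X : EE → EE) (n : ℕ) (z : EE) : EE := fderiv ℂ (f^[n]) z (X z)

theorem PV_diff {f X : EE → EE} (hf : Differentiable ℂ f) (hX : Differentiable ℂ X) (n : ℕ) :
    Differentiable ℂ (PV f X n) := by
  have h1 : ContDiff ℂ (⊤ : ℕ∞) (f^[n]) := by
    have := (contDiff_of_entire (hf.iterate n).fst).prodMk (contDiff_of_entire (hf.iterate n).snd)
    exact this
  have h2 : Differentiable ℂ (fderiv ℂ (f^[n])) :=
    (h1.fderiv_right (m := (⊤ : ℕ∞)) (by simp)).differentiable (by simp)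
  exact h2.clm_apply hX

theorem Δd_eq {f f' : EE → EE} (hf : Differentiable ℂ f) (hf' : Differentiable ℂ f') (X Y : EE → EE) (n : ℕ) (e : E4) :
    Δd f f' X Y n e = (PV f X n e.1).2 * (PV f' Y n e.2).2 - (PV f X n e.1).1 * (PV f' Y n e.2).1 := by
  have f1 := ((hf.iterate n) e.1).hasFDerivAt.comp e (hasFDerivAt_fst (𝕜 := ℂ))
  have f2 := ((hf'.iterate n) e.2).hasFDerivAt.comp e (hasFDerivAt_snd (𝕜 := ℂ))
  have gA : fderiv ℂ (hA f f' n) e = _ := (f1.fst.sub f2.snd).fderiv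
  have gB : fderiv ℂ (hB f f' n) e = _ := (f1.snd.sub f2.fst).fderiv
  rw [Δd, gA, gB]
  simp [PV]
  try ring

theorem wedge_le (U V : EE) : ‖U.2 * V.2 - U.1 * V.1‖ ≤ 2 * (‖U‖ * ‖V‖) := by
  refine (norm_sub_le _ _).trans ?_
  rw [norm_mul, norm_mul]
  have := mul_le_mul (norm_fst_le U) (norm_fst_le V) (norm_nonneg _) (norm_nonneg _)
  have := mul_le_mul (norm_snd_le U) (norm_snd_le V) (norm_nonneg _) (norm_nonneg _)
  linarith

theorem bdd_on_ball {X : EE → EE} (hX : Continuous X) (K : ℝ) : ∃ B : ℝ, 1 ≤ B ∧ ∀ z, ‖z‖ ≤ K → ‖X z‖ ≤ B := by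
  obtain ⟨B, hB⟩ := (isCompact_closedBall (0 : EE) K).exists_bound_of_continuousOn hX.continuousOn
  exact ⟨max B 1, le_max_right _ _, fun z hz => (hB z (by simpa using hz)).trans (le_max_left _ _)⟩

/-- Lipschitz estimate for the pushforward along bounded orbits. -/
theorem Est0.PV_lip (H : Est0 f d R C c) {K B : ℝ} (hK : 1 ≤ K) {Y : EE → EE} (hY : Differentiable ℂ Y)
    (hB : ∀ z, ‖z‖ ≤ K + 1 → ‖Y z‖ ≤ B) (n : ℕ) {w w' : EE} (h : ∀ i ≤ n, ‖f^[i] w‖ ≤ K)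
    (hw : (C * (K + 1) ^ d) ^ n * ‖w' - w‖ < 1) :
    ‖PV f Y n w' - PV f Y n w‖ ≤ 2 * B * (C * (K + 1) ^ d) ^ (2 * n) * ‖w' - w‖ := by
  have C1 := H.C1
  have L0 : 0 < (C * (K + 1) ^ d) ^ n := by positivity
  have B0 : 0 ≤ B := (norm_nonneg _).trans (hB 0 (by simp; linarith))
  have bd : ∀ x ∈ Metric.ball w ((C * (K + 1) ^ d) ^ n)⁻¹, ‖PV f Y n x‖ ≤ (C * (K + 1) ^ d) ^ n * B := by
    intro x hx
    rw [Metric.mem_ball, dist_comm, dist_eq_norm] at hx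
    have h1 := H.fwd_near hK n h (w' := x) ((lt_inv_iff_mul L0).1 hx).le
    have h2 := H.deriv_bdd (K := K + 1) (by linarith) n (fun i hi => (h1 i hi.le).2) (Y x)
    refine h2.trans ?_
    gcongr
    exact hB x (h1 0 (Nat.zero_le _)).2
  have := Complex.dist_le_div_mul_dist_of_mapsTo_ball (f := PV f Y n) (c := w) (z := w')
    (R₁ := ((C * (K + 1) ^ d) ^ n)⁻¹) (R₂ := 2 * ((C * (K + 1) ^ d) ^ n * B))
    (PV_diff H.diff hY n).differentiableOn (fun x hx => by
      rw [Metric.mem_closedBall, dist_eq_norm]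
      have h1 := bd x hx
      have h2 := bd w (Metric.mem_ball_self (by positivity))
      linarith [norm_sub_le (PV f Y n x) (PV f Y n w)]) (by
      rw [Metric.mem_ball, dist_eq_norm, lt_inv_iff_mul L0]; exact hw)
  rw [dist_eq_norm, dist_eq_norm] at this
  refine this.trans (le_of_eq ?_)
  rw [div_inv_eq_mul]; ring
end
end

noncomputable section


theorem exp_eta_lim (A L : ℝ) : Tendsto (fun n : ℕ => A * L ^ n * ηη n) atTop (𝓝 0) := by
  have h0 : Tendsto (fun n : ℕ => |L| * (1/2:ℝ) ^ n) atTop (𝓝 0) := by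
    simpa using (tendsto_pow_atTop_nhds_zero_of_lt_one (r := (1/2:ℝ)) (by norm_num) (by norm_num)).const_mul |L|
  have h1 : ∀ᶠ n : ℕ in atTop, |L| * (1/2:ℝ) ^ n ≤ 1/2 := h0.eventually_le_const (by norm_num)
  have h2 : Tendsto (fun n : ℕ => |A| * (1/2:ℝ) ^ n) atTop (𝓝 0) := by
    simpa using (tendsto_pow_atTop_nhds_zero_of_lt_one (r := (1/2:ℝ)) (by norm_num) (by norm_num)).const_mul |A|
  refine squeeze_zero_norm' ?_ h2
  filter_upwards [h1] with n hn
  rw [norm_mul, norm_mul, norm_pow, Real.norm_eq_abs, Real.norm_eq_abs, Real.norm_eq_abs, abs_of_pos (ηη_pos n), ηη,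
    pow_mul, mul_assoc, ← mul_pow]
  gcongr

section
variable {f g f' g' : EE → EE} {d : ℕ} {R C c : ℝ}

theorem orbit_K (H : HP f g d R C c) (H' : HP f' g' d R C c) {M : ℝ} {e : E4} (he : ‖e‖ ≤ M) (n : ℕ)
    (hr : rr f f' n e ≤ 1) : ∀ i ≤ n, ‖f^[i] e.1‖ ≤ max (max R M) (4 + 4 * (C * max R M ^ d)) ∧
      ‖f'^[i] e.2‖ ≤ max (max R M) (4 + 4 * (C * max R M ^ d)) := by
  intro i hi
  have h := C1a H H' he n
  have p0 := norm_nonneg (px f n e.1)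
  have q0 := norm_nonneg (px f' n e.2)
  refine ⟨(H.orbit e.1 hi).trans (max_le_max (max_le_max le_rfl (E4_fst he)) ?_),
    (H'.orbit e.2 hi).trans (max_le_max (max_le_max le_rfl (E4_snd he)) ?_)⟩
  · show ‖px f n e.1‖ ≤ _
    linarith
  · show ‖px f' n e.2‖ ≤ _
    linarith

theorem Δ_small (H : HP f g d R C c) (H' : HP f' g' d R C c) {X Y : EE → EE}
    (hX : Differentiable ℂ X) (hY : Differentiable ℂ Y)
    (hΔ : ∀ n z w, f^[n] z = sw (f'^[n] w) → (PV f X n z).2 * (PV f' Y n w).2 = (PV f X n z).1 * (PV f' Y n w).1)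
    (M : ℝ) : ∃ A L : ℝ, 1 ≤ A ∧ 1 ≤ L ∧ ∀ᶠ n in atTop, ∀ e : E4, ‖e‖ ≤ M → rr f f' n e < ηη n →
      ‖Δd f f' X Y n e‖ ≤ A * L ^ n * rr f f' n e := by
  obtain ⟨K, hKe⟩ : ∃ K, K = max (max R M) (4 + 4 * (C * max R M ^ d)) := ⟨_, rfl⟩
  have C1 := H.F.C1
  have K1 : 1 ≤ K := by rw [hKe]; exact H.F.R1.trans ((le_max_left _ _).trans (le_max_left _ _))
  obtain ⟨B, B1, hB⟩ := bdd_on_ball hX.continuous (K + 1)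
  obtain ⟨B', B1', hB'⟩ := bdd_on_ball hY.continuous (K + 1)
  obtain ⟨L, hL⟩ : ∃ L, L = C * (K + 1) ^ d := ⟨_, rfl⟩
  have L1 : 1 ≤ L := by
    have : 1 ≤ (K + 1) ^ d := one_le_pow₀ (by linarith)
    rw [hL]; nlinarith
  refine ⟨4 * B * B', L ^ 4, by nlinarith, one_le_pow₀ L1, ?_⟩
  have ev : ∀ᶠ n in atTop, 1 * (L ^ 2) ^ n * ηη n < 1 := (exp_eta_lim 1 (L ^ 2)).eventually_lt_const one_pos
  filter_upwards [ev] with n hn e he hr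
  have r0 : 0 ≤ rr f f' n e := norm_nonneg _
  have r1 : rr f f' n e ≤ 1 := hr.le.trans (ηη_le n)
  have orb := orbit_K H H' he n r1
  rw [← hKe] at orb
  have hL2 : L ^ n * (L ^ n * rr f f' n e) < 1 := by
    calc L ^ n * (L ^ n * rr f f' n e) = (L ^ 2) ^ n * rr f f' n e := by ring
      _ ≤ (L ^ 2) ^ n * ηη n := by gcongr
      _ < 1 := by linarith
  have hL1 : L ^ n * rr f f' n e ≤ 1 := by
    have h1 : 1 ≤ L ^ n := one_le_pow₀ L1
    have h2 : 0 ≤ L ^ n * rr f f' n e := by positivity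
    nlinarith
  have er : ‖sw (f^[n] e.1) - f'^[n] e.2‖ = rr f f' n e := by
    rw [rr, ← sw_norm]; rfl
  obtain ⟨w', hw', hw''⟩ := H'.pert K1 (w := e.2) (ζ := sw (f^[n] e.1)) n (fun i hi => (orb i hi).2)
    (by rw [er, ← hL]; exact hL1)
  rw [er, ← hL] at hw''
  have lp := H'.F.PV_lip K1 hY hB' n (w := e.2) (w' := w') (fun i hi => (orb i hi).2) (by
    rw [← hL]
    exact lt_of_le_of_lt (by gcongr) hL2)
  rw [← hL] at lp
  have hU : ‖PV f X n e.1‖ ≤ L ^ n * B := by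
    have h1 := H.F.deriv_bdd K1 n (fun i hi => (orb i hi.le).1) (X e.1)
    refine h1.trans ?_
    have : C * K ^ d ≤ L := by rw [hL]; gcongr; linarith
    have h2 := hB e.1 (((orb 0 (Nat.zero_le _)).1).trans (by linarith))
    gcongr
  have z := hΔ n e.1 w' (by rw [hw', sw_sw])
  have e1 : Δd f f' X Y n e = (PV f X n e.1).2 * (PV f' Y n e.2 - PV f' Y n w').2 -
      (PV f X n e.1).1 * (PV f' Y n e.2 - PV f' Y n w').1 := by
    rw [Δd_eq H.F.diff H'.F.diff, Prod.snd_sub, Prod.fst_sub]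
    linear_combination z
  rw [e1]
  refine (wedge_le _ _).trans ?_
  rw [norm_sub_rev]
  calc 2 * (‖PV f X n e.1‖ * ‖PV f' Y n w' - PV f' Y n e.2‖)
      ≤ 2 * ((L ^ n * B) * (2 * B' * L ^ (2 * n) * ‖w' - e.2‖)) := by gcongr
    _ ≤ 2 * ((L ^ n * B) * (2 * B' * L ^ (2 * n) * (L ^ n * rr f f' n e))) := by gcongr
    _ = _ := by ring

theorem Δ_big (H : HP f g d R C c) (H' : HP f' g' d R C c) {X Y : EE → EE}
    (hX : Differentiable ℂ X) (hY : Differentiable ℂ Y) {M : ℝ} (hM : R ≤ M) :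
    ∃ A L : ℝ, 1 ≤ A ∧ 1 ≤ L ∧ ∀ n, ∀ e : E4, ‖e‖ ≤ M → 
      ‖Δd f f' X Y n e‖ ≤ A * L ^ n * (max 1 (rr f f' n e)) ^ 2 := by
  have C1 := H.F.C1
  have c0 := H.F.c0
  have c1 := H.F.c1
  have M1 : 1 ≤ M := H.F.R1.trans hM
  obtain ⟨B, B1, hB⟩ := bdd_on_ball hX.continuous M
  obtain ⟨B', B1', hB'⟩ := bdd_on_ball hY.continuous M
  obtain ⟨L, hL⟩ : ∃ L, L = C * M ^ d / c := ⟨_, rfl⟩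
  have L1 : 1 ≤ L := by
    have : 1 ≤ M ^ d := one_le_pow₀ M1
    rw [hL, le_div_iff₀ c0]; nlinarith
  have k0 : 0 ≤ C * max R M ^ d := by
    have : 0 ≤ max R M := by rw [max_eq_right hM]; linarith
    positivity
  refine ⟨2 * B * B' * (5 + 4 * (C * max R M ^ d)) ^ 2, L ^ 2, ?_, one_le_pow₀ L1, ?_⟩
  · have : 1 ≤ (5 + 4 * (C * max R M ^ d)) ^ 2 := one_le_pow₀ (by linarith)
    nlinarith [mul_nonneg (sub_nonneg.2 B1) (sub_nonneg.2 B1')]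
  intro n e he
  have h0 := C1a H H' he n
  have hU := H.Dn hM (E4_fst he) n (X e.1)
  have hV := H'.Dn hM (E4_snd he) n (Y e.2)
  rw [← hL] at hU hV
  have b1 := hB _ (E4_fst he)
  have b2 := hB' _ (E4_snd he)
  rw [Δd_eq H.F.diff H'.F.diff]
  refine (wedge_le _ _).trans ?_
  have m1 : max 1 ‖(f^[n] e.1).1‖ ≤ (5 + 4 * (C * max R M ^ d)) * max 1 (rr f f' n e) := by
    have p0 := norm_nonneg (px f n e.1)
    have q0 := norm_nonneg (px f' n e.2)
    have hp : ‖(f^[n] e.1).1‖ = ‖px f n e.1‖ := rfl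
    rw [hp]
    have a1 := le_max_left 1 (rr f f' n e)
    have a2 := le_max_right 1 (rr f f' n e)
    apply max_le <;> nlinarith
  have m2 : max 1 ‖(f'^[n] e.2).1‖ ≤ (5 + 4 * (C * max R M ^ d)) * max 1 (rr f f' n e) := by
    have p0 := norm_nonneg (px f n e.1)
    have q0 := norm_nonneg (px f' n e.2)
    have hp : ‖(f'^[n] e.2).1‖ = ‖px f' n e.2‖ := rfl
    rw [hp]
    have a1 := le_max_left 1 (rr f f' n e)
    have a2 := le_max_right 1 (rr f f' n e)
    apply max_le <;> nlinarith
  have t1 : ‖PV f X n e.1‖ ≤ L ^ n * ((5 + 4 * (C * max R M ^ d)) * max 1 (rr f f' n e)) * B :=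
    hU.trans (by gcongr)
  have t2 : ‖PV f' Y n e.2‖ ≤ L ^ n * ((5 + 4 * (C * max R M ^ d)) * max 1 (rr f f' n e)) * B' :=
    hV.trans (by gcongr)
  calc 2 * (‖PV f X n e.1‖ * ‖PV f' Y n e.2‖) ≤
      2 * ((L ^ n * ((5 + 4 * (C * max R M ^ d)) * max 1 (rr f f' n e)) * B) * (L ^ n * ((5 + 4 * (C * max R M ^ d)) * max 1 (rr f f' n e)) * B')) := by
        gcongr
    _ = _ := by ring

theorem real_big {η r m S W Δ : ℝ} (h0 : 0 < η) (h1 : η ≤ 1) (hr : η ≤ r) (hm : m = max 1 r) (hS : r ^ 2 ≤ S)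
    (hW : 0 ≤ W) (hΔ0 : 0 ≤ Δ) (hΔ : Δ ≤ W * m ^ 2) : (η ^ 5) ^ 2 * Δ ^ 2 / S ^ 3 ≤ W ^ 2 * η ^ 4 := by
  have r0 : 0 < r := h0.trans_le hr
  have m0 : 0 ≤ m := by rw [hm]; exact zero_le_one.trans (le_max_left _ _)
  have key : η ^ 6 * m ^ 4 ≤ r ^ 6 := by
    rcases le_total 1 r with h | h
    · rw [hm, max_eq_right h]
      have : η ^ 6 ≤ r ^ 2 := by
        calc η ^ 6 ≤ 1 := pow_le_one₀ h0.le h1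
          _ ≤ r ^ 2 := one_le_pow₀ h
      calc η ^ 6 * r ^ 4 ≤ r ^ 2 * r ^ 4 := by gcongr
        _ = _ := by ring
    · rw [hm, max_eq_left h]
      calc η ^ 6 * 1 ^ 4 = η ^ 6 := by ring
        _ ≤ r ^ 6 := by gcongr
  have S0 : 0 < S := lt_of_lt_of_le (by positivity) hS
  rw [div_le_iff₀ (by positivity)]
  calc (η ^ 5) ^ 2 * Δ ^ 2 ≤ (η ^ 5) ^ 2 * (W * m ^ 2) ^ 2 := by gcongr
    _ = W ^ 2 * η ^ 4 * (η ^ 6 * m ^ 4) := by ring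
    _ ≤ W ^ 2 * η ^ 4 * r ^ 6 := by gcongr
    _ = W ^ 2 * η ^ 4 * (r ^ 2) ^ 3 := by ring
    _ ≤ _ := by gcongr

theorem real_mid {η r S W Δ : ℝ} (h0 : 0 < η) (hr : η ^ 3 ≤ r) (hS : r ^ 2 ≤ S)
    (hW : 0 ≤ W) (hΔ0 : 0 ≤ Δ) (hΔ : Δ ≤ W * r) : (η ^ 5) ^ 2 * Δ ^ 2 / S ^ 3 ≤ W ^ 2 * (η ^ 2)⁻¹ := by
  have r0 : 0 < r := lt_of_lt_of_le (by positivity) hr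
  have S0 : 0 < S := lt_of_lt_of_le (by positivity) hS
  rw [← div_eq_mul_inv, div_le_div_iff₀ (by positivity) (by positivity)]
  calc (η ^ 5) ^ 2 * Δ ^ 2 * η ^ 2 ≤ (η ^ 5) ^ 2 * (W * r) ^ 2 * η ^ 2 := by gcongr
    _ = W ^ 2 * (r ^ 2 * (η ^ 3) ^ 4) := by ring
    _ ≤ W ^ 2 * (r ^ 2 * r ^ 4) := by gcongr
    _ = W ^ 2 * (r ^ 2) ^ 3 := by ring
    _ ≤ _ := by gcongr

theorem real_low {η r S W Δ : ℝ} (h0 : 0 < η) (r0 : 0 ≤ r) (hS : r ^ 2 ≤ S) (hS' : (η ^ 5) ^ 2 ≤ S)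
    (hW : 0 ≤ W) (hΔ0 : 0 ≤ Δ) (hΔ : Δ ≤ W * r) : (η ^ 5) ^ 2 * Δ ^ 2 / S ^ 3 ≤ W ^ 2 * (η ^ 10)⁻¹ := by
  have S0 : 0 < S := lt_of_lt_of_le (by positivity) hS'
  rw [← div_eq_mul_inv, div_le_div_iff₀ (by positivity) (by positivity)]
  calc (η ^ 5) ^ 2 * Δ ^ 2 * η ^ 10 ≤ (η ^ 5) ^ 2 * (W * r) ^ 2 * η ^ 10 := by gcongr
    _ = W ^ 2 * ((η ^ 5) ^ 2 * r ^ 2 * (η ^ 5) ^ 2) := by ring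
    _ ≤ W ^ 2 * (S * S * S) := by gcongr
    _ = W ^ 2 * S ^ 3 := by ring

def Sset (f f' : EE → EE) (M : ℝ) (n : ℕ) (ρ : ℝ) : Set E4 := {e | ‖e‖ ≤ M ∧ rr f f' n e ≤ ρ}

theorem rr_cont (hf : Continuous f) (hf' : Continuous f') (n : ℕ) : Continuous (rr f f' n) := by
  have h1 := (hf.iterate n).comp (continuous_fst (X := EE) (Y := EE))
  have h2 := (hf'.iterate n).comp (continuous_snd (X := EE) (Y := EE))
  have h3 : Continuous sw := continuous_snd.prodMk continuous_fst
  exact (h1.sub (h3.comp h2)).norm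

theorem Sset_meas (hf : Continuous f) (hf' : Continuous f') (M : ℝ) (n : ℕ) (ρ : ℝ) :
    MeasurableSet (Sset f f' M n ρ) :=
  ((isClosed_le continuous_norm continuous_const).inter
    (isClosed_le (rr_cont hf hf' n) continuous_const)).measurableSet

open MeasureTheory in
theorem Sset_vol (H : HP f g d R C c) (H' : HP f' g' d R C c) (M : ℝ) :
    ∃ A L : ℝ, 1 ≤ A ∧ 1 ≤ L ∧ ∀ n, ∀ ρ : ℝ, 0 ≤ ρ → ρ ≤ 1 →
      (volume : Measure E4).real (Sset f f' M n ρ) ≤ A * L ^ n * ρ ^ 4 := by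
  obtain ⟨K, hKe⟩ : ∃ K, K = max (max R M) (4 + 4 * (C * max R M ^ d)) := ⟨_, rfl⟩
  have C1 := H.F.C1
  have K1 : 1 ≤ K := by rw [hKe]; exact H.F.R1.trans ((le_max_left _ _).trans (le_max_left _ _))
  obtain ⟨L, hL⟩ : ∃ L, L = C * K ^ d := ⟨_, rfl⟩
  have L1 : 1 ≤ L := by
    have : 1 ≤ K ^ d := one_le_pow₀ K1
    rw [hL]; nlinarith
  have fr : Module.finrank ℝ EE = 4 := by
    rw [Module.finrank_prod, Complex.finrank_real_complex]
  obtain ⟨b, hb⟩ : ∃ b : ℝ, b = (volume : Measure EE).real (Metric.closedBall 0 M) * ((volume : Measure EE).real (Metric.ball 0 1) * 16) := ⟨_, rfl⟩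
  have fM : (volume : Measure EE) (Metric.closedBall 0 M) ≠ ⊤ := measure_closedBall_lt_top.ne
  have f1 : (volume : Measure EE) (Metric.ball 0 1) ≠ ⊤ := measure_ball_lt_top.ne
  refine ⟨b + 1, L ^ 4, ?_, one_le_pow₀ L1, ?_⟩
  · have : 0 ≤ b := by rw [hb]; positivity
    linarith
  intro n ρ h0 h1
  have main : (volume : Measure E4) (Sset f f' M n ρ) ≤
      ENNReal.ofReal ((L ^ n * (2 * ρ)) ^ 4) * volume (Metric.ball (0 : EE) 1) * volume (Metric.closedBall (0 : EE) M) := by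
    rw [Measure.volume_eq_prod, Measure.prod_apply (Sset_meas H.F.diff.continuous H'.F.diff.continuous M n ρ)]
    have hsec : ∀ z : EE, (volume : Measure EE) (Prod.mk z ⁻¹' Sset f f' M n ρ) ≤
        (Metric.closedBall (0 : EE) M).indicator (fun _ => ENNReal.ofReal ((L ^ n * (2 * ρ)) ^ 4) * volume (Metric.ball (0 : EE) 1)) z := by
      intro z
      by_cases hne : (Prod.mk z ⁻¹' Sset f f' M n ρ).Nonempty
      · obtain ⟨w₀, hw₀⟩ := hne
        have hz : z ∈ Metric.closedBall (0 : EE) M := by simpa using E4_fst hw₀.1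
        rw [indicator_of_mem hz]
        have sub : Prod.mk z ⁻¹' Sset f f' M n ρ ⊆ Metric.closedBall w₀ (L ^ n * (2 * ρ)) := by
          intro w hw
          rw [Metric.mem_closedBall, dist_eq_norm]
          have o1 := orbit_K H H' hw.1 n (hw.2.trans h1)
          have o2 := orbit_K H H' hw₀.1 n (hw₀.2.trans h1)
          rw [← hKe] at o1 o2
          have bl := H'.back_lip K1 n (fun i hi => (o1 i hi).2) (fun i hi => (o2 i hi).2)
          rw [← hL] at bl
          refine bl.trans ?_
          gcongr
          have a1 := hw.2
          have a2 := hw₀.2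
          simp only [rr] at a1 a2
          have e1 : ‖f'^[n] w - f'^[n] w₀‖ = ‖(f^[n] z - sw (f'^[n] w₀)) - (f^[n] z - sw (f'^[n] w))‖ := by
            rw [sub_sub_sub_cancel_left, ← sw_sub, sw_norm]
          show ‖f'^[n] w - f'^[n] w₀‖ ≤ _
          rw [e1]
          refine (norm_sub_le _ _).trans ?_
          linarith
        refine (measure_mono sub).trans ?_
        rw [Measure.addHaar_closedBall _ _ (by positivity), fr]
      · rw [not_nonempty_iff_eq_empty] at hne
        rw [hne]; simp
    refine (lintegral_mono hsec).trans ?_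
    rw [lintegral_indicator Metric.isClosed_closedBall.measurableSet, lintegral_const,
      Measure.restrict_apply_univ]
  have main2 := ENNReal.toReal_mono (by
    refine ENNReal.mul_ne_top (ENNReal.mul_ne_top ENNReal.ofReal_ne_top f1) fM) main
  rw [ENNReal.toReal_mul, ENNReal.toReal_mul, ENNReal.toReal_ofReal (by positivity)] at main2
  refine main2.trans ?_
  have e2 : (L ^ n * (2 * ρ)) ^ 4 * (volume (Metric.ball (0:EE) 1)).toReal * (volume (Metric.closedBall (0:EE) M)).toReal =
    b * (L ^ 4) ^ n * ρ ^ 4 := by rw [hb]; simp only [Measure.real]; ring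
  rw [e2]
  gcongr
  linarith
end
end

noncomputable section


section
variable {f g f' g' : EE → EE} {d : ℕ} {R C c : ℝ}
open MeasureTheory

theorem cutoff_bdd {χ : EE → ℝ} (h : Continuous χ) (hc : HasCompactSupport χ) : ∃ K : ℝ, 0 ≤ K ∧ ∀ e, χ e ≤ K := by
  obtain ⟨K, hK⟩ := hc.exists_bound_of_continuous h
  exact ⟨K, (norm_nonneg _).trans (hK 0), fun e => (le_abs_self _).trans (hK e)⟩

theorem real_ball {χ : EE → ℝ} (hc : HasCompactSupport χ) :
    ∃ M : ℝ, 0 < M ∧ ∀ e, M < ‖e‖ → e ∉ tsupport χ := by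
  obtain ⟨M, hM⟩ := hc.isBounded.subset_closedBall (0 : EE)
  refine ⟨max M 1, by positivity, fun e he h => ?_⟩
  have := hM h
  rw [mem_closedBall_zero_iff] at this
  exact absurd (this.trans (le_max_left M 1)) (not_le.2 he)

theorem integrand_bound {η r m S W Δ i1 i2 : ℝ} (h0 : 0 < η) (h1 : η ≤ 1) (r0 : 0 ≤ r) (hm : m = max 1 r) (hS : r ^ 2 ≤ S)
    (hS' : (η ^ 5) ^ 2 ≤ S)
    (hW : 0 ≤ W) (hΔ0 : 0 ≤ Δ) (hΔ : Δ ≤ W * m ^ 2) (hΔ' : r < η → Δ ≤ W * r)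
    (hi1 : 0 ≤ i1) (hi2 : 0 ≤ i2) (hi1' : r ≤ η → i1 = 1) (hi2' : r ≤ η ^ 3 → i2 = 1) :
    (η ^ 5) ^ 2 * Δ ^ 2 / S ^ 3 ≤ W ^ 2 * (η ^ 4 + (η ^ 2)⁻¹ * i1 + (η ^ 10)⁻¹ * i2) := by
  have p1 : 0 ≤ W ^ 2 * η ^ 4 := by positivity
  have p2 : 0 ≤ W ^ 2 * ((η ^ 2)⁻¹ * i1) := by positivity
  have p3 : 0 ≤ W ^ 2 * ((η ^ 10)⁻¹ * i2) := by positivity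
  rw [mul_add, mul_add]
  by_cases h : η ≤ r
  · have := real_big h0 h1 h hm hS hW hΔ0 hΔ
    linarith
  · push Not at h
    by_cases h3 : η ^ 3 ≤ r
    · have := real_mid h0 h3 hS hW hΔ0 (hΔ' h)
      rw [hi1' h.le] at p2 ⊢
      simp only [mul_one] at p2 ⊢
      linarith
    · push Not at h3
      have := real_low h0 r0 hS hS' hW hΔ0 (hΔ' h)
      rw [hi2' h3.le] at p3 ⊢
      simp only [mul_one] at p3 ⊢
      linarith

theorem Aint_lim (H : HP f g d R C c) (H' : HP f' g' d R C c) {X Y : EE → EE}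
    (hX : Differentiable ℂ X) (hY : Differentiable ℂ Y)
    (hΔ : ∀ n z w, f^[n] z = sw (f'^[n] w) → (PV f X n z).2 * (PV f' Y n w).2 = (PV f X n z).1 * (PV f' Y n w).1)
    {χ χ' : EE → ℝ}
    (h : ContDiff ℝ (⊤ : ℕ∞) χ) (h' : ContDiff ℝ (⊤ : ℕ∞) χ')
    (hc : HasCompactSupport χ) (hc' : HasCompactSupport χ') (h0 : ∀ e, 0 ≤ χ e) (h0' : ∀ e, 0 ≤ χ' e) :
    Tendsto (Aint f f' X Y χ χ') atTop (𝓝 0) := by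
  obtain ⟨K, K0, hK⟩ := cutoff_bdd h.continuous hc
  obtain ⟨K', K0', hK'⟩ := cutoff_bdd h'.continuous hc'
  obtain ⟨M1, M10, hM1⟩ := real_ball hc
  obtain ⟨M2, M20, hM2⟩ := real_ball hc'
  obtain ⟨M, hM⟩ : ∃ M, M = max R (max M1 M2) := ⟨_, rfl⟩
  have hRM : R ≤ M := hM ▸ le_max_left _ _
  have hM1M : M1 ≤ M := hM ▸ (le_max_left _ _).trans (le_max_right _ _)
  have hM2M : M2 ≤ M := hM ▸ (le_max_right _ _).trans (le_max_right _ _)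
  obtain ⟨A1, L1, A11, L11, hb⟩ := Δ_big H H' hX hY hRM
  obtain ⟨A2, L2, A21, L21, hs⟩ := Δ_small H H' hX hY hΔ M
  obtain ⟨A3, L3, A31, L31, hv⟩ := Sset_vol H H' M
  obtain ⟨A, hAA⟩ : ∃ A, A = max A1 A2 := ⟨_, rfl⟩
  obtain ⟨L, hL⟩ : ∃ L, L = max L1 L2 := ⟨_, rfl⟩
  have A1le : A1 ≤ A := hAA ▸ le_max_left _ _
  have A2le : A2 ≤ A := hAA ▸ le_max_right _ _
  have L1le : L1 ≤ L := hL ▸ le_max_left _ _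
  have L2le : L2 ≤ L := hL ▸ le_max_right _ _
  have A0 : 1 ≤ A := A11.trans A1le
  have L0 : 1 ≤ L := L11.trans L1le
  have fc := H.F.diff.continuous
  have fc' := H'.F.diff.continuous
  obtain ⟨V, hV⟩ : ∃ V, V = (volume : Measure E4).real (Metric.closedBall 0 M) := ⟨_, rfl⟩
  have V0 : 0 ≤ V := hV ▸ measureReal_nonneg
  have fin : (volume : Measure E4) (Metric.closedBall 0 M) < ⊤ := (isCompact_closedBall 0 M).measure_lt_top
  have sub : ∀ n ρ, Sset f f' M n ρ ⊆ Metric.closedBall 0 M := fun n ρ e he => by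
    simpa using he.1
  have key : ∀ᶠ n in atTop, Aint f f' X Y χ χ' n ≤
      (K * K' * A ^ 2 * V) * (L ^ 2) ^ n * ηη n + (2 * (K * K' * A ^ 2 * A3)) * (L ^ 2 * L3) ^ n * ηη n := by
    filter_upwards [hs] with n hs
    have η0 := ηη_pos n
    have η1 := ηη_le n
    obtain ⟨W, hW⟩ : ∃ W, W = A * L ^ n := ⟨_, rfl⟩
    have W0 : 0 ≤ W := by rw [hW]; positivity
    let I0 : E4 → ℝ := (Metric.closedBall (0:E4) M).indicator 1
    let I1 : E4 → ℝ := (Sset f f' M n (ηη n)).indicator 1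
    let I2 : E4 → ℝ := (Sset f f' M n (ηη n ^ 3)).indicator 1
    let B : E4 → ℝ := fun e => K * K' * W ^ 2 * (ηη n ^ 4 * I0 e + (ηη n ^ 2)⁻¹ * I1 e + (ηη n ^ 10)⁻¹ * I2 e)
    have i0 : Integrable I0 := (integrable_indicator_iff Metric.isClosed_closedBall.measurableSet).2 (integrableOn_const fin.ne)
    have i1 : Integrable I1 := (integrable_indicator_iff (Sset_meas fc fc' _ _ _)).2 (integrableOn_const ((measure_mono (sub _ _)).trans_lt fin).ne)
    have i2 : Integrable I2 := (integrable_indicator_iff (Sset_meas fc fc' _ _ _)).2 (integrableOn_const ((measure_mono (sub _ _)).trans_lt fin).ne)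
    have v0 : ∫ e, I0 e = V := by
      rw [hV]; exact integral_indicator_one Metric.isClosed_closedBall.measurableSet
    have v1 : ∫ e, I1 e ≤ A3 * L3 ^ n * ηη n ^ 4 := by
      refine le_trans (le_of_eq ?_) (hv n (ηη n) η0.le η1)
      exact integral_indicator_one (Sset_meas fc fc' _ _ _)
    have v2 : ∫ e, I2 e ≤ A3 * L3 ^ n * (ηη n ^ 3) ^ 4 := by
      refine le_trans (le_of_eq ?_) (hv n (ηη n ^ 3) (by positivity) (pow_le_one₀ η0.le η1))
      exact integral_indicator_one (Sset_meas fc fc' _ _ _)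
    have ind0 : ∀ (s : Set E4) (e : E4), 0 ≤ s.indicator (1 : E4 → ℝ) e := fun s e =>
      indicator_nonneg (fun _ _ => zero_le_one) _
    have step1 : Aint f f' X Y χ χ' n ≤ ∫ e, B e := by
      unfold Aint
      refine integral_mono_of_nonneg (Eventually.of_forall fun e => ?_)
        ((((i0.const_mul _).add (i1.const_mul _)).add (i2.const_mul _)).const_mul _) (Eventually.of_forall fun e => ?_)
      · have := SS_pos (pow_pos (εε_pos n) 2) (hA f f' n) (hB f f' n) e
        have := h0 e.1
        have := h0' e.2
        positivity
      · show _ ≤ K * K' * W ^ 2 * (ηη n ^ 4 * I0 e + (ηη n ^ 2)⁻¹ * I1 e + (ηη n ^ 10)⁻¹ * I2 e)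
        have n0 : 0 ≤ I0 e := ind0 _ _
        have n1 : 0 ≤ I1 e := ind0 _ _
        have n2 : 0 ≤ I2 e := ind0 _ _
        have rhs0 : 0 ≤ K * K' * W ^ 2 * (ηη n ^ 4 * I0 e + (ηη n ^ 2)⁻¹ * I1 e + (ηη n ^ 10)⁻¹ * I2 e) := by
          positivity
        by_cases he : ‖e‖ ≤ M
        · have e0 : I0 e = 1 := indicator_of_mem (by simpa using he) _
          rw [e0, mul_one, mul_assoc (K * K')]
          have := SS_pos (pow_pos (εε_pos n) 2) (hA f f' n) (hB f f' n) e
          have a0 := h0 e.1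
          have a0' := h0' e.2
          refine mul_le_mul (mul_le_mul (hK _) (hK' _) (h0' _) K0) ?_ (by positivity) (by positivity)
          have rs := rr_sq f f' n e
          refine integrand_bound η0 η1 (norm_nonneg _ : 0 ≤ rr f f' n e) (rfl : max 1 (rr f f' n e) = _) (rs.trans ?_) ?_ W0 (norm_nonneg _) ?_ ?_ n1 n2 ?_ ?_
          · unfold SS; have := εε_pos n; nlinarith
          · unfold SS; show εε n ^ 2 ≤ _; nlinarith [sq_nonneg ‖hA f f' n e‖, sq_nonneg ‖hB f f' n e‖]
          · refine (hb n e he).trans ?_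
            rw [hW]
            gcongr
          · intro hr
            refine (hs e he hr).trans ?_
            rw [hW]
            have : 0 ≤ rr f f' n e := norm_nonneg _
            gcongr
            exact le_refl _
          · intro hr
            exact indicator_of_mem (show e ∈ Sset f f' M n (ηη n) from ⟨he, hr⟩) _
          · intro hr
            exact indicator_of_mem (show e ∈ Sset f f' M n (ηη n ^ 3) from ⟨he, hr⟩) _
        · push Not at he
          have : χ e.1 * χ' e.2 = 0 := by
            rw [Prod.norm_def] at he
            rcases lt_max_iff.1 he with h | h
            · rw [image_eq_zero_of_notMem_tsupport (hM1 e.1 (hM1M.trans_lt h)), zero_mul]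
            · rw [image_eq_zero_of_notMem_tsupport (hM2 e.2 (hM2M.trans_lt h)), mul_zero]
          simp only []
          rw [this, zero_mul]
          exact rhs0
    have step2 : ∫ e, B e = K * K' * W ^ 2 * (ηη n ^ 4 * V + (ηη n ^ 2)⁻¹ * (∫ e, I1 e) + (ηη n ^ 10)⁻¹ * ∫ e, I2 e) := by
      show ∫ e, K * K' * W ^ 2 * (ηη n ^ 4 * I0 e + (ηη n ^ 2)⁻¹ * I1 e + (ηη n ^ 10)⁻¹ * I2 e) = _
      have i01 : Integrable (fun e => ηη n ^ 4 * I0 e + (ηη n ^ 2)⁻¹ * I1 e) := (i0.const_mul _).add (i1.const_mul _)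
      rw [integral_const_mul, integral_add i01 (i2.const_mul _),
        integral_add (i0.const_mul _) (i1.const_mul _), integral_const_mul, integral_const_mul, integral_const_mul, v0]
    have e1 : (ηη n ^ 2)⁻¹ * (∫ e, I1 e) ≤ A3 * L3 ^ n * ηη n := by
      calc (ηη n ^ 2)⁻¹ * (∫ e, I1 e) ≤ (ηη n ^ 2)⁻¹ * (A3 * L3 ^ n * ηη n ^ 4) := by gcongr
        _ = A3 * L3 ^ n * ηη n ^ 2 := by field_simp
        _ ≤ A3 * L3 ^ n * ηη n ^ 1 := by
          gcongr A3 * L3 ^ n * ?_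
          exact pow_le_pow_of_le_one η0.le η1 (by norm_num)
        _ = _ := by ring
    have e2 : (ηη n ^ 10)⁻¹ * (∫ e, I2 e) ≤ A3 * L3 ^ n * ηη n := by
      calc (ηη n ^ 10)⁻¹ * (∫ e, I2 e) ≤ (ηη n ^ 10)⁻¹ * (A3 * L3 ^ n * (ηη n ^ 3) ^ 4) := by gcongr
        _ = A3 * L3 ^ n * ηη n ^ 2 := by field_simp
        _ ≤ A3 * L3 ^ n * ηη n ^ 1 := by
          gcongr A3 * L3 ^ n * ?_
          exact pow_le_pow_of_le_one η0.le η1 (by norm_num)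
        _ = _ := by ring
    have e3 : ηη n ^ 4 * V ≤ ηη n * V := by
      have : ηη n ^ 4 ≤ ηη n ^ 1 := pow_le_pow_of_le_one η0.le η1 (by norm_num)
      rw [pow_one] at this
      gcongr
    rw [step2] at step1
    refine step1.trans ?_
    calc K * K' * W ^ 2 * (ηη n ^ 4 * V + (ηη n ^ 2)⁻¹ * (∫ e, I1 e) + (ηη n ^ 10)⁻¹ * ∫ e, I2 e)
        ≤ K * K' * W ^ 2 * (ηη n * V + A3 * L3 ^ n * ηη n + A3 * L3 ^ n * ηη n) := by
          refine mul_le_mul_of_nonneg_left ?_ (by positivity)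
          linarith
      _ = _ := by rw [hW]; ring
  have lim := (exp_eta_lim (K * K' * A ^ 2 * V) (L ^ 2)).add (exp_eta_lim (2 * (K * K' * A ^ 2 * A3)) (L ^ 2 * L3))
  rw [add_zero] at lim
  refine squeeze_zero' (Eventually.of_forall fun n => ?_) key lim
  refine integral_nonneg fun e => ?_
  have := SS_pos (pow_pos (εε_pos n) 2) (hA f f' n) (hB f f' n) e
  have := h0 e.1
  have := h0' e.2
  show 0 ≤ χ e.1 * χ' e.2 * _
  positivity

theorem partC (H : HP f g d R C c) (H' : HP f' g' d R C c) {X Y : EE → EE}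
    (hX : Differentiable ℂ X) (hY : Differentiable ℂ Y)
    (hΔ : ∀ n z w, f^[n] z = sw (f'^[n] w) → (PV f X n z).2 * (PV f' Y n w).2 = (PV f X n z).1 * (PV f' Y n w).1) :
    HH f d X ∨ HH f' d Y := by
  by_contra hcon
  push Not at hcon
  obtain ⟨χ, h, hc, h0, q, hq, t⟩ := H.notHH hX hcon.1
  obtain ⟨χ', h', hc', h0', q', hq', t'⟩ := H'.notHH hY hcon.2
  exact partC_assembly H H' hX hY h h' hc hc' h0 h0' hq hq' t t' (Aint_lim H H' hX hY hΔ h h' hc hc' h0 h0')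

end
end

noncomputable section


section
open MeasureTheory

/-- convolution of functions on `EE` -/
def cv (L m : EE → ℂ) (z : EE) : ℂ := ∫ w, L w * m (z - w)

theorem cv_eq (L m : EE → ℂ) : cv L m = convolution L m (ContinuousLinearMap.mul ℝ ℂ) volume := rfl

theorem cv_sm {L m : EE → ℂ} (hL : Continuous L) (hm : Sm m) (hc : HasCompactSupport m) : Sm (cv L m) := by
  rw [cv_eq]
  exact hc.contDiff_convolution_right _ hL.locallyIntegrable hm

theorem rf_sm {m : EE → ℂ} (hm : Sm m) (z : EE) : Sm (fun w => m (z - w)) :=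
  hm.comp (contDiff_const.sub contDiff_id)

theorem rf_cs {m : EE → ℂ} (hc : HasCompactSupport m) (z : EE) : HasCompactSupport (fun w => m (z - w)) :=
  hc.comp_homeomorph (Homeomorph.subLeft z)

theorem rf_W {m : EE → ℂ} (hm : Sm m) (z : EE) (s : ℂ) (v w : EE) :
    Wi s v (fun w => m (z - w)) w = - Wi s v m (z - w) := by
  have h : HasFDerivAt (fun w => m (z - w)) (-fderiv ℝ m (z - w)) w := by
    have h1 : HasFDerivAt (fun w : EE => z - w) (-(ContinuousLinearMap.id ℝ EE)) w := by
      simpa using (hasFDerivAt_id w).const_sub z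
    have h2 := (hm.diff (z - w)).hasFDerivAt.comp w h1
    have h3 : (fderiv ℝ m (z - w)).comp (-(ContinuousLinearMap.id ℝ EE)) = -fderiv ℝ m (z - w) := by
      refine ContinuousLinearMap.ext fun v => ?_
      simp
    rw [h3] at h2
    exact h2
  simp only [Wi]
  rw [h.fderiv]
  simp; ring

theorem cv_int {L m : EE → ℂ} (hL : Continuous L) (hm : Continuous m) (hc : HasCompactSupport m) (z : EE) :
    Integrable (fun w => L w * m (z - w)) :=
  (hL.mul (hm.comp (continuous_const.sub continuous_id))).integrable_of_hasCompactSupport (rf_cs hc z).mul_left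

theorem Wi_cv {L m : EE → ℂ} (hL : Continuous L) (hm : Sm m) (hc : HasCompactSupport m) (s : ℂ) (v z : EE) :
    Wi s v (cv L m) z = cv L (Wi s v m) z := by
  have h1 : ∀ v, fderiv ℝ (cv L m) z v = cv L (fun a => fderiv ℝ m a v) z := fun v => by
    rw [cv_eq, (hc.hasFDerivAt_convolution_right (ContinuousLinearMap.mul ℝ ℂ) hL.locallyIntegrable
      (hm.of_le (by simp)) z).fderiv, convolution_precompR_apply _ hL.locallyIntegrable (hc.fderiv ℝ) (hm.continuous_fderiv (by simp))]
    rfl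
  have c : ∀ v : EE, Continuous (fun a => fderiv ℝ m a v) := fun v =>
    (hm.continuous_fderiv (by simp)).clm_apply continuous_const
  have hcs : ∀ v : EE, HasCompactSupport (fun a => fderiv ℝ m a v) := fun v =>
    (hc.fderiv ℝ).comp_left (g := fun L : EE →L[ℝ] ℂ => L v) (by simp)
  simp only [Wi, h1]
  simp only [cv]
  rw [← integral_const_mul, ← integral_add (cv_int hL (c v) (hcs v) z) ((cv_int hL (c _) (hcs _) z).const_mul s), ← integral_const_mul]
  congr 1; funext w; simp only [Wi]; ring

/-- derivative along X -/
def XA (X : EE → EE) (A : EE → ℂ) (w : EE) : ℂ := (X w).1 * wd (1,0) A w + (X w).2 * wd (0,1) A w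

theorem XA_eq (X : EE → EE) (A : EE → ℂ) (w : EE) : XA X A w = wd (X w) A w := by
  conv_rhs => rw [EE_decomp (X w)]
  have := wd_dir_add A (-Complex.I) ((X w).1 • ((1, 0) : EE)) ((X w).2 • ((0, 1) : EE)) w
  rw [wd, this]
  exact (congrArg₂ _ (wd_dir_smul _ _ _ _) (wd_dir_smul _ _ _ _)).symm

def dvX (X : EE → EE) (w : EE) : ℂ := fderiv ℂ (fun z => (X z).1) w (1,0) + fderiv ℂ (fun z => (X z).2) w (0,1)

def TT (X : EE → EE) (G m : EE → ℂ) (z : EE) : ℂ :=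
  cv (fun w => G w * (X w).1) (wd (1,0) m) z + cv (fun w => G w * (X w).2) (wd (0,1) m) z
    - cv (fun w => G w * dvX X w) m z

variable {X : EE → EE} (hX : Differentiable ℂ X)

theorem dvX_cont (hX : Differentiable ℂ X) : Continuous (dvX X) :=
  ((differentiable_fderiv_apply_entire hX.fst _).continuous).add ((differentiable_fderiv_apply_entire hX.snd _).continuous)

theorem TT_sm (hX : Differentiable ℂ X) {G m : EE → ℂ} (hG : Continuous G) (hm : Sm m) (hc : HasCompactSupport m) : Sm (TT X G m) := by
  have c1 := hX.continuous.fst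
  have c2 := hX.continuous.snd
  exact ((cv_sm (hG.fun_mul c1) (hm.W _ _) (hasCompactSupport_Wi hc _ _)).add
    (cv_sm (hG.fun_mul c2) (hm.W _ _) (hasCompactSupport_Wi hc _ _))).sub (cv_sm (hG.fun_mul (dvX_cont hX)) hm hc)

theorem Wi_TT (hX : Differentiable ℂ X) {G m : EE → ℂ} (hG : Continuous G) (hm : Sm m) (hc : HasCompactSupport m) (s : ℂ) (v z : EE) :
    Wi s v (TT X G m) z = TT X G (Wi s v m) z := by
  have c1 := hX.continuous.fst
  have c2 := hX.continuous.snd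
  have s1 := cv_sm (hG.fun_mul c1) (hm.W (-Complex.I) (1,0)) (hasCompactSupport_Wi hc _ _)
  have s2 := cv_sm (hG.fun_mul c2) (hm.W (-Complex.I) (0,1)) (hasCompactSupport_Wi hc _ _)
  have s3 := cv_sm (hG.fun_mul (dvX_cont hX)) hm hc
  have e1 := Wi_sub s v ((s1.diff z).add (s2.diff z)) (s3.diff z)
  have e2 := Wi_add s v (s1.diff z) (s2.diff z)
  have e3 : Wi s v (TT X G m) z = _ := e1.trans (congrArg₂ _ e2 rfl)
  rw [e3, Wi_cv (hG.fun_mul c1) (hm.W _ _) (hasCompactSupport_Wi hc _ _), Wi_cv (hG.fun_mul c2) (hm.W _ _) (hasCompactSupport_Wi hc _ _),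
    Wi_cv (hG.fun_mul (dvX_cont hX)) hm hc, Wi_comm hm s (-Complex.I) v (1,0), Wi_comm hm s (-Complex.I) v (0,1)]
  rfl

theorem TT_smooth (hX : Differentiable ℂ X) {A m : EE → ℂ} (hA : Sm A) (hm : Sm m) (hc : HasCompactSupport m) (z : EE) :
    TT X A m z = ∫ w, XA X A w * m (z - w) := by
  have ibp : ∀ (Y : EE → ℂ) (hY : Differentiable ℂ Y) (v : EE),
      ∫ w, Y w * wd v A w * m (z - w) = cv (fun w => A w * Y w) (wd v m) z - cv (fun w => A w * fderiv ℂ Y w v) m z := by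
    intro Y hY v
    have h1 := Wi_ibp volume hA ((sm_of_entire hY).mul (rf_sm hm z)) (rf_cs hc z).mul_left (-Complex.I) v
    have h2 : ∫ w, Y w * wd v A w * m (z - w) = ∫ w, Wi (-Complex.I) v A w * (Y w * m (z - w)) := by
      congr 1; funext w; simp only [wd]; ring
    rw [h2, h1]
    simp only [cv]
    rw [← integral_sub (cv_int (hA.continuous.fun_mul hY.continuous) (hm.W _ _).continuous (hasCompactSupport_Wi hc _ _) z)
      (cv_int (hA.continuous.fun_mul (differentiable_fderiv_apply_entire hY v).continuous) hm.continuous hc z), ← integral_neg]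
    congr 1; funext w
    rw [Wi_mul _ _ ((sm_of_entire hY).diff w) ((rf_sm hm z).diff w), rf_W hm]
    have := wd_holo (hY w) v
    simp only [wd] at this ⊢
    rw [this]; ring
  have c1 := hX.continuous.fst
  have c2 := hX.continuous.snd
  have d1 := (differentiable_fderiv_apply_entire hX.fst (1,0)).continuous
  have d2 := (differentiable_fderiv_apply_entire hX.snd (0,1)).continuous
  have e0 : ∫ w, XA X A w * m (z - w) = (∫ w, (X w).1 * wd (1,0) A w * m (z - w)) + ∫ w, (X w).2 * wd (0,1) A w * m (z - w) := by
    rw [← integral_add (cv_int (c1.fun_mul (hA.W _ _).continuous) hm.continuous hc z) (cv_int (c2.fun_mul (hA.W _ _).continuous) hm.continuous hc z)]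
    congr 1; funext w; simp only [XA]; ring
  have e1 : cv (fun w => A w * dvX X w) m z = cv (fun w => A w * fderiv ℂ (fun z => (X z).1) w (1,0)) m z
      + cv (fun w => A w * fderiv ℂ (fun z => (X z).2) w (0,1)) m z := by
    simp only [cv]
    rw [← integral_add (cv_int (hA.continuous.fun_mul d1) hm.continuous hc z) (cv_int (hA.continuous.fun_mul d2) hm.continuous hc z)]
    congr 1; funext w; simp only [dvX]; ring
  rw [e0, ibp _ hX.fst, ibp _ hX.snd, TT, e1]
  ring

theorem cv_conv {A : ℕ → EE → ℂ} {G m Y : EE → ℂ} (hA : ∀ n, Continuous (A n)) (hG : Continuous G) (h : LU A G)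
    (hY : Continuous Y) (hm : Continuous m) (hc : HasCompactSupport m) (z : EE) :
    Tendsto (fun n => cv (fun w => A n w * Y w) m z) atTop (𝓝 (cv (fun w => G w * Y w) m z)) := by
  have := integral_conv_LU volume hA hG (L := fun w => Y w * m (z - w)) (hY.mul (hm.comp (continuous_const.sub continuous_id)))
    (rf_cs hc z).mul_left h
  simpa only [cv, mul_assoc] using this

theorem TT_conv (hX : Differentiable ℂ X) {A : ℕ → EE → ℂ} {G m : EE → ℂ} (hA : ∀ n, Continuous (A n)) (hG : Continuous G) (h : LU A G)
    (hm : Sm m) (hc : HasCompactSupport m) (z : EE) :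
    Tendsto (fun n => TT X (A n) m z) atTop (𝓝 (TT X G m z)) :=
  ((cv_conv hA hG h hX.continuous.fst (hm.W _ _).continuous (hasCompactSupport_Wi hc _ _) z).add
    (cv_conv hA hG h hX.continuous.snd (hm.W _ _).continuous (hasCompactSupport_Wi hc _ _) z)).sub
    (cv_conv hA hG h (dvX_cont hX) hm.continuous hc z)

variable {f g : EE → EE} {d : ℕ} {R C c : ℝ}

/-- complex version of the approximants -/
def Ac (f : EE → EE) (d n : ℕ) (e : EE) : ℂ := (AG f d n e : ℂ)
def Gc (f : EE → EE) (d : ℕ) (e : EE) : ℂ := (GG f d e : ℂ)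

theorem Ac_eq (f : EE → EE) (d n : ℕ) : Ac f d n = fun e => ((1 / (2 * (d : ℝ) ^ n) : ℝ) : ℂ) * LS 1 (px f n) (fun _ => 0) e := by
  funext e
  simp only [Ac, AG, LS, SS_one, px]
  push_cast; rfl

theorem LSp_sm (hf : Differentiable ℂ f) (n : ℕ) : Sm (LS 1 (px f n) (fun _ => 0)) :=
  LS_smooth one_pos (px_diff hf n) (differentiable_const _)

theorem Ac_sm (hf : Differentiable ℂ f) (n : ℕ) : Sm (Ac f d n) := by
  rw [Ac_eq]; exact contDiff_const.mul (LSp_sm hf n)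

theorem Gc_cont (H : HP f g d R C c) : Continuous (Gc f d) := Complex.continuous_ofReal.comp H.GG_continuous

theorem Ac_LU (H : HP f g d R C c) : LU (Ac f d) (Gc f d) := by
  intro M
  obtain ⟨K, hK, hb⟩ := H.AG_conv M
  refine ⟨fun n => K * (1/2)^n, by simpa using (tendsto_pow_atTop_nhds_zero_of_lt_one (r := (1/2:ℝ)) (by norm_num) (by norm_num)).const_mul K, fun n e he => ?_⟩
  have := hb e he n
  simp only [Ac, Gc]
  rw [← Complex.ofReal_sub, Complex.norm_real]
  exact this

theorem XA_Ac (hf : Differentiable ℂ f) (n : ℕ) (w : EE) : XA X (Ac f d n) w =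
    ((1 / (2 * (d : ℝ) ^ n) : ℝ) : ℂ) * (fderiv ℂ (px f n) w (X w) * (starRingEnd ℂ) (px f n w) / ((1 + ‖px f n w‖ ^ 2 : ℝ) : ℂ)) := by
  rw [XA_eq, Ac_eq, wd, Wi_const_mul _ _ _ ((LSp_sm hf n).diff w)]
  have := wd_LS one_pos (px_diff hf n) (differentiable_const (0:ℂ)) (X w) w
  rw [wd] at this
  rw [this, SS_one]
  simp

theorem XA_sm (hX : Differentiable ℂ X) {A : EE → ℂ} (hA : Sm A) : Sm (XA X A) :=
  ((sm_of_entire hX.fst).mul (hA.W _ _)).add ((sm_of_entire hX.snd).mul (hA.W _ _))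

theorem wb_XA (hX : Differentiable ℂ X) {A : EE → ℂ} (hA : Sm A) (v w : EE) : wb v (XA X A) w = Lv A (X w) v w := by
  have s1 := sm_of_entire hX.fst
  have s2 := sm_of_entire hX.snd
  have t1 := hA.W (-Complex.I) (1,0)
  have t2 := hA.W (-Complex.I) (0,1)
  have e1 := Wi_add Complex.I v ((s1.diff w).fun_mul (t1.diff w)) ((s2.diff w).fun_mul (t2.diff w))
  have e2 := Wi_mul Complex.I v (s1.diff w) (t1.diff w)
  have e3 := Wi_mul Complex.I v (s2.diff w) (t2.diff w)
  have h1 := wb_holo (hX.fst w) v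
  have h2 := wb_holo (hX.snd w) v
  have e4 : wb v (XA X A) w = _ := e1.trans (congrArg₂ _ e2 e3)
  simp only [wb] at h1 h2
  rw [e4, h1, h2]
  conv_rhs => rw [EE_decomp (X w)]
  rw [Lv_dir_left_add hA, Lv_dir_left_smul hA, Lv_dir_left_smul hA]
  simp only [zero_mul, zero_add]; rfl

theorem Lv_Ac (hf : Differentiable ℂ f) (n : ℕ) (v v' w : EE) : Lv (Ac f d n) v v' w = ((1 / (2 * (d : ℝ) ^ n) : ℝ) : ℂ) *
    (fderiv ℂ (px f n) w v * (starRingEnd ℂ) (fderiv ℂ (px f n) w v') / ((1 + ‖px f n w‖ ^ 2 : ℝ) : ℂ) ^ 2) := by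
  rw [Ac_eq, Lv_const_mul _ (LSp_sm hf n), Lv_LS_one (px_diff hf n), SS_one]

end
end

noncomputable section


section
open MeasureTheory

variable {f g X : EE → EE} {d : ℕ} {R C c : ℝ}

theorem exists_dominating {φ : EE → ℂ} (hφ : Continuous φ) (hc : HasCompactSupport φ) :
    ∃ χ : EE → ℝ, ContDiff ℝ (⊤ : ℕ∞) χ ∧ HasCompactSupport χ ∧ (∀ e, 0 ≤ χ e) ∧ ∀ e, ‖φ e‖ ≤ χ e := by
  obtain ⟨K, hK⟩ := hc.exists_bound_of_continuous hφ
  have K0 : 0 ≤ K := (norm_nonneg _).trans (hK 0)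
  obtain ⟨M, M0, hM⟩ := exists_ball_of_compactSupport hc
  obtain ⟨χ, h1, h2, h3, h4, h5, h6⟩ := exists_cutoff EE M0
  refine ⟨fun e => K * χ e, contDiff_const.mul h1, h2.mul_left, fun e => mul_nonneg K0 (h3 e), fun e => ?_⟩
  show ‖φ e‖ ≤ K * χ e
  by_cases he : ‖e‖ ≤ M
  · rw [h5 e he, mul_one]; exact hK e
  · rw [image_eq_zero_of_notMem_tsupport (hM e (not_le.1 he)), norm_zero]
    exact mul_nonneg K0 (h3 e)

theorem fd_cont {p : EE → ℂ} (hp : Differentiable ℂ p) {Y : EE → EE} (hY : Continuous Y) :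
    Continuous fun w => fderiv ℂ p w (Y w) :=
  ((contDiff_of_entire hp).continuous_fderiv (by simp)).clm_apply hY

theorem Kq_cont {p : EE → ℂ} (hp : Differentiable ℂ p) (hX : Continuous X) (k : ℕ) : Continuous (Kq X p k) := by
  unfold Kq
  refine ((fd_cont hp hX).norm.pow 2).div₀ ((continuous_const.add (hp.continuous.norm.pow 2)).pow k) fun e => ?_
  positivity

theorem Lv_lim (H : HP f g d R C c) (hX : Differentiable ℂ X) (hH : HH f d X) {φ : EE → ℂ} (hφ : Continuous φ)
    (hc : HasCompactSupport φ) (v : EE) :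
    Tendsto (fun n => ∫ w, Lv (Ac f d n) (X w) v w * φ w) atTop (𝓝 0) := by
  obtain ⟨χ, h1, h2, h3, h4⟩ := exists_dominating hφ hc
  have tX := hH χ h1 h2 h3
  have hv : Differentiable ℂ (fun _ : EE => v) := differentiable_const _
  have tv := (H.II2 hv h1 h2).norm
  obtain ⟨B, hB⟩ : ∃ B, ∀ n, II f d (fun _ => v) 2 n χ ≤ B := by
    obtain ⟨B, hB⟩ := tv.bddAbove_range
    refine ⟨B, fun n => le_trans ?_ (hB (mem_range_self n))⟩
    rw [Complex.norm_real]; exact le_abs_self _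
  have B0 : 0 ≤ B := (II_nonneg f d _ 2 0 h3).trans (hB 0)
  have bound : ∀ l : ℝ, 0 < l → ∀ n, ‖∫ w, Lv (Ac f d n) (X w) v w * φ w‖ ≤ l⁻¹ * II f d X 2 n χ + l * B := by
    intro l l0 n
    have N0 : (0:ℝ) < 1 / (2 * (d : ℝ) ^ n) := by have := pow_pos H.dpos n; positivity
    obtain ⟨N, hN⟩ : ∃ N, N = 1 / (2 * (d : ℝ) ^ n) := ⟨_, rfl⟩
    rw [← hN] at N0
    have hp := px_diff H.F.diff n
    have iX : Integrable (fun w => χ w * Kq X (px f n) 2 w) :=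
      (h1.continuous.mul (Kq_cont hp hX.continuous 2)).integrable_of_hasCompactSupport h2.mul_right
    have iv : Integrable (fun w => χ w * Kq (fun _ => v) (px f n) 2 w) :=
      (h1.continuous.mul (Kq_cont hp hv.continuous 2)).integrable_of_hasCompactSupport h2.mul_right
    have e1 : l⁻¹ * II f d X 2 n χ + l * II f d (fun _ => v) 2 n χ =
        ∫ w, (l⁻¹ * N * (χ w * Kq X (px f n) 2 w) + l * N * (χ w * Kq (fun _ => v) (px f n) 2 w)) := by
      rw [integral_add (iX.const_mul _) (iv.const_mul _), integral_const_mul, integral_const_mul]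
      simp only [II, ← hN]; ring
    have : l⁻¹ * II f d X 2 n χ + l * II f d (fun _ => v) 2 n χ ≤ l⁻¹ * II f d X 2 n χ + l * B := by
      have := hB n
      gcongr
    refine le_trans ?_ this
    rw [e1]
    refine norm_integral_le_of_norm_le ((iX.const_mul _).add (iv.const_mul _)) (Eventually.of_forall fun w => ?_)
    rw [Lv_Ac H.F.diff, ← hN]
    obtain ⟨a, ha⟩ : ∃ a, a = ‖fderiv ℂ (px f n) w (X w)‖ := ⟨_, rfl⟩
    obtain ⟨b, hb⟩ : ∃ b, b = ‖fderiv ℂ (px f n) w v‖ := ⟨_, rfl⟩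
    obtain ⟨S, hS⟩ : ∃ S, S = 1 + ‖px f n w‖ ^ 2 := ⟨_, rfl⟩
    have S0 : 0 < S := by rw [hS]; positivity
    have a0 : 0 ≤ a := ha ▸ norm_nonneg _
    have b0 : 0 ≤ b := hb ▸ norm_nonneg _
    simp only [Kq]
    rw [← hS, norm_mul, norm_mul, norm_div, norm_mul, RCLike.norm_conj, norm_pow, Complex.norm_real, Complex.norm_real,
      Real.norm_eq_abs, Real.norm_eq_abs, abs_of_pos N0, abs_of_pos S0, ← ha, ← hb]
    have k1 : a * b ≤ l⁻¹ * a ^ 2 + l * b ^ 2 := by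
      have : 0 ≤ l⁻¹ * (a - l * b) ^ 2 := by positivity
      have h5 : l⁻¹ * (a - l * b) ^ 2 = l⁻¹ * a ^ 2 + l * b ^ 2 - 2 * (a * b) := by field_simp; ring
      nlinarith [mul_nonneg a0 b0]
    calc N * (a * b / S ^ 2) * ‖φ w‖ ≤ N * ((l⁻¹ * a ^ 2 + l * b ^ 2) / S ^ 2) * χ w := by
          have := h4 w
          have := h3 w
          gcongr
      _ = _ := by ring
  rw [Metric.tendsto_atTop]
  intro ε ε0
  obtain ⟨l, l0, hl⟩ : ∃ l : ℝ, 0 < l ∧ l * B < ε / 2 := by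
    refine ⟨ε / (2 * (B + 1)), by positivity, ?_⟩
    rw [div_mul_eq_mul_div, div_lt_iff₀ (by positivity)]
    nlinarith
  have ev := (tX.const_mul l⁻¹)
  rw [mul_zero] at ev
  obtain ⟨n0, hn0⟩ := eventually_atTop.1 (ev.eventually_lt_const (half_pos ε0))
  refine ⟨n0, fun n hn => ?_⟩
  rw [dist_zero_right]
  have := bound l l0 n
  have := hn0 n hn
  linarith

theorem TT_wb_zero (H : HP f g d R C c) (hX : Differentiable ℂ X) (hH : HH f d X) {m : EE → ℂ} (hm : Sm m)
    (hc : HasCompactSupport m) (v z : EE) : wb v (TT X (Gc f d) m) z = 0 := by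
  rw [wb, Wi_TT hX (Gc_cont H) hm hc]
  have t := TT_conv hX (fun n => (Ac_sm H.F.diff n).continuous) (Gc_cont H) (Ac_LU H) (hm.W Complex.I v)
    (hasCompactSupport_Wi hc Complex.I v) z
  refine tendsto_nhds_unique t ((Lv_lim H hX hH (rf_sm hm z).continuous (rf_cs hc z) v).congr fun n => ?_)
  have sA := Ac_sm (d := d) H.F.diff n
  rw [TT_smooth hX sA (hm.W Complex.I v) (hasCompactSupport_Wi hc Complex.I v)]
  simp only [← wb_XA hX sA]
  rw [wb, Wi_ibp volume (XA_sm hX sA) (rf_sm hm z) (rf_cs hc z), ← integral_neg]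
  congr 1; funext w
  rw [rf_W hm]; ring

theorem diff_of_wb {u : EE → ℂ} (hu : Sm u) (h : ∀ v z, wb v u z = 0) : Differentiable ℂ u := by
  intro z
  rw [differentiableAt_iff_restrictScalars ℝ (hu.diff z)]
  let L := fderiv ℝ u z
  have hL : ∀ v, L (Complex.I • v) = Complex.I • L v := fun v => by
    have := h v z
    simp only [wb, Wi] at this
    have h2 : L v + Complex.I * L (Complex.I • v) = 0 := by
      have h3 : (1/2 : ℂ) ≠ 0 := by norm_num
      exact (mul_eq_zero.1 this).resolve_left h3
    have h4 : Complex.I * (L v + Complex.I * L (Complex.I • v)) = 0 := by rw [h2, mul_zero]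
    rw [mul_add, ← mul_assoc, Complex.I_mul_I] at h4
    rw [smul_eq_mul]; linear_combination -h4
  have hc : ∀ (a : ℂ) v, L (a • v) = a • L v := fun a v => by
    have e : a • v = a.re • v + a.im • (Complex.I • v) := by
      conv_lhs => rw [← Complex.re_add_im a]
      rw [add_smul, mul_smul, Complex.coe_smul, Complex.coe_smul]
    rw [e, map_add, map_smul, map_smul, hL]
    conv_rhs => rw [← Complex.re_add_im a]
    simp only [Complex.real_smul, smul_eq_mul]; ring
  refine ⟨⟨{ toFun := L, map_add' := L.map_add, map_smul' := hc }, L.continuous⟩, ?_⟩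
  ext v <;> rfl

theorem TT_holo (H : HP f g d R C c) (hX : Differentiable ℂ X) (hH : HH f d X) {m : EE → ℂ} (hm : Sm m)
    (hc : HasCompactSupport m) : Differentiable ℂ (TT X (Gc f d) m) :=
  diff_of_wb (TT_sm hX (Gc_cont H) hm hc) (TT_wb_zero H hX hH hm hc)

end
end

noncomputable section
open MeasureTheory

def sc (k : ℕ) (φ : EE → ℂ) (z : EE) : ℂ := (((k:ℝ)+1)^4 : ℝ) * φ (((k:ℝ)+1) • z)

theorem kpos (k : ℕ) : (0:ℝ) < (k:ℝ)+1 := by positivity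

theorem sc_zero (k : ℕ) {φ : EE → ℂ} (h0 : ∀ z, 1 < ‖z‖ → φ z = 0) {z : EE} (hz : 1/((k:ℝ)+1) < ‖z‖) : sc k φ z = 0 := by
  have h1 := kpos k
  rw [sc, h0, mul_zero]
  rw [norm_smul, Real.norm_eq_abs, abs_of_pos h1]
  rwa [div_lt_iff₀ h1, mul_comm] at hz

theorem sc_integral {E : Type*} [NormedAddCommGroup E] [NormedSpace ℝ E] (k : ℕ) (ψ : EE → E) (z : EE) :
    ∫ w, (((k:ℝ)+1)^4) • ψ (((k:ℝ)+1) • (z - w)) = ∫ w, ψ w := by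
  rw [integral_sub_left_eq_self (fun u => (((k:ℝ)+1)^4) • ψ (((k:ℝ)+1) • u)) volume z, integral_smul,
    Measure.integral_comp_smul_of_nonneg _ _ _ (hR := (kpos k).le), smul_smul]
  have : Module.finrank ℝ EE = 4 := by
    rw [Module.finrank_prod, Complex.finrank_real_complex]
  rw [this, mul_inv_cancel₀ (by have := kpos k; positivity), one_smul]

theorem sc_cont (k : ℕ) {φ : EE → ℂ} (hφ : Continuous φ) : Continuous (sc k φ) := by
  unfold sc; fun_prop

theorem sc_cs (k : ℕ) {φ : EE → ℂ} (hc : HasCompactSupport φ) : HasCompactSupport (sc k φ) := by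
  have h : HasCompactSupport (fun z : EE => φ (((k:ℝ)+1) • z)) := hc.comp_smul (kpos k).ne'
  exact h.mul_left

theorem sc_sm (k : ℕ) {φ : EE → ℂ} (hφ : Sm φ) : Sm (sc k φ) :=
  contDiff_const.mul (hφ.comp (contDiff_id.const_smul _))

theorem sc_W (k : ℕ) {φ : EE → ℂ} (hφ : Sm φ) (s : ℂ) (v z : EE) :
    Wi s v (sc k φ) z = (((k:ℝ)+1 : ℝ) : ℂ) * sc k (Wi s v φ) z := by
  have h1 : ∀ v, fderiv ℝ (sc k φ) z v = ((((k:ℝ)+1)^4 : ℝ):ℂ) * ((((k:ℝ)+1 : ℝ):ℂ) * fderiv ℝ φ (((k:ℝ)+1) • z) v) := by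
    intro v
    have h0 : HasFDerivAt (fun u : EE => ((k:ℝ)+1) • u) (((k:ℝ)+1) • ContinuousLinearMap.id ℝ EE) z :=
      (hasFDerivAt_id z).fun_const_smul _
    have h2 := ((hφ.diff (((k:ℝ)+1) • z)).hasFDerivAt.comp z h0).const_mul ((((k:ℝ)+1)^4 : ℝ):ℂ)
    have h3 : fderiv ℝ (sc k φ) z = _ := h2.fderiv
    rw [h3]
    simp
  rw [Wi, h1, h1, sc, Wi]
  ring

theorem sc_est (k : ℕ) {φ h : EE → ℂ} (hφ : Continuous φ) (hc : HasCompactSupport φ) (h0 : ∀ z, 1 < ‖z‖ → φ z = 0)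
    {ω : ℝ} {z : EE} (hb : ∀ w, ‖z - w‖ ≤ 1/((k:ℝ)+1) → ‖h w‖ ≤ ω) :
    ‖∫ w, h w * sc k φ (z - w)‖ ≤ ω * ∫ w, ‖φ w‖ := by
  have e : ∀ w, ‖sc k φ (z - w)‖ = (((k:ℝ)+1)^4) • ‖φ (((k:ℝ)+1) • (z - w))‖ := fun w => by
    rw [sc, norm_mul, Complex.norm_real, Real.norm_eq_abs, abs_of_nonneg (by have := kpos k; positivity), smul_eq_mul]
  have h1 : ∫ w, ‖sc k φ (z - w)‖ = ∫ w, ‖φ w‖ := by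
    simp_rw [e]
    exact sc_integral k (fun u => ‖φ u‖) z
  rw [← h1, ← integral_const_mul]
  refine norm_integral_le_of_norm_le ?_ (Eventually.of_forall fun w => ?_)
  · have c1 := (sc_cont k hφ).comp (continuous_const.sub continuous_id : Continuous fun w : EE => z - w)
    exact ((c1.norm).integrable_of_hasCompactSupport (rf_cs (sc_cs k hc) z).norm).const_mul _
  · rw [norm_mul]
    by_cases hw : ‖z - w‖ ≤ 1/((k:ℝ)+1)
    · exact mul_le_mul_of_nonneg_right (hb w hw) (norm_nonneg _)
    · rw [sc_zero k h0 (not_le.mp hw)]; simp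

/-- a bump of integral one -/
structure Moll (ρ : EE → ℂ) : Prop where
  sm : Sm ρ
  cs : HasCompactSupport ρ
  z0 : ∀ z, 1 < ‖z‖ → ρ z = 0
  re : ∀ z, (ρ z).im = 0
  i1 : ∫ w, ρ w = 1
  i2 : ∫ w, ‖ρ w‖ = 1

theorem exists_moll : ∃ ρ, Moll ρ := by
  let b : ContDiffBump (0:EE) := ⟨1/2, 1, by norm_num, by norm_num⟩
  have i1 := b.integral_normed (μ := (volume : Measure EE))
  refine ⟨fun z => (b.normed volume z : ℂ), ?_, ?_, ?_, ?_, ?_, ?_⟩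
  · exact Complex.ofRealCLM.contDiff.comp b.contDiff_normed
  · exact (b.hasCompactSupport_normed (μ := volume)).comp_left Complex.ofReal_zero
  · intro z hz
    have : z ∉ support (b.normed volume) := by
      rw [b.support_normed_eq]
      simp [b]
      linarith
    rw [notMem_support.mp this]; simp
  · intro z; simp
  · rw [integral_complex_ofReal, i1]; simp
  · rw [← i1]; congr 1; funext w
    rw [Complex.norm_real, Real.norm_eq_abs, abs_of_nonneg (b.nonneg_normed w)]

theorem Moll.W0 {ρ : EE → ℂ} (hρ : Moll ρ) (s : ℂ) (v z : EE) (hz : 1 < ‖z‖) : Wi s v ρ z = 0 := by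
  apply Wi_zero_of_notMem
  have : tsupport ρ ⊆ Metric.closedBall 0 1 := by
    apply closure_minimal _ Metric.isClosed_closedBall
    intro u hu
    by_contra h
    exact hu (hρ.z0 u (by simpa using h))
  intro h
  have := this h
  simp at this
  exact absurd hz (not_lt.mpr this)

theorem Moll.int_sc {ρ : EE → ℂ} (hρ : Moll ρ) (k : ℕ) (z : EE) : ∫ w, sc k ρ (z - w) = 1 := by
  rw [← hρ.i1, ← sc_integral k ρ z]
  congr 1

theorem Moll.est {ρ : EE → ℂ} (hρ : Moll ρ) (k : ℕ) {φ : EE → ℂ} (hφ : Continuous φ) {a : ℂ} {ω : ℝ} {z : EE}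
    (hb : ∀ w, ‖z - w‖ ≤ 1/((k:ℝ)+1) → ‖φ w - a‖ ≤ ω) : ‖cv φ (sc k ρ) z - a‖ ≤ ω := by
  have h1 := sc_est k hρ.sm.continuous hρ.cs hρ.z0 (h := fun w => φ w - a) hb
  rw [hρ.i2, mul_one] at h1
  have i1 := cv_int hφ (sc_cont k hρ.sm.continuous) (sc_cs k hρ.cs) z
  have i2 := cv_int (continuous_const (y := a)) (sc_cont k hρ.sm.continuous) (sc_cs k hρ.cs) z
  have : ∫ w, (φ w - a) * sc k ρ (z - w) = cv φ (sc k ρ) z - a := by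
    simp_rw [sub_mul]
    rw [integral_sub i1 i2, integral_const_mul, hρ.int_sc, mul_one]; rfl
  rwa [this] at h1

variable {X : EE → EE}

theorem cv_const {ρ : EE → ℂ} (hρ : Moll ρ) (k : ℕ) (a : ℂ) : cv (fun _ => a) (sc k ρ) = fun _ => a := by
  funext z
  rw [cv, integral_const_mul, hρ.int_sc, mul_one]

theorem cv_sub {L1 L2 m : EE → ℂ} (h1 : Continuous L1) (h2 : Continuous L2) (hm : Continuous m) (hc : HasCompactSupport m) (z : EE) :
    cv (fun w => L1 w - L2 w) m z = cv L1 m z - cv L2 m z := by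
  simp only [cv, sub_mul]
  exact integral_sub (cv_int h1 hm hc z) (cv_int h2 hm hc z)

theorem cv_const_mul (a : ℂ) (L m : EE → ℂ) (z : EE) : cv (fun w => a * L w) m z = a * cv L m z := by
  simp only [cv, mul_assoc]
  exact integral_const_mul _ _

theorem fr_term {Y : EE → ℂ} (hY : Continuous Y) {ρ : EE → ℂ} (hρ : Moll ρ) {B : ℝ} {h : EE → ℂ} (hh : Continuous h)
    {k : ℕ} {z : EE} {ω : ℝ} (hB : ∀ w, ‖z - w‖ ≤ 1/((k:ℝ)+1) → ‖Y w - Y z‖ ≤ B * (1/((k:ℝ)+1)))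
    (hω : ∀ w, ‖z - w‖ ≤ 1/((k:ℝ)+1) → ‖h w‖ ≤ ω) (v : EE) :
    ‖cv (fun w => h w * Y w) (wd v (sc k ρ)) z - Y z * cv h (wd v (sc k ρ)) z‖ ≤ ω * B * ∫ w, ‖wd v ρ w‖ := by
  have sm := (sc_sm k hρ.sm).W (-Complex.I) v
  have cs := hasCompactSupport_Wi (sc_cs k hρ.cs) (-Complex.I) v
  have e : cv (fun w => h w * Y w) (wd v (sc k ρ)) z - Y z * cv h (wd v (sc k ρ)) z
      = ∫ w, ((((k:ℝ)+1 : ℝ) : ℂ) * (h w * (Y w - Y z))) * sc k (wd v ρ) (z - w) := by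
    rw [← cv_const_mul, ← cv_sub (hh.fun_mul hY) (continuous_const.fun_mul hh) sm.continuous cs, cv]
    congr 1; funext w
    rw [wd, sc_W k hρ.sm]; ring
  rw [e]
  refine sc_est k (hρ.sm.W _ _).continuous (hasCompactSupport_Wi hρ.cs _ _) (hρ.W0 _ _) fun w hw => ?_
  have h1 := kpos k
  have a1 := hB w hw
  have a2 := hω w hw
  rw [norm_mul, norm_mul, Complex.norm_real, Real.norm_eq_abs, abs_of_pos h1]
  calc ((k:ℝ)+1) * (‖h w‖ * ‖Y w - Y z‖) ≤ ((k:ℝ)+1) * (ω * (B * (1/((k:ℝ)+1)))) := by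
        have := (norm_nonneg _).trans a2
        gcongr
    _ = ω * B := by field_simp

theorem lip_entire {Y : EE → ℂ} (hY : Differentiable ℂ Y) {M B : ℝ} (hB0 : 0 ≤ B) (hB : ∀ z, ‖z‖ ≤ M + 2 → ‖Y z‖ ≤ B) {z w : EE}
    (hz : ‖z‖ ≤ M + 1) (hw : ‖w‖ ≤ M + 1) : ‖Y w - Y z‖ ≤ B * ‖w - z‖ := by
  refine (convex_closedBall (0:EE) (M+1)).norm_image_sub_le_of_norm_fderiv_le (𝕜 := ℂ) (fun x _ => hY x) (fun x hx => ?_)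
    (by simpa using hz) (by simpa using hw)
  refine norm_fderiv_le_of_entire hY x hB0 fun y hy => hB y ?_
  have h1 : ‖x‖ ≤ M + 1 := by simpa using hx
  have := norm_add_le (y - x) x
  rw [sub_add_cancel] at this
  linarith

theorem friedrichs (hX : Differentiable ℂ X) {ρ : EE → ℂ} (hρ : Moll ρ) (M : ℝ) : ∃ K : ℝ, 0 ≤ K ∧ ∀ (G : EE → ℂ) (hG : Continuous G)
    (k : ℕ) (z : EE) (ω : ℝ), ‖z‖ ≤ M → (∀ w, ‖z - w‖ ≤ 1/((k:ℝ)+1) → ‖G w - G z‖ ≤ ω) →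
    ‖TT X G (sc k ρ) z - XA X (cv G (sc k ρ)) z‖ ≤ K * ω := by
  obtain ⟨B, hB1, hB⟩ := bdd_on_ball hX.continuous (M+2)
  obtain ⟨D, hD0, hD⟩ : ∃ D, 0 ≤ D ∧ ∀ w : EE, ‖w‖ ≤ M + 1 → ‖dvX X w‖ ≤ D := by
    obtain ⟨D, hD⟩ := (isCompact_closedBall (0:EE) (M+1)).exists_bound_of_continuousOn (dvX_cont hX).continuousOn
    exact ⟨max D 0, le_max_right _ _, fun w hw => (hD w (by simpa using hw)).trans (le_max_left _ _)⟩
  obtain ⟨N1, hN1⟩ : ∃ N, N = ∫ w, ‖wd (1,0) ρ w‖ := ⟨_, rfl⟩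
  obtain ⟨N2, hN2⟩ : ∃ N, N = ∫ w, ‖wd (0,1) ρ w‖ := ⟨_, rfl⟩
  have n1 : 0 ≤ N1 := hN1 ▸ integral_nonneg fun w => norm_nonneg _
  have n2 : 0 ≤ N2 := hN2 ▸ integral_nonneg fun w => norm_nonneg _
  refine ⟨B * N1 + B * N2 + D, by positivity, fun G hG k z ω hz hω => ?_⟩
  have hk : 1/((k:ℝ)+1) ≤ 1 := by
    rw [div_le_one (kpos k)]; have : (0:ℝ) ≤ k := k.cast_nonneg
    linarith
  have hw1 : ∀ w, ‖z - w‖ ≤ 1/((k:ℝ)+1) → ‖w‖ ≤ M + 1 := fun w hw => by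
    have := norm_sub_le z (z - w)
    rw [sub_sub_cancel] at this
    linarith
  have lip : ∀ {Y : EE → ℂ}, Differentiable ℂ Y → (∀ w, ‖Y w‖ ≤ ‖X w‖) → ∀ w, ‖z - w‖ ≤ 1/((k:ℝ)+1) →
      ‖Y w - Y z‖ ≤ B * (1/((k:ℝ)+1)) := fun {Y} hY hYX w hw => by
    refine (lip_entire hY (by linarith) (fun u hu => (hYX u).trans (hB u hu)) (by linarith) (hw1 w hw)).trans ?_
    rw [norm_sub_rev]; gcongr
  obtain ⟨h, hh⟩ : ∃ h : EE → ℂ, h = fun w => G w - G z := ⟨_, rfl⟩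
  have hhc : Continuous h := by rw [hh]; fun_prop
  have hhω : ∀ w, ‖z - w‖ ≤ 1/((k:ℝ)+1) → ‖h w‖ ≤ ω := by rw [hh]; exact hω
  have t1 := fr_term hX.continuous.fst hρ hhc (lip hX.fst fun w => norm_fst_le _) hhω (1,0)
  have t2 := fr_term hX.continuous.snd hρ hhc (lip hX.snd fun w => norm_snd_le _) hhω (0,1)
  have t3 := sc_est k hρ.sm.continuous hρ.cs hρ.z0 (h := fun w => h w * dvX X w) (ω := ω * D) (z := z) fun w hw => by
    rw [norm_mul]
    have a1 := hhω w hw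
    have a2 := hD w (hw1 w hw)
    have := (norm_nonneg _).trans a1
    gcongr
  rw [hρ.i2, mul_one] at t3
  have ms := sc_sm k hρ.sm
  have mc := sc_cs k hρ.cs
  obtain ⟨m, hm⟩ : ∃ m, m = sc k ρ := ⟨_, rfl⟩
  have m1 := hρ.W0
  have zc : TT X (fun _ => G z) (sc k ρ) z = 0 := by
    rw [TT_smooth hX contDiff_const ms mc]
    have : ∀ w, XA X (fun _ => G z) w = 0 := fun w => by
      rw [XA_eq, wd, Wi_const]
    simp [this]
  have zv : ∀ v, cv (fun _ => G z) (wd v (sc k ρ)) z = 0 := fun v => by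
    rw [wd, ← Wi_cv continuous_const ms mc, cv_const hρ, Wi_const]
  have key : TT X G (sc k ρ) z - XA X (cv G (sc k ρ)) z =
      (cv (fun w => h w * (X w).1) (wd (1,0) (sc k ρ)) z - (X z).1 * cv h (wd (1,0) (sc k ρ)) z)
      + (cv (fun w => h w * (X w).2) (wd (0,1) (sc k ρ)) z - (X z).2 * cv h (wd (0,1) (sc k ρ)) z)
      - cv (fun w => h w * dvX X w) (sc k ρ) z := by
    have c1 := hX.continuous.fst
    have c2 := hX.continuous.snd
    have c3 := dvX_cont hX
    have w1 := fun v => (ms.W (-Complex.I) v).continuous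
    have w2 := fun v => hasCompactSupport_Wi mc (-Complex.I) v
    rw [hh]
    simp only [sub_mul]
    rw [cv_sub (hG.fun_mul c1) (continuous_const.fun_mul c1) (w1 _) (w2 _), cv_sub (hG.fun_mul c2) (continuous_const.fun_mul c2) (w1 _) (w2 _),
      cv_sub (hG.fun_mul c3) (continuous_const.fun_mul c3) ms.continuous mc, cv_sub hG continuous_const (w1 _) (w2 _),
      cv_sub hG continuous_const (w1 _) (w2 _), zv, zv, XA, wd, wd, Wi_cv hG ms mc, Wi_cv hG ms mc]
    rw [TT] at zc ⊢
    linear_combination zc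
  rw [key]
  rw [← hN1] at t1
  rw [← hN2] at t2
  have t3' : ‖cv (fun w => h w * dvX X w) (sc k ρ) z‖ ≤ ω * D := t3
  refine (norm_sub_le _ _).trans ((add_le_add ((norm_add_le _ _).trans (add_le_add t1 t2)) t3').trans (le_of_eq ?_))
  ring
end

noncomputable section
open MeasureTheory

section
variable {f g X : EE → EE} {d : ℕ} {R C c : ℝ}

theorem PV_succ (hf : Differentiable ℂ f) (n : ℕ) (z : EE) : PV f X (n+1) z = fderiv ℂ f (f^[n] z) (PV f X n z) :=
  fderiv_iterate_succ hf n z (X z)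

theorem PV_px (hf : Differentiable ℂ f) (n : ℕ) (z : EE) : fderiv ℂ (px f n) z (X z) = (PV f X n z).1 := by
  have h := (hf.iterate n z).hasFDerivAt.fst
  have h2 : fderiv ℂ (px f n) z = _ := h.fderiv
  rw [h2]; rfl

theorem HP.PV_bd (H : HP f g d R C c) {z : EE} (hz : Vs R z) (n : ℕ) :
    ‖PV f X n z‖ ≤ (C/c)^n * (‖X z‖ / ‖z.1‖) * ‖px f n z‖ := by
  have c0 := H.F.c0
  have C1 := H.F.C1
  have R1 := H.F.R1
  induction n with
  | zero =>
    have : 0 < ‖z.1‖ := by have := hz.1; linarith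
    simp [PV, px]
    rw [div_mul_cancel₀ _ this.ne']
  | succ n ih =>
    have hv := (H.Viter hz n).1
    have l := H.F.lower _ hv.1 hv.2
    have x1 : 1 ≤ ‖(f^[n] z).1‖ := R1.trans hv.1
    have du := H.F.dub (f^[n] z)
    rw [hv.norm, max_eq_right x1] at du
    rw [PV_succ H.F.diff]
    have e1 : px f (n+1) z = (f (f^[n] z)).1 := by rw [px, iterate_succ_apply']
    have K0 : 0 ≤ (C/c)^n * (‖X z‖ / ‖z.1‖) := by positivity
    have e2 : ‖(f^[n] z).1‖^(d-1) * ‖(f^[n] z).1‖ = ‖(f^[n] z).1‖^d := by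
      rw [← pow_succ]; congr 1; have := H.F.hd; omega
    rw [e1]
    calc _ ≤ ‖fderiv ℂ f (f^[n] z)‖ * ‖PV f X n z‖ := ContinuousLinearMap.le_opNorm _ _
      _ ≤ (C * ‖(f^[n] z).1‖^(d-1)) * ((C/c)^n * (‖X z‖ / ‖z.1‖) * ‖(f^[n] z).1‖) := by
        gcongr; exact ih
      _ = (C/c)^n * (‖X z‖ / ‖z.1‖) * (C/c) * (c * (‖(f^[n] z).1‖^(d-1) * ‖(f^[n] z).1‖)) := by field_simp
      _ ≤ (C/c)^n * (‖X z‖ / ‖z.1‖) * (C/c) * ‖(f (f^[n] z)).1‖ := by rw [e2]; gcongr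
      _ = _ := by rw [pow_succ]; ring

theorem HP.px1 (H : HP f g d R C c) {z : EE} (hz : Vs R z) (n : ℕ) : 1 ≤ ‖px f n z‖ := H.F.R1.trans (H.Viter hz n).1.1

theorem HP.PV_x2 (H : HP f g d R C c) {z : EE} (hz : Vs R z) (n : ℕ) :
    ‖PV f X n z‖ / ‖px f n z‖^2 ≤ ‖X z‖ * (1/2)^n := by
  have c0 := H.F.c0
  have C1 := H.F.C1
  have R1 := H.F.R1
  have x1 := H.px1 hz n
  have z1 : 1 ≤ ‖z.1‖ := R1.trans hz.1
  have l : (2 * C / c) ^ n * ‖z.1‖ ≤ ‖px f n z‖ := (H.Viter hz n).2.2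
  have b := H.PV_bd (X := X) hz n
  rw [div_le_iff₀ (by positivity)]
  refine b.trans ?_
  have e : (C/c)^n * (‖X z‖ / ‖z.1‖) * ‖px f n z‖ ≤ (C/c)^n * ‖X z‖ * ‖px f n z‖ := by
    gcongr; exact div_le_self (norm_nonneg _) z1
  refine e.trans ?_
  have l2 : (C/c)^n ≤ (1/2)^n * ‖px f n z‖ := by
    have : (C/c)^n = (1/2)^n * (2*C/c)^n := by rw [← mul_pow]; congr 1; field_simp
    rw [this]
    gcongr
    refine le_trans ?_ l
    exact le_mul_of_one_le_right (by positivity) z1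
  calc _ ≤ ((1/2)^n * ‖px f n z‖) * ‖X z‖ * ‖px f n z‖ := by gcongr
    _ = _ := by ring

def tn (f : EE → EE) (d : ℕ) (X : EE → EE) (n : ℕ) (z : EE) : ℂ :=
  ((1 / (2 * (d : ℝ) ^ n) : ℝ) : ℂ) * ((PV f X n z).1 / px f n z)

theorem dn_le (H : HP f g d R C c) (n : ℕ) : ‖((1 / (2 * (d : ℝ) ^ n) : ℝ) : ℂ)‖ ≤ 1 := by
  have h2 := H.d2
  have : (1:ℝ) ≤ (d:ℝ)^n := one_le_pow₀ (by linarith)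
  rw [Complex.norm_real, Real.norm_eq_abs, abs_of_nonneg (by positivity)]
  rw [div_le_one (by positivity)]
  linarith

theorem HP.tn_step (H : HP f g d R C c) {z : EE} (hz : Vs R z) (n : ℕ) :
    ‖tn f d X (n+1) z - tn f d X n z‖ ≤ C * ‖X z‖ * (1/2)^n := by
  have hv := (H.Viter hz n).1
  have C1 := H.F.C1
  have D := H.F.Dt _ hv.1 hv.2 (PV f X n z)
  have d2 := H.dpos
  rw [← PV_succ H.F.diff] at D
  have e1 : px f (n+1) z = (f (f^[n] z)).1 := by rw [px, iterate_succ_apply']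
  have e : tn f d X (n+1) z - tn f d X n z = ((1 / (2 * (d : ℝ) ^ (n+1)) : ℝ) : ℂ) *
      ((PV f X (n+1) z).1 / (f (f^[n] z)).1 - d * (PV f X n z).1 / (f^[n] z).1) := by
    have d0 : (d:ℂ) ≠ 0 := by exact_mod_cast d2.ne'
    rw [tn, tn, e1, px]
    push_cast
    field_simp
    ring
  rw [e, norm_mul]
  calc _ ≤ 1 * (C * ‖PV f X n z‖ / ‖px f n z‖^2) := by
        gcongr
        · exact dn_le H _
        · exact D
    _ = C * (‖PV f X n z‖ / ‖px f n z‖^2) := by ring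
    _ ≤ C * (‖X z‖ * (1/2)^n) := by have := H.PV_x2 (X := X) hz n; gcongr
    _ = _ := by ring

theorem HP.XA_tn (H : HP f g d R C c) {z : EE} (hz : Vs R z) (n : ℕ) :
    ‖XA X (Ac f d n) z - tn f d X n z‖ ≤ ‖X z‖ * (1/2)^n := by
  have x1 := H.px1 hz n
  have p0 : px f n z ≠ 0 := norm_pos_iff.mp (by linarith)
  have q0 : ((1 + ‖px f n z‖^2 : ℝ):ℂ) ≠ 0 := by
    have : (1 + ‖px f n z‖^2 : ℝ) ≠ 0 := by positivity
    exact_mod_cast this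
  have e : XA X (Ac f d n) z - tn f d X n z = -((1 / (2 * (d : ℝ) ^ n) : ℝ) : ℂ) * ((PV f X n z).1 / (px f n z * ((1 + ‖px f n z‖^2 : ℝ):ℂ))) := by
    rw [XA_Ac H.F.diff, PV_px H.F.diff, tn]
    have h : (PV f X n z).1 * (starRingEnd ℂ) (px f n z) / ((1 + ‖px f n z‖^2 : ℝ):ℂ) - (PV f X n z).1 / px f n z
       = -((PV f X n z).1 / (px f n z * ((1 + ‖px f n z‖^2 : ℝ):ℂ))) := by
      have h1 : px f n z * (starRingEnd ℂ) (px f n z) = ((‖px f n z‖^2 : ℝ):ℂ) := by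
        rw [Complex.mul_conj, Complex.normSq_eq_norm_sq]
      field_simp
      push_cast at h1 ⊢
      linear_combination (PV f X n z).1 * h1
    linear_combination ((1 / (2 * (d : ℝ) ^ n) : ℝ) : ℂ) * h
  rw [e, norm_mul, norm_neg, norm_div, norm_mul, Complex.norm_real (1 + _), Real.norm_eq_abs, abs_of_nonneg (by positivity)]
  calc _ ≤ 1 * (‖PV f X n z‖ / ‖px f n z‖^2) := by
        gcongr
        · exact dn_le H n
        · exact norm_fst_le _
        · nlinarith [sq_nonneg ‖px f n z‖]
    _ ≤ _ := by rw [one_mul]; exact H.PV_x2 hz n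

def tl (f : EE → EE) (d : ℕ) (X : EE → EE) (z : EE) : ℂ := limUnder atTop (fun n => tn f d X n z)

theorem HP.tn_tl (H : HP f g d R C c) {z : EE} (hz : Vs R z) : Tendsto (fun n => tn f d X n z) atTop (𝓝 (tl f d X z)) := by
  have hc : CauchySeq fun n => tn f d X n z :=
    cauchySeq_of_le_geometric (1/2) (C * ‖X z‖) (by norm_num) fun n => by
      rw [dist_comm, dist_eq_norm]; exact H.tn_step hz n
  exact hc.tendsto_limUnder

theorem HP.tn_est (H : HP f g d R C c) {z : EE} (hz : Vs R z) (n : ℕ) :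
    ‖tn f d X n z - tl f d X z‖ ≤ 2 * C * ‖X z‖ * (1/2)^n := by
  have := dist_le_of_le_geometric_of_tendsto (1/2) (C * ‖X z‖) (by norm_num) (fun n => by
      rw [dist_comm, dist_eq_norm]; exact H.tn_step hz n) (H.tn_tl (X := X) hz) n
  rw [dist_eq_norm] at this
  refine this.trans (le_of_eq ?_); ring

theorem HP.XA_tl (H : HP f g d R C c) {z : EE} (hz : Vs R z) (n : ℕ) :
    ‖XA X (Ac f d n) z - tl f d X z‖ ≤ (2 * C + 1) * ‖X z‖ * (1/2)^n := by
  have := norm_sub_le_norm_sub_add_norm_sub (XA X (Ac f d n) z) (tn f d X n z) (tl f d X z)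
  refine (this.trans (add_le_add (H.XA_tn hz n) (H.tn_est hz n))).trans (le_of_eq ?_)
  ring

theorem HP.tl_cont (H : HP f g d R C c) (hX : Differentiable ℂ X) (M : ℝ) :
    ContinuousOn (tl f d X) ({z | Vs R z} ∩ Metric.closedBall 0 M) := by
  obtain ⟨B, hB1, hB⟩ := bdd_on_ball hX.continuous M
  have C1 := H.F.C1
  have hu : TendstoUniformlyOn (fun n z => XA X (Ac f d n) z) (tl f d X) atTop ({z | Vs R z} ∩ Metric.closedBall 0 M) := by
    rw [Metric.tendstoUniformlyOn_iff]
    intro ε hε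
    have ht : Tendsto (fun n : ℕ => (2 * C + 1) * B * (1/2:ℝ)^n) atTop (𝓝 0) := by
      simpa using (tendsto_pow_atTop_nhds_zero_of_lt_one (r := (1/2:ℝ)) (by norm_num) (by norm_num)).const_mul ((2 * C + 1) * B)
    filter_upwards [ht.eventually (gt_mem_nhds hε)] with n hn z hz
    rw [dist_comm, dist_eq_norm]
    refine (H.XA_tl hz.1 n).trans_lt (lt_of_le_of_lt ?_ hn)
    have := hB z (by simpa using hz.2)
    gcongr
  refine hu.continuousOn (Frequently.of_forall fun n => ?_)
  exact (XA_sm hX (Ac_sm H.F.diff n)).continuous.continuousOn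

end
end

noncomputable section
open MeasureTheory

section
variable {f g X : EE → EE} {d : ℕ} {R C c : ℝ}

def UL (u : ℕ → EE → ℂ) (U : EE → ℂ) : Prop :=
  ∀ M ε : ℝ, 0 < ε → ∃ N : ℕ, ∀ k ≥ N, ∀ z : EE, ‖z‖ ≤ M → ‖u k z - U z‖ ≤ ε

theorem UL.tlu {u : ℕ → EE → ℂ} {U : EE → ℂ} (h : UL u U) : TendstoLocallyUniformly u U atTop := by
  rw [Metric.tendstoLocallyUniformly_iff]
  intro ε hε z
  refine ⟨Metric.ball z 1, Metric.ball_mem_nhds z one_pos, ?_⟩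
  obtain ⟨N, hN⟩ := h (‖z‖ + 1) (ε/2) (by positivity)
  filter_upwards [eventually_ge_atTop N] with k hk y hy
  rw [dist_comm, dist_eq_norm]
  refine (hN k hk y ?_).trans_lt (by linarith)
  rw [Metric.mem_ball, dist_eq_norm] at hy
  have := norm_add_le (y - z) z
  rw [sub_add_cancel] at this
  linarith

theorem UL.continuous {u : ℕ → EE → ℂ} {U : EE → ℂ} (h : UL u U) (hu : ∀ k, Continuous (u k)) : Continuous U :=
  h.tlu.continuous (Frequently.of_forall hu)

theorem UL.diff_x {u : ℕ → EE → ℂ} {U : EE → ℂ} (h : UL u U) (hu : ∀ k, Differentiable ℂ (u k)) (y : ℂ) :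
    Differentiable ℂ (fun x => U (x, y)) := by
  have h1 : TendstoLocallyUniformly (fun k x => u k (x, y)) (fun x : ℂ => U (x, y)) atTop :=
    h.tlu.comp (fun x : ℂ => ((x, y) : EE)) (by fun_prop)
  rw [← differentiableOn_univ]
  refine (tendstoLocallyUniformlyOn_univ.mpr h1).differentiableOn (Eventually.of_forall fun k => ?_) isOpen_univ
  exact ((hu k).comp (differentiable_id.prodMk (differentiable_const y))).differentiableOn

theorem UL.tendsto {u : ℕ → EE → ℂ} {U : EE → ℂ} (h : UL u U) (z : EE) : Tendsto (fun k => u k z) atTop (𝓝 (U z)) := by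
  rw [Metric.tendsto_atTop]
  intro ε hε
  obtain ⟨N, hN⟩ := h ‖z‖ (ε/2) (by positivity)
  exact ⟨N, fun k hk => by rw [dist_eq_norm]; exact (hN k hk z le_rfl).trans_lt (by linarith)⟩

theorem exists_UL {u : ℕ → EE → ℂ} (h : ∀ M ε : ℝ, 0 < ε → ∃ N : ℕ, ∀ k ≥ N, ∀ j ≥ N, ∀ z : EE, ‖z‖ ≤ M → ‖u k z - u j z‖ ≤ ε) :
    ∃ U, UL u U := by
  have hc : ∀ z, CauchySeq (fun k => u k z) := fun z => by
    rw [Metric.cauchySeq_iff]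
    intro ε hε
    obtain ⟨N, hN⟩ := h ‖z‖ (ε/2) (by positivity)
    exact ⟨N, fun k hk j hj => by rw [dist_eq_norm]; exact (hN k hk j hj z le_rfl).trans_lt (by linarith)⟩
  refine ⟨fun z => limUnder atTop (fun k => u k z), fun M ε hε => ?_⟩
  obtain ⟨N, hN⟩ := h M ε hε
  refine ⟨N, fun k hk z hz => ?_⟩
  have ht := ((hc z).tendsto_limUnder.const_sub (u k z)).norm
  exact le_of_tendsto ht (eventually_atTop.mpr ⟨N, fun j hj => hN k hk j hj z hz⟩)

def Marg (R : ℝ) (z : EE) : Prop := ∀ w : EE, ‖z - w‖ ≤ 1 → Vs R w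

theorem Marg.self {z : EE} (h : Marg R z) : Vs R z := h z (by simp)

theorem marg_of {R M : ℝ} (hR : 0 ≤ R) {x y : ℂ} (hx : R + 2 + M ≤ ‖x‖) (hy : ‖y‖ ≤ M) : Marg R (x, y) := by
  intro w hw
  have h1 : ‖x - w.1‖ ≤ 1 := (norm_fst_le ((x,y) - w)).trans hw
  have h2 : ‖y - w.2‖ ≤ 1 := (norm_snd_le ((x,y) - w)).trans hw
  have h3 := norm_sub_norm_le x w.1
  have h4 := norm_sub_norm_le w.2 y
  rw [norm_sub_rev] at h4
  have := norm_nonneg y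
  constructor <;> linarith

theorem knorm_le {k N : ℕ} (h : N ≤ k) : 1/((k:ℝ)+1) ≤ 1/((N:ℝ)+1) := by
  have : (N:ℝ) ≤ k := by exact_mod_cast h
  gcongr

theorem k1_le (k : ℕ) : 1/((k:ℝ)+1) ≤ 1 := by simpa using knorm_le (Nat.zero_le k)

theorem HP.Tk_marg (H : HP f g d R C c) (hX : Differentiable ℂ X) {ρ : EE → ℂ} (hρ : Moll ρ) {k : ℕ} {z : EE}
    (hz : Marg R z) {ω : ℝ} (hω : ∀ w, ‖z - w‖ ≤ 1/((k:ℝ)+1) → ‖tl f d X w - tl f d X z‖ ≤ ω) :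
    ‖TT X (Gc f d) (sc k ρ) z - tl f d X z‖ ≤ ω := by
  have C1 := H.F.C1
  have ht := TT_conv hX (fun n => (Ac_sm H.F.diff n).continuous) (Gc_cont H) (Ac_LU H) (sc_sm k hρ.sm) (sc_cs k hρ.cs) z
  obtain ⟨B, hB1, hB⟩ := bdd_on_ball hX.continuous (‖z‖ + 1)
  have hb : ∀ n, ‖TT X (Ac f d n) (sc k ρ) z - tl f d X z‖ ≤ (2 * C + 1) * B * (1/2)^n + ω := by
    intro n
    rw [TT_smooth hX (Ac_sm H.F.diff n) (sc_sm k hρ.sm) (sc_cs k hρ.cs)]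
    refine hρ.est k (XA_sm hX (Ac_sm H.F.diff n)).continuous fun w hw => ?_
    have w1 : ‖z - w‖ ≤ 1 := hw.trans (k1_le k)
    have := norm_sub_le_norm_sub_add_norm_sub (XA X (Ac f d n) w) (tl f d X w) (tl f d X z)
    refine this.trans (add_le_add ((H.XA_tl (hz w w1) n).trans ?_) (hω w hw))
    have : ‖X w‖ ≤ B := hB w (by
      have := norm_sub_le z (z - w)
      rw [sub_sub_cancel] at this
      linarith)
    gcongr
  have hl : Tendsto (fun n : ℕ => (2 * C + 1) * B * (1/2:ℝ)^n + ω) atTop (𝓝 (0 + ω)) := by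
    refine Tendsto.add_const _ ?_
    simpa using (tendsto_pow_atTop_nhds_zero_of_lt_one (r := (1/2:ℝ)) (by norm_num) (by norm_num)).const_mul ((2 * C + 1) * B)
  rw [zero_add] at hl
  exact le_of_tendsto_of_tendsto' (ht.sub_const _).norm hl hb

theorem isClosed_Vs (R : ℝ) : IsClosed {z : EE | Vs R z} := by
  have : {z : EE | Vs R z} = {z | R ≤ ‖z.1‖} ∩ {z | ‖z.2‖ ≤ ‖z.1‖} := rfl
  rw [this]
  exact (isClosed_le (by fun_prop) (by fun_prop)).inter (isClosed_le (by fun_prop) (by fun_prop))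

theorem HP.Tk_unif (H : HP f g d R C c) (hX : Differentiable ℂ X) {ρ : EE → ℂ} (hρ : Moll ρ) (M ε : ℝ) (hε : 0 < ε) :
    ∃ N : ℕ, ∀ k ≥ N, ∀ z, ‖z‖ ≤ M → Marg R z → ‖TT X (Gc f d) (sc k ρ) z - tl f d X z‖ ≤ ε := by
  have hK : IsCompact ({z : EE | Vs R z} ∩ Metric.closedBall 0 (M+1)) := (isCompact_closedBall _ _).inter_left (isClosed_Vs R)
  have hu := hK.uniformContinuousOn_of_continuous (H.tl_cont hX (M+1))
  rw [Metric.uniformContinuousOn_iff] at hu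
  obtain ⟨δ, hδ, h⟩ := hu ε hε
  obtain ⟨N, hN⟩ := exists_nat_one_div_lt hδ
  refine ⟨N, fun k hk z hz hm => H.Tk_marg hX hρ hm fun w hw => ?_⟩
  have w1 : ‖z - w‖ ≤ 1 := hw.trans (k1_le k)
  have wn : ‖w‖ ≤ M + 1 := by
      have := norm_sub_le z (z - w)
      rw [sub_sub_cancel] at this
      linarith
  have := h w ⟨hm w w1, by simpa using wn⟩ z ⟨hm.self, by simp; linarith⟩ (by
    rw [dist_comm, dist_eq_norm]
    exact (hw.trans (knorm_le hk)).trans_lt hN)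
  rw [dist_eq_norm] at this
  exact this.le

/-- maximum principle in the first variable -/
theorem max_x {F : Type*} [NormedAddCommGroup F] [NormedSpace ℂ F] {u : EE → F} (hu : Differentiable ℂ u) {y : ℂ} {r b : ℝ} (hr : 0 < r)
    (hb : ∀ x : ℂ, ‖x‖ = r → ‖u (x, y)‖ ≤ b) {x : ℂ} (hx : ‖x‖ ≤ r) : ‖u (x, y)‖ ≤ b := by
  have hd : Differentiable ℂ (fun x : ℂ => u (x, y)) := hu.comp (differentiable_id.prodMk (differentiable_const y))
  refine Complex.norm_le_of_forall_mem_frontier_norm_le (f := fun x : ℂ => u (x, y)) (Metric.isBounded_ball (x := (0:ℂ)) (r := r)) hd.diffContOnCl (fun w hw => ?_) ?_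
  · rw [frontier_ball _ hr.ne'] at hw
    exact hb w (by simpa using hw)
  · rw [closure_ball _ hr.ne']
    simpa using hx

theorem HP.exists_tau (H : HP f g d R C c) (hX : Differentiable ℂ X) (hH : HH f d X) {ρ : EE → ℂ} (hρ : Moll ρ) :
    ∃ τ, UL (fun k => TT X (Gc f d) (sc k ρ)) τ ∧ Continuous τ ∧ (∀ y, Differentiable ℂ (fun x => τ (x, y))) ∧
      ∀ z, Marg R z → τ z = tl f d X z := by
  have hd : ∀ k, Differentiable ℂ (TT X (Gc f d) (sc k ρ)) := fun k => TT_holo H hX hH (sc_sm k hρ.sm) (sc_cs k hρ.cs)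
  have R1 := H.F.R1
  obtain ⟨τ, hτ⟩ := exists_UL (u := fun k => TT X (Gc f d) (sc k ρ)) (fun M ε hε => by
    obtain ⟨M', hM'⟩ : ∃ M', M' = max M 0 := ⟨_, rfl⟩
    have hM0 : 0 ≤ M' := hM' ▸ le_max_right _ _
    obtain ⟨N, hN⟩ := H.Tk_unif hX hρ (R + 2 + M') (ε/2) (by positivity)
    refine ⟨N, fun k hk j hj z hz => ?_⟩
    have hzM : ‖z‖ ≤ M' := hz.trans (hM' ▸ le_max_left _ _)
    have z2 : ‖z.2‖ ≤ M' := (norm_snd_le z).trans hzM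
    have z1 : ‖z.1‖ ≤ M' := (norm_fst_le z).trans hzM
    refine max_x (u := fun z => TT X (Gc f d) (sc k ρ) z - TT X (Gc f d) (sc j ρ) z) ((hd k).sub (hd j)) (y := z.2) (x := z.1)
      (r := R + 2 + M') (by linarith) (fun x hx => ?_) (by linarith)
    have mg : Marg R (x, z.2) := marg_of (by linarith) hx.ge z2
    have nb : ‖((x, z.2) : EE)‖ ≤ R + 2 + M' := by
      rw [Prod.norm_def]; exact max_le hx.le (by simp only []; linarith)
    have a1 := hN k hk _ nb mg
    have a2 := hN j hj _ nb mg
    rw [norm_sub_rev] at a2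
    have := norm_sub_le_norm_sub_add_norm_sub (TT X (Gc f d) (sc k ρ) (x, z.2)) (tl f d X (x, z.2)) (TT X (Gc f d) (sc j ρ) (x, z.2))
    linarith)
  refine ⟨τ, hτ, hτ.continuous fun k => (hd k).continuous, hτ.diff_x hd, fun z hz => ?_⟩
  refine tendsto_nhds_unique (hτ.tendsto z) ?_
  rw [Metric.tendsto_atTop]
  intro ε hε
  obtain ⟨N, hN⟩ := H.Tk_unif hX hρ ‖z‖ (ε/2) (by positivity)
  exact ⟨N, fun k hk => by rw [dist_eq_norm]; exact (hN k hk z le_rfl hz).trans_lt (by linarith)⟩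

end
end

noncomputable section
open MeasureTheory

section
variable {f g X : EE → EE} {d : ℕ} {R C c : ℝ}

theorem unif_mod {G : EE → ℂ} (hG : Continuous G) (M ω : ℝ) (hω : 0 < ω) : ∃ N : ℕ, ∀ k ≥ N, ∀ z, ‖z‖ ≤ M → ∀ w, ‖z - w‖ ≤ 1/((k:ℝ)+1) →
    ‖G w - G z‖ ≤ ω := by
  have hu := (isCompact_closedBall (0:EE) (M+1)).uniformContinuousOn_of_continuous hG.continuousOn
  rw [Metric.uniformContinuousOn_iff] at hu
  obtain ⟨δ, hδ, h⟩ := hu ω hω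
  obtain ⟨N, hN⟩ := exists_nat_one_div_lt hδ
  refine ⟨N, fun k hk z hz w hw => ?_⟩
  have w1 : ‖z - w‖ ≤ 1 := hw.trans (k1_le k)
  have wn : ‖w‖ ≤ M + 1 := by
      have := norm_sub_le z (z - w)
      rw [sub_sub_cancel] at this
      linarith
  have := h w (by simpa using wn) z (by simp; linarith) (by
    rw [dist_comm, dist_eq_norm]
    exact (hw.trans (knorm_le hk)).trans_lt hN)
  rw [dist_eq_norm] at this
  exact this.le

theorem cv_real {G : EE → ℝ} {ρ : EE → ℂ} (hρ : Moll ρ) (k : ℕ) (z : EE) :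
    (((cv (fun w => (G w : ℂ)) (sc k ρ) z).re : ℝ) : ℂ) = cv (fun w => (G w : ℂ)) (sc k ρ) z := by
  rw [← Complex.conj_eq_iff_re, cv, ← integral_conj]
  congr 1; funext w
  rw [map_mul, Complex.conj_ofReal]
  congr 1
  rw [sc, map_mul, Complex.conj_ofReal, Complex.conj_eq_iff_im.mpr (hρ.re _)]

def qz (a : EE) (z : EE) : ℂ := (z.1 - a.1) * (starRingEnd ℂ) (z.1 - a.1) + (z.2 - a.2) * (starRingEnd ℂ) (z.2 - a.2)

theorem qz_eq (a z : EE) : qz a z = ((‖z.1 - a.1‖^2 + ‖z.2 - a.2‖^2 : ℝ) : ℂ) := by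
  rw [qz, Complex.mul_conj, Complex.mul_conj, Complex.normSq_eq_norm_sq, Complex.normSq_eq_norm_sq]; push_cast; rfl

theorem d1 (a : EE) : Differentiable ℂ (fun z : EE => z.1 - a.1) := by fun_prop
theorem d2' (a : EE) : Differentiable ℂ (fun z : EE => z.2 - a.2) := by fun_prop

theorem qz_sm (a : EE) : Sm (qz a) := by
  have s1 := sm_of_entire (d1 a)
  have s2 := sm_of_entire (d2' a)
  exact (s1.mul s1.conj).add (s2.mul s2.conj)

theorem qz_wd (a v z : EE) : wd v (qz a) z = v.1 * (starRingEnd ℂ) (z.1 - a.1) + v.2 * (starRingEnd ℂ) (z.2 - a.2) := by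
  have s1 := sm_of_entire (d1 a)
  have s2 := sm_of_entire (d2' a)
  have e := Wi_add (-Complex.I) v ((s1.diff z).fun_mul (s1.conj.diff z)) ((s2.diff z).fun_mul (s2.conj.diff z))
  have h : wd v (qz a) z = _ := e
  have f1 : fderiv ℂ (fun z : EE => z.1 - a.1) z v = v.1 := by
    have : HasFDerivAt (fun z : EE => z.1 - a.1) (ContinuousLinearMap.fst ℂ ℂ ℂ) z := hasFDerivAt_fst.sub_const _
    rw [this.fderiv]; rfl
  have f2 : fderiv ℂ (fun z : EE => z.2 - a.2) z v = v.2 := by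
    have : HasFDerivAt (fun z : EE => z.2 - a.2) (ContinuousLinearMap.snd ℂ ℂ ℂ) z := hasFDerivAt_snd.sub_const _
    rw [this.fderiv]; rfl
  have m1 := Wi_mul (-Complex.I) v (s1.diff z) (s1.conj.diff z)
  have m2 := Wi_mul (-Complex.I) v (s2.diff z) (s2.conj.diff z)
  have a1 := wd_holo (d1 a z) v
  have a2 := wd_holo (d2' a z) v
  have b1 := wd_conj (s1.diff z) v
  have b2 := wd_conj (s2.diff z) v
  rw [wb_holo (d1 a z)] at b1
  rw [wb_holo (d2' a z)] at b2
  rw [wd] at a1 a2 b1 b2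
  rw [h, m1, m2, a1, a2, b1, b2, f1, f2]
  simp

theorem pen_min {G : EE → ℝ} {u : EE → ℂ} (hu : Sm u) (hre : ∀ z, ((u z).re : ℂ) = u z) {z₀ : EE} {r δ ω : ℝ} (hr : 0 < r) (hδ : 0 < δ)
    (hω : 2 * ω < δ * r^2) (hG : ∀ z, 0 ≤ G z) (hz : G z₀ = 0) (hb : ∀ z, ‖z - z₀‖ ≤ r → ‖u z - G z‖ ≤ ω) :
    ∃ z, ‖z - z₀‖ ≤ r ∧ ∀ v, ‖wd v u z‖ ≤ 2 * δ * r * ‖v‖ := by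
  obtain ⟨φ, hφ⟩ : ∃ φ : EE → ℝ, φ = fun z => (u z).re + δ * (‖z.1 - z₀.1‖^2 + ‖z.2 - z₀.2‖^2) := ⟨_, rfl⟩
  have hF : (fun z => u z + (δ:ℂ) * qz z₀ z) = fun z => ((φ z : ℝ) : ℂ) := by
    funext z
    rw [hφ, qz_eq]; push_cast; rw [hre]
  have hFs : Sm (fun z => u z + (δ:ℂ) * qz z₀ z) := hu.add (contDiff_const.mul (qz_sm z₀))
  have hφd : Differentiable ℝ φ := by
    have : φ = fun z => Complex.reCLM ((fun z => u z + (δ:ℂ) * qz z₀ z) z) := by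
      funext z; rw [hF]; simp
    rw [this]
    exact Complex.reCLM.differentiable.comp (fun z => hFs.diff z)
  have re_est : ∀ z, ‖z - z₀‖ ≤ r → |(u z).re - G z| ≤ ω := fun z hz => by
    have := Complex.abs_re_le_norm (u z - G z)
    simp at this
    exact this.trans (hb z hz)
  obtain ⟨z, hzm, hmin⟩ := (isCompact_closedBall z₀ r).exists_isMinOn ⟨z₀, by simp [hr.le]⟩ hφd.continuous.continuousOn
  have hzr : ‖z - z₀‖ ≤ r := by simpa [dist_eq_norm] using hzm
  have h0 : φ z ≤ ω := by
    have h1 : φ z ≤ φ z₀ := hmin (by simp [hr.le])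
    have h2 := re_est z₀ (by simp [hr.le])
    rw [hz] at h2
    have h3 : φ z₀ = (u z₀).re := by rw [hφ]; simp
    rw [h3] at h1
    have := abs_le.mp h2
    linarith
  have hlt : ‖z - z₀‖ < r := by
    by_contra hcon
    have he : ‖z - z₀‖ = r := le_antisymm hzr (not_lt.mp hcon)
    have h2 := (abs_le.mp (re_est z hzr)).1
    have h3 := hG z
    have h4 : r^2 ≤ ‖z.1 - z₀.1‖^2 + ‖z.2 - z₀.2‖^2 := by
      rw [← he, Prod.norm_def]
      rcases max_choice ‖(z - z₀).1‖ ‖(z - z₀).2‖ with h | h <;> rw [h]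
      · simp only [Prod.fst_sub]; nlinarith [sq_nonneg ‖z.2 - z₀.2‖]
      · simp only [Prod.snd_sub]; nlinarith [sq_nonneg ‖z.1 - z₀.1‖]
    have h5 : φ z = (u z).re + δ * (‖z.1 - z₀.1‖^2 + ‖z.2 - z₀.2‖^2) := by rw [hφ]
    have h6 := mul_le_mul_of_nonneg_left h4 hδ.le
    linarith
  refine ⟨z, hzr, fun v => ?_⟩
  have hloc : IsLocalMin φ z := hmin.isLocalMin (mem_nhds_iff.mpr ⟨Metric.ball z₀ r, Metric.ball_subset_closedBall, Metric.isOpen_ball, by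
    simpa [dist_eq_norm] using hlt⟩)
  have hd0 := hloc.fderiv_eq_zero
  have hF0 : fderiv ℝ (fun z => u z + (δ:ℂ) * qz z₀ z) z = 0 := by
    rw [hF]
    have h1 : HasFDerivAt φ (0 : EE →L[ℝ] ℝ) z := hd0 ▸ (hφd z).hasFDerivAt
    have := (Complex.ofRealCLM.hasFDerivAt (x := φ z)).comp z h1
    have h2 : fderiv ℝ (fun z => ((φ z : ℝ) : ℂ)) z = Complex.ofRealCLM.comp 0 := this.fderiv
    rw [h2]; simp
  have hw0 : wd v (fun z => u z + (δ:ℂ) * qz z₀ z) z = 0 := by rw [wd, Wi, hF0]; simp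
  have hsq : Sm fun z => (δ:ℂ) * qz z₀ z := contDiff_const.mul (qz_sm z₀)
  have hs := Wi_add (-Complex.I) v (hu.diff z) (hsq.diff z)
  rw [wd, hs, Wi_const_mul _ _ _ ((qz_sm z₀).diff z)] at hw0
  have hq := qz_wd z₀ v z
  rw [wd] at hq
  rw [hq] at hw0
  have : wd v u z = -((δ:ℂ) * (v.1 * (starRingEnd ℂ) (z.1 - z₀.1) + v.2 * (starRingEnd ℂ) (z.2 - z₀.2))) := by
    rw [wd]; linear_combination hw0
  rw [this, norm_neg, norm_mul, Complex.norm_real, Real.norm_eq_abs, abs_of_pos hδ]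
  have n1 : ‖z.1 - z₀.1‖ ≤ r := (norm_fst_le (z - z₀)).trans hzr
  have n2 : ‖z.2 - z₀.2‖ ≤ r := (norm_snd_le (z - z₀)).trans hzr
  have v1 := norm_fst_le v
  have v2 := norm_snd_le v
  calc _ ≤ δ * (‖v‖ * r + ‖v‖ * r) := by
        gcongr
        refine (norm_add_le _ _).trans ?_
        rw [norm_mul, norm_mul, RCLike.norm_conj, RCLike.norm_conj]
        gcongr
    _ = _ := by ring

theorem HP.tau_zero (H : HP f g d R C c) (hX : Differentiable ℂ X) {ρ : EE → ℂ} (hρ : Moll ρ) {τ : EE → ℂ}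
    (hτ : UL (fun k => TT X (Gc f d) (sc k ρ)) τ) (hτc : Continuous τ) {z₀ : EE} (hz : GG f d z₀ = 0) : τ z₀ = 0 := by
  obtain ⟨B, hB1, hB⟩ := bdd_on_ball hX.continuous (‖z₀‖ + 1)
  obtain ⟨K, hK0, hK⟩ := friedrichs hX hρ (‖z₀‖ + 1)
  have main : ∀ ε > 0, ‖τ z₀‖ ≤ (3 + 2 * B) * ε := by
    intro ε hε
    obtain ⟨r, hr, hr1, hrτ⟩ : ∃ r, 0 < r ∧ r ≤ 1 ∧ ∀ z, ‖z - z₀‖ ≤ r → ‖τ z - τ z₀‖ ≤ ε := by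
      obtain ⟨s, hs, h⟩ := Metric.continuous_iff.mp hτc z₀ ε hε
      refine ⟨min (s/2) 1, by positivity, min_le_right _ _, fun z hz => ?_⟩
      have := h z (by rw [dist_eq_norm]; have := min_le_left (s/2) 1; linarith)
      rw [dist_eq_norm] at this
      exact this.le
    obtain ⟨ω, hω0, hω1, hω2⟩ : ∃ ω, 0 < ω ∧ 2 * ω < ε * r^2 ∧ K * ω ≤ ε := by
      refine ⟨min (ε * r^2/4) (ε/(K+1)), by positivity, ?_, ?_⟩
      · have := min_le_left (ε * r^2/4) (ε/(K+1))
        have : 0 < ε * r^2 := by positivity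
        linarith
      · calc K * min (ε * r^2/4) (ε/(K+1)) ≤ K * (ε/(K+1)) := by gcongr; exact min_le_right _ _
          _ ≤ (K+1) * (ε/(K+1)) := by gcongr; linarith
          _ = ε := by field_simp
    obtain ⟨N1, hN1⟩ := unif_mod (Gc_cont H) (‖z₀‖ + 1) ω hω0
    obtain ⟨N2, hN2⟩ := hτ (‖z₀‖ + 1) ε hε
    obtain ⟨k, hk⟩ : ∃ k, k = max N1 N2 := ⟨_, rfl⟩
    have k1 : N1 ≤ k := hk ▸ le_max_left _ _
    have k2 : N2 ≤ k := hk ▸ le_max_right _ _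
    have nb : ∀ z, ‖z - z₀‖ ≤ r → ‖z‖ ≤ ‖z₀‖ + 1 := fun z hz => by
      have := norm_add_le (z - z₀) z₀
      rw [sub_add_cancel] at this
      linarith
    obtain ⟨z, hzr, hw⟩ := pen_min (G := GG f d) (u := cv (Gc f d) (sc k ρ)) (cv_sm (Gc_cont H) (sc_sm k hρ.sm) (sc_cs k hρ.cs))
      (cv_real hρ k) hr hε hω1 H.GG_nonneg hz (fun z hz => hρ.est k (Gc_cont H) (hN1 k k1 z (nb z hz)))
    have e1 := hK (Gc f d) (Gc_cont H) k z ω (nb z hzr) (hN1 k k1 z (nb z hzr))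
    have e2 := hN2 k k2 z (nb z hzr)
    have e3 := hrτ z hzr
    have e4 := hw (X z)
    rw [← XA_eq] at e4
    have e5 : 2 * ε * r * ‖X z‖ ≤ 2 * B * ε := by
      calc 2 * ε * r * ‖X z‖ ≤ 2 * ε * 1 * B := by gcongr; exact hB z (nb z hzr)
        _ = _ := by ring
    have a1 := norm_sub_norm_le (τ z₀) (τ z)
    have a2 := norm_sub_norm_le (τ z) (TT X (Gc f d) (sc k ρ) z)
    have a3 := norm_sub_norm_le (TT X (Gc f d) (sc k ρ) z) (XA X (cv (Gc f d) (sc k ρ)) z)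
    rw [norm_sub_rev] at a1 a2
    linarith
  rw [← norm_le_zero_iff]
  refine le_of_forall_pos_le_add fun ε hε => ?_
  have := main (ε / (3 + 2 * B)) (by positivity)
  rw [mul_div_cancel₀ _ (by positivity)] at this
  linarith

/-- tl vanishes -/
theorem HP.tl_zero (H : HP f g d R C c) (hX : Differentiable ℂ X) (hH : HH f d X) {z : EE} (hz : Marg R z) : tl f d X z = 0 := by
  obtain ⟨ρ, hρ⟩ := exists_moll
  obtain ⟨τ, h1, h2, h3, h4⟩ := H.exists_tau hX hH hρ
  rw [← h4 z hz]
  exact H.lemma_h (h3 z.2) z.2 (fun x hx => H.tau_zero hX hρ h1 h2 hx) z.1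

end
end

noncomputable section
open MeasureTheory

section
variable {f g X : EE → EE} {d : ℕ} {R C c : ℝ}

theorem HP.hor_false (H : HP f g d R C c) {z : EE} (hz : Vs R z) (hx : 4 * C ≤ ‖z.1‖) (ht : tl f d X z = 0) {j : ℕ}
    (hh : ‖(PV f X j z).2‖ ≤ ‖(PV f X j z).1‖) : PV f X j z = 0 := by
  have C1 := H.F.C1
  have hor : ∀ i, ‖(PV f X (j+i) z).2‖ ≤ ‖(PV f X (j+i) z).1‖ := by
    intro i
    induction i with
    | zero => exact hh
    | succ i ih =>
      rw [← add_assoc, PV_succ H.F.diff]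
      have hv := (H.Viter hz (j+i)).1
      exact H.F.Dh _ hv.1 hv.2 _ ih
  have step : ∀ i, ‖tn f d X (j+i+1) z - tn f d X (j+i) z‖ ≤ (1/2)^i/4 * ‖tn f d X (j+i) z‖ := by
    intro i
    obtain ⟨n, hn⟩ : ∃ n, n = j + i := ⟨_, rfl⟩
    have hi := hor i
    rw [← hn] at hi ⊢
    have hv := (H.Viter hz n).1
    have hl := (H.Viter hz n).2.1
    have D := H.F.Dt _ hv.1 hv.2 (PV f X n z)
    have d2 := H.dpos
    rw [← PV_succ H.F.diff] at D
    have e1 : px f (n+1) z = (f (f^[n] z)).1 := by rw [px, iterate_succ_apply']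
    have e : tn f d X (n+1) z - tn f d X n z = ((1 / (2 * (d : ℝ) ^ (n+1)) : ℝ) : ℂ) *
        ((PV f X (n+1) z).1 / (f (f^[n] z)).1 - d * (PV f X n z).1 / (f^[n] z).1) := by
      have d0 : (d:ℂ) ≠ 0 := by exact_mod_cast d2.ne'
      rw [tn, tn, e1, px]
      push_cast
      field_simp
      ring
    have x0 : 0 < ‖(f^[n] z).1‖ := by have := H.px1 hz n; rw [px] at this; linarith
    have nv : ‖PV f X n z‖ = ‖(PV f X n z).1‖ := by rw [Prod.norm_def, max_eq_left hi]
    rw [e, norm_mul, Complex.norm_real, Real.norm_eq_abs, abs_of_nonneg (by positivity)]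
    rw [tn, norm_mul, Complex.norm_real, Real.norm_eq_abs, abs_of_nonneg (by positivity), norm_div, px]
    rw [nv] at D
    have h2 : C / ‖(f^[n] z).1‖ ≤ (1/2)^i/4 := by
      rw [div_le_iff₀ x0]
      have p1 : (2:ℝ)^i ≤ 2^n := pow_le_pow_right₀ (by norm_num) (by omega)
      have p2 : (2:ℝ)^i * (4 * C) ≤ ‖(f^[n] z).1‖ := le_trans (by gcongr) hl
      have p3 : (1/2:ℝ)^i * 2^i = 1 := by rw [← mul_pow]; norm_num
      calc C = (1/2)^i/4 * (2^i * (4 * C)) := by linear_combination (-C) * p3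
        _ ≤ _ := by gcongr
    have h3 : 1 / (2 * (d:ℝ)^(n+1)) ≤ 1 / (2 * (d:ℝ)^n) := by
      have := H.d2
      gcongr
      · linarith
      · omega
    calc _ ≤ (1 / (2 * (d:ℝ)^n)) * (C * ‖(PV f X n z).1‖ / ‖(f^[n] z).1‖^2) := by gcongr
      _ = (C / ‖(f^[n] z).1‖) * (1 / (2 * (d:ℝ)^n) * (‖(PV f X n z).1‖ / ‖(f^[n] z).1‖)) := by field_simp
      _ ≤ _ := by gcongr
  have low : ∀ i, ‖tn f d X j z‖ * ((1 + (1/2)^i)/2) ≤ ‖tn f d X (j+i) z‖ := by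
    intro i
    induction i with
    | zero => simp
    | succ i ih =>
      have s := step i
      have t := norm_sub_norm_le (tn f d X (j+i) z) (tn f d X (j+i+1) z)
      rw [norm_sub_rev] at t
      have e0 : (0:ℝ) ≤ (1/2)^i := by positivity
      have e1 : (1/2:ℝ)^i ≤ 1 := pow_le_one₀ (by norm_num) (by norm_num)
      rw [← add_assoc, pow_succ]
      obtain ⟨e, he⟩ : ∃ e : ℝ, e = (1/2)^i := ⟨_, rfl⟩
      rw [← he] at ih s e0 e1 ⊢
      have n0 := norm_nonneg (tn f d X j z)
      have b1 : ‖tn f d X (j+i) z‖ * (1 - e/4) ≤ ‖tn f d X (j+i+1) z‖ := by linarith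
      have b2 := mul_le_mul_of_nonneg_right ih (by linarith : 0 ≤ 1 - e/4)
      refine le_trans ?_ (b2.trans b1)
      have b3 : (1 + e * (1/2))/2 ≤ (1 + e)/2 * (1 - e/4) := by nlinarith
      calc _ ≤ ‖tn f d X j z‖ * ((1 + e)/2 * (1 - e/4)) := by gcongr
        _ = _ := by ring
  have lim : ‖tn f d X j z‖ / 2 ≤ ‖tl f d X z‖ := by
    have h1 := (tendsto_add_atTop_iff_nat j).mpr (H.tn_tl (X := X) hz)
    refine ge_of_tendsto' h1.norm fun i => ?_
    rw [add_comm]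
    refine le_trans ?_ (low i)
    have e0 : (0:ℝ) ≤ (1/2)^i := by positivity
    have n0 := norm_nonneg (tn f d X j z)
    nlinarith
  rw [ht, norm_zero] at lim
  have t0 : tn f d X j z = 0 := norm_le_zero_iff.mp (by linarith)
  rw [tn] at t0
  have d2 := H.dpos
  have x1 := H.px1 hz j
  have p0 : px f j z ≠ 0 := norm_pos_iff.mp (by linarith)
  have v1 : (PV f X j z).1 = 0 := by
    rcases mul_eq_zero.mp t0 with h | h
    · have h' : (1 / (2 * (d:ℝ)^j)) = 0 := by exact_mod_cast h
      have : 0 < (1 / (2 * (d:ℝ)^j)) := by positivity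
      linarith
    · exact (div_eq_zero_iff.mp h).resolve_right p0
  have v2 : (PV f X j z).2 = 0 := by
    rw [v1, norm_zero] at hh
    exact norm_le_zero_iff.mp hh
  exact Prod.ext v1 v2

theorem HP.PV_small (H : HP f g d R C c) {z : EE} (hz : Vs R z) (hx : 4 * C ≤ ‖z.1‖) (ht : tl f d X z = 0) (n : ℕ) :
    ‖PV f X n z‖ ≤ (C / ‖z.1‖)^n * ‖X z‖ := by
  have C1 := H.F.C1
  have z0 : 0 < ‖z.1‖ := by linarith
  induction n with
  | zero => simp [PV]
  | succ n ih =>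
    have hv := (H.Viter hz n).1
    have hl := (H.Viter hz n).2.1
    by_cases h : ‖(PV f X (n+1) z).2‖ ≤ ‖(PV f X (n+1) z).1‖
    · rw [H.hor_false hz hx ht h, norm_zero]; positivity
    · have h' := not_le.mp h
      rw [PV_succ H.F.diff] at h' ⊢
      have D := H.F.Dv _ hv.1 hv.2 _ h'
      have hxx : ‖z.1‖ ≤ ‖(f^[n] z).1‖ := le_trans (le_mul_of_one_le_left (norm_nonneg _) (one_le_pow₀ (by norm_num))) hl
      calc _ ≤ C / ‖(f^[n] z).1‖ * ‖PV f X n z‖ := D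
        _ ≤ C / ‖z.1‖ * ((C / ‖z.1‖)^n * ‖X z‖) := by gcongr
        _ = _ := by ring

theorem sw_diff : Differentiable ℂ sw := by unfold sw; fun_prop

theorem HP.gdiff (H : HP f g d R C c) : Differentiable ℂ g := by
  have h := sw_diff.comp (H.G.diff.comp sw_diff)
  have e : (sw ∘ (fun z => sw (g (sw z))) ∘ sw) = g := by
    funext z; simp [sw]
  rwa [e] at h

theorem fderiv_bdd (hf : Differentiable ℂ f) (K : ℝ) : ∃ L : ℝ, 1 ≤ L ∧ ∀ z : EE, ‖z‖ ≤ K → ‖fderiv ℂ f z‖ ≤ L := by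
  have h : ContDiff ℂ (⊤:ℕ∞) f := (contDiff_of_entire hf.fst).prodMk (contDiff_of_entire hf.snd)
  obtain ⟨L, hL⟩ := (isCompact_closedBall (0:EE) K).exists_bound_of_continuousOn (h.continuous_fderiv (by simp)).continuousOn
  exact ⟨max L 1, le_max_right _ _, fun z hz => (hL z (by simpa using hz)).trans (le_max_left _ _)⟩

theorem HP.partD (H : HP f g d R C c) (hX : Differentiable ℂ X) (hne : ∃ z, X z ≠ 0) (hH : HH f d X) : False := by
  have C1 := H.F.C1
  have R1 := H.F.R1
  obtain ⟨z₀, hz0, hXz⟩ : ∃ z₀, GG f d z₀ = 0 ∧ X z₀ ≠ 0 := by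
    by_contra hcon
    push Not at hcon
    obtain ⟨z, hz⟩ := hne
    apply hz
    have l : Differentiable ℂ (fun x : ℂ => ((x, z.2) : EE)) := differentiable_id.prodMk (differentiable_const _)
    refine Prod.ext ?_ ?_
    · exact H.lemma_h (h := fun x => (X (x, z.2)).1) (hX.fst.comp l) z.2 (fun x hx => by simp [hcon _ hx]) z.1
    · exact H.lemma_h (h := fun x => (X (x, z.2)).2) (hX.snd.comp l) z.2 (fun x hx => by simp [hcon _ hx]) z.1
  obtain ⟨L, hL1, hL⟩ := fderiv_bdd H.gdiff (max R ‖z₀‖)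
  have back : ∀ n, ‖X z₀‖ ≤ L^n * ‖PV f X n z₀‖ := by
    intro n
    induction n with
    | zero => simp [PV]
    | succ n ih =>
      have ho := (H.GG_zero_orbit hz0 (n+1)).2
      rw [iterate_succ_apply'] at ho
      have b := hL _ ho
      have hid : g ∘ f = id := by funext z; exact H.gf z
      have hc : fderiv ℂ g (f (f^[n] z₀)) (fderiv ℂ f (f^[n] z₀) (PV f X n z₀)) = PV f X n z₀ := by
        have h1 := fderiv_comp (𝕜 := ℂ) (f^[n] z₀) (H.gdiff (f (f^[n] z₀))) (H.F.diff (f^[n] z₀))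
        rw [hid, fderiv_id] at h1
        have := congrArg (fun T => T (PV f X n z₀)) h1
        simpa using this.symm
      rw [← PV_succ H.F.diff] at hc
      have : ‖PV f X n z₀‖ ≤ L * ‖PV f X (n+1) z₀‖ := by
        rw [← hc]
        refine (ContinuousLinearMap.le_opNorm _ _).trans ?_
        gcongr
      calc ‖X z₀‖ ≤ L^n * ‖PV f X n z₀‖ := ih
        _ ≤ L^n * (L * ‖PV f X (n+1) z₀‖) := by gcongr
        _ = _ := by ring
  obtain ⟨r, hr1, hr2, hr3⟩ : ∃ r, 4 * C ≤ r ∧ 2 * C * L ≤ r ∧ R + 2 + ‖z₀‖ ≤ r :=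
    ⟨max (4 * C) (max (2 * C * L) (R + 2 + ‖z₀‖)), le_max_left _ _, (le_max_left _ _).trans (le_max_right _ _), (le_max_right _ _).trans (le_max_right _ _)⟩
  have r0 : 0 < r := by linarith
  obtain ⟨B, hB1, hB⟩ := bdd_on_ball hX.continuous r
  have z1 : ‖z₀.1‖ ≤ ‖z₀‖ := norm_fst_le z₀
  have z2 : ‖z₀.2‖ ≤ ‖z₀‖ := norm_snd_le z₀
  have small : ∀ n, ‖PV f X n z₀‖ ≤ (C/r)^n * B := by
    intro n
    refine max_x (u := PV f X n) (PV_diff H.F.diff hX n) (y := z₀.2) (x := z₀.1) r0 (fun x hx => ?_) (by linarith)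
    have mg : Marg R (x, z₀.2) := marg_of (by linarith) (by rw [hx]; exact hr3) z2
    have h := H.PV_small (z := (x, z₀.2)) mg.self (by show 4 * C ≤ ‖x‖; rw [hx]; exact hr1) (H.tl_zero hX hH mg) n
    have nb : ‖((x, z₀.2) : EE)‖ ≤ r := by
      rw [Prod.norm_def]; exact max_le hx.le (by simp only []; linarith)
    have hb := hB _ nb
    have h' : ‖PV f X n (x, z₀.2)‖ ≤ (C / ‖x‖)^n * ‖X (x, z₀.2)‖ := h
    rw [hx] at h'
    refine h'.trans ?_
    gcongr
  have fin : ∀ n : ℕ, ‖X z₀‖ ≤ B * (1/2)^n := by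
    intro n
    calc ‖X z₀‖ ≤ L^n * ((C/r)^n * B) := (back n).trans (by gcongr; exact small n)
      _ = (L * (C/r))^n * B := by rw [mul_pow]; ring
      _ ≤ (1/2)^n * B := by
        gcongr
        rw [← mul_div_assoc, div_le_div_iff₀ r0 (by norm_num)]
        linarith
      _ = _ := mul_comm _ _
  have ht : Tendsto (fun n : ℕ => B * (1/2:ℝ)^n) atTop (𝓝 0) := by
    simpa using (tendsto_pow_atTop_nhds_zero_of_lt_one (r := (1/2:ℝ)) (by norm_num) (by norm_num)).const_mul B
  have := ge_of_tendsto' ht fin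
  exact hXz (norm_le_zero_iff.mp this)

end
end

noncomputable section
open MeasureTheory

section
variable {f g X : EE → EE} {d : ℕ} {R C c : ℝ}

def wg (v w : EE) : ℂ := v.1 * w.2 - v.2 * w.1

theorem wg_map (T : EE →L[ℂ] EE) (v w : EE) : wg (T v) (T w) = wg v w * wg (T (1,0)) (T (0,1)) := by
  have h : ∀ v : EE, T v = v.1 • T (1,0) + v.2 • T (0,1) := fun v => by
    conv_lhs => rw [EE_decomp v, map_add, map_smul, map_smul]
  rw [h v, h w]
  simp only [wg, Prod.fst_add, Prod.snd_add, Prod.smul_fst, Prod.smul_snd, smul_eq_mul]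
  ring

theorem wg_map_zero (T : EE →L[ℂ] EE) {v w : EE} (h : wg v w = 0) : wg (T v) (T w) = 0 := by
  rw [wg_map, h, zero_mul]

theorem wg_symm {v w : EE} (h : wg v w = 0) : wg w v = 0 := by
  simp only [wg] at *; linear_combination -h

theorem wg_trans {v w u : EE} (h1 : wg v w = 0) (hw : w ≠ 0) (h2 : wg w u = 0) : wg v u = 0 := by
  simp only [wg] at *
  by_cases h : w.1 = 0
  · have h' : w.2 ≠ 0 := fun h' => hw (Prod.ext h h')
    apply mul_left_cancel₀ h'
    rw [h] at h1 h2
    linear_combination u.2 * h1 + v.2 * h2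
  · apply mul_left_cancel₀ h
    linear_combination v.1 * h2 + u.1 * h1

theorem zero_of_line {φ : EE → ℂ} (hφ : Differentiable ℂ φ) {z₀ : EE} (h : ∀ᶠ z in 𝓝 z₀, φ z = 0) (z : EE) : φ z = 0 := by
  have hl : Differentiable ℂ (fun t : ℂ => z₀ + t • (z - z₀)) := by fun_prop
  have hd : Differentiable ℂ (fun t : ℂ => φ (z₀ + t • (z - z₀))) := hφ.comp hl
  have ha : AnalyticOnNhd ℂ (fun t : ℂ => φ (z₀ + t • (z - z₀))) univ := fun t _ => hd.analyticAt t
  have ht : Tendsto (fun t : ℂ => z₀ + t • (z - z₀)) (𝓝 0) (𝓝 z₀) := by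
    have := hl.continuous.tendsto 0
    simpa using this
  have h0 : (fun t : ℂ => φ (z₀ + t • (z - z₀))) =ᶠ[𝓝 0] fun _ => 0 := ht.eventually h
  have := ha.eq_of_eventuallyEq (analyticOnNhd_const) h0
  have h1 := congrFun this 1
  simpa using h1

theorem dense_ne {Y : EE → EE} (hY : Differentiable ℂ Y) (hne : ∃ z, Y z ≠ 0) : Dense {z | Y z ≠ 0} := by
  by_contra hd
  rw [dense_iff_inter_open] at hd
  push Not at hd
  obtain ⟨U, hU, ⟨z₀, hz₀⟩, h⟩ := hd
  have hz : ∀ z ∈ U, Y z = 0 := fun z hz => by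
    by_contra hc
    have : z ∈ U ∩ {z | Y z ≠ 0} := ⟨hz, hc⟩
    rw [h] at this
    exact this
  obtain ⟨z, hz'⟩ := hne
  apply hz'
  have hev : ∀ᶠ z in 𝓝 z₀, Y z = 0 := by
    filter_upwards [hU.mem_nhds hz₀] with z h using hz z h
  refine Prod.ext (zero_of_line hY.fst (hev.mono fun w hw => by simp [hw]) z) (zero_of_line hY.snd (hev.mono fun w hw => by simp [hw]) z)

theorem zero_of_dense {Y : EE → EE} (hY : Differentiable ℂ Y) (hne : ∃ z, Y z ≠ 0) {φ : EE → ℂ} (hφ : Continuous φ)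
    (h : ∀ z, Y z ≠ 0 → φ z = 0) (z : EE) : φ z = 0 :=
  congrFun (hφ.ext_on (dense_ne hY hne) continuous_const h) z

theorem wg_cont {A B : EE → EE} (hA : Continuous A) (hB : Continuous B) : Continuous (fun z => wg (A z) (B z)) :=
  (hA.fst.mul hB.snd).sub (hA.snd.mul hB.fst)

theorem left_inv_fderiv (hf : Differentiable ℂ f) (hg : Differentiable ℂ g) (hgf : ∀ z, g (f z) = z) (z v : EE) :
    fderiv ℂ g (f z) (fderiv ℂ f z v) = v := by
  have hid : g ∘ f = id := by funext z; exact hgf z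
  have h1 := fderiv_comp (𝕜 := ℂ) z (hg (f z)) (hf z)
  rw [hid, fderiv_id] at h1
  have := congrArg (fun T => T v) h1
  simpa using this.symm

/-- iterated invariance -/
theorem inv_iter (hf : Differentiable ℂ f) (hg : Differentiable ℂ g) (hgf : ∀ z, g (f z) = z) (hfg : ∀ z, f (g z) = z)
    (hX : Differentiable ℂ X) (hne : ∃ z, X z ≠ 0) (hinv : ∀ z, wg (X (f z)) (fderiv ℂ f z (X z)) = 0) (n : ℕ) :
    ∀ z, wg (X (f^[n] z)) (PV f X n z) = 0 := by
  induction n with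
  | zero => intro z; simp [PV, wg]; ring
  | succ n ih =>
    have hd : Differentiable ℂ (fun z => X (f^[n] z)) := hX.comp (hf.iterate n)
    have hs : Surjective (f^[n]) := Surjective.iterate (fun z => ⟨g z, hfg z⟩) n
    refine zero_of_dense (Y := fun z => X (f^[n] z)) hd ?_ (wg_cont (hX.continuous.comp (hf.continuous.iterate (n+1))) (PV_diff hf hX (n+1)).continuous) ?_
    · obtain ⟨z, hz⟩ := hne
      obtain ⟨w, rfl⟩ := hs z
      exact ⟨w, hz⟩
    · intro z hz
      rw [PV_succ hf, iterate_succ_apply']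
      refine wg_trans (hinv (f^[n] z)) ?_ (wg_map_zero _ (ih z))
      intro h0
      apply hz
      have := left_inv_fderiv hf hg hgf (f^[n] z) (X (f^[n] z))
      rw [h0, map_zero] at this
      exact this.symm

theorem sw_iter (g : EE → EE) (n : ℕ) (w : EE) : (fun z => sw (g (sw z)))^[n] w = sw (g^[n] (sw w)) := by
  induction n with
  | zero => rfl
  | succ n ih => rw [iterate_succ_apply', iterate_succ_apply', ih, sw_sw]

def swL : EE →L[ℂ] EE := (ContinuousLinearMap.snd ℂ ℂ ℂ).prod (ContinuousLinearMap.fst ℂ ℂ ℂ)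

theorem sw_hfd (z : EE) : HasFDerivAt sw swL z := swL.hasFDerivAt

theorem PV_sw (hg : Differentiable ℂ g) (n : ℕ) (w : EE) :
    PV (fun z => sw (g (sw z))) (fun z => sw (X (sw z))) n w = sw (PV g X n (sw w)) := by
  have h1 : (fun z => sw (g (sw z)))^[n] = fun w => sw (g^[n] (sw w)) := funext (sw_iter g n)
  rw [PV, h1]
  have h2 := (sw_hfd (g^[n] (sw w))).comp w (((hg.iterate n (sw w)).hasFDerivAt).comp w (sw_hfd w))
  have h3 : fderiv ℂ (fun w => sw (g^[n] (sw w))) w = _ := h2.fderiv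
  rw [h3]
  rfl

theorem main_HP (H : HP f g d R C c) (hX : Differentiable ℂ X) (hne : ∃ z, X z ≠ 0)
    (hinv : ∀ z, wg (X (f z)) (fderiv ℂ f z (X z)) = 0) : False := by
  have hf := H.F.diff
  have hg := H.gdiff
  have hinv' : ∀ z, wg (X (g z)) (fderiv ℂ g z (X z)) = 0 := fun z => by
    have h1 := wg_map_zero (fderiv ℂ g (f (g z))) (hinv (g z))
    rw [left_inv_fderiv hf hg H.gf, H.fg] at h1
    exact wg_symm h1
  have A1 := inv_iter hf hg H.gf H.fg hX hne hinv
  have A2 := inv_iter hg hf H.fg H.gf hX hne hinv'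
  have gfn : ∀ n z, g^[n] (f^[n] z) = z := fun n z => (Function.LeftInverse.iterate H.gf n) z
  have fgn : ∀ n z, f^[n] (g^[n] z) = z := fun n z => (Function.LeftInverse.iterate H.fg n) z
  have W : ∀ n z, wg (PV f X n z) (PV g X n (f^[n] (f^[n] z))) = 0 := by
    intro n
    have hd : Differentiable ℂ (fun z => X (f^[n] z)) := hX.comp (hf.iterate n)
    refine zero_of_dense (Y := fun z => X (f^[n] z)) hd ?_ (wg_cont (PV_diff hf hX n).continuous
      ((PV_diff hg hX n).continuous.comp ((hf.continuous.iterate n).comp (hf.continuous.iterate n)))) ?_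
    · obtain ⟨z, hz⟩ := hne
      exact ⟨g^[n] z, by simpa only [fgn] using hz⟩
    · intro z hz
      have a2 := A2 n (f^[n] (f^[n] z))
      rw [gfn] at a2
      exact wg_trans (wg_symm (A1 n z)) hz a2
  have hY : Differentiable ℂ (fun z => sw (X (sw z))) := sw_diff.comp (hX.comp sw_diff)
  have hYne : ∃ z, sw (X (sw z)) ≠ 0 := by
    obtain ⟨z, hz⟩ := hne
    refine ⟨sw z, fun h => hz ?_⟩
    rw [sw_sw] at h
    have := congrArg sw h
    rw [sw_sw] at this
    exact this
  rcases partC H H.symm hX hY (fun n z w h => by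
    rw [sw_iter, sw_sw] at h
    rw [PV_sw hg]
    have hw : sw w = f^[n] (f^[n] z) := by rw [h, fgn]
    have := W n z
    rw [hw]
    simp only [wg] at this
    simp only [sw]
    linear_combination -this) with h | h
  · exact H.partD hX hne h
  · exact H.symm.partD hY hYne h

theorem poly_diff {F : EE → EE} (h : IsPolyMap F) : Differentiable ℂ F := by
  obtain ⟨P, Q, h⟩ := h
  have key : ∀ P : MvPolynomial (Fin 2) ℂ, Differentiable ℂ (fun z : EE => MvPolynomial.eval ![z.1, z.2] P) := by
    intro P
    induction P using MvPolynomial.induction_on with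
    | C a => simp
    | add p q hp hq => simpa using hp.fun_add hq
    | mul_X p i hp =>
      have : Differentiable ℂ (fun z : EE => (![z.1, z.2] : Fin 2 → ℂ) i) := by
        fin_cases i
        · exact differentiable_fst
        · exact differentiable_snd
      simpa using hp.fun_mul this
  have e : F = fun z => (MvPolynomial.eval ![z.1, z.2] P, MvPolynomial.eval ![z.1, z.2] Q) := funext h
  rw [e]
  exact (key P).prodMk (key Q)

end
end

/-- a loxodromic automorphism of `ℂ²` does not preserve any global singular
holomorphic foliation; equivalently, there is no holomorphic `1`-form `ω = a dx + b dy`,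
with `a, b` entire and not both identically zero, satisfying `f*ω ∧ ω ≡ 0`. -/
theorem no_invariant_global_holomorphic_foliation (f : ℂ × ℂ → ℂ × ℂ)
    (hf : IsLoxodromic f) :
    ¬ ∃ a b : ℂ × ℂ → ℂ, Differentiable ℂ a ∧ Differentiable ℂ b ∧
        (¬ ∀ z : ℂ × ℂ, a z = 0 ∧ b z = 0) ∧
        ∀ z : ℂ × ℂ,
          b z * (a (f z) * (fderiv ℂ f z (1, 0)).1 + b (f z) * (fderiv ℂ f z (1, 0)).2) =
          a z * (a (f z) * (fderiv ℂ f z (0, 1)).1 + b (f z) * (fderiv ℂ f z (0, 1)).2) := by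
  rintro ⟨a, b, ha, hb, hne, hinv⟩
  obtain ⟨hfp, u, uinv, hs, hu, hu1, hu2, hs0, hsh, hfu⟩ := hf
  obtain ⟨g, d, R, C, c, H⟩ := list_HP hs hs0 hsh
  obtain ⟨h, hh⟩ : ∃ h : EE → EE, h = hs.foldr (fun h acc => h ∘ acc) id := ⟨_, rfl⟩
  rw [← hh] at H hfu
  have du : Differentiable ℂ u := poly_diff hu.1
  have df : Differentiable ℂ f := poly_diff hfp.1
  have dui : Differentiable ℂ uinv := by
    obtain ⟨_, G, hG, hG1, hG2⟩ := hu
    have : uinv = G := by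
      funext z
      have := hG1 (uinv z)
      rw [hu2] at this
      exact this.symm
    rw [this]; exact poly_diff hG
  obtain ⟨X, hXd⟩ : ∃ X : EE → EE, X = fun z => (b z, -a z) := ⟨_, rfl⟩
  have dX : Differentiable ℂ X := by rw [hXd]; exact hb.prodMk ha.neg
  have hXne : ∃ z, X z ≠ 0 := by
    by_contra hcon
    push Not at hcon
    apply hne
    intro z
    have h1 := hcon z
    rw [hXd] at h1
    have := Prod.mk_eq_zero.mp h1
    exact ⟨neg_eq_zero.mp this.2, this.1⟩
  have Xinv : ∀ z, wg (X (f z)) (fderiv ℂ f z (X z)) = 0 := by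
    intro z
    have hl : fderiv ℂ f z (X z) = (X z).1 • fderiv ℂ f z (1,0) + (X z).2 • fderiv ℂ f z (0,1) := by
      conv_lhs => rw [EE_decomp (X z), map_add, map_smul, map_smul]
    have := hinv z
    rw [hl, hXd]
    simp only [wg, Prod.fst_add, Prod.snd_add, Prod.smul_fst, Prod.smul_snd, smul_eq_mul]
    linear_combination this
  obtain ⟨X', hX'⟩ : ∃ X' : EE → EE, X' = fun z => fderiv ℂ u (uinv z) (X (uinv z)) := ⟨_, rfl⟩
  have dX' : Differentiable ℂ X' := by
    have := (PV_diff du dX 1).comp dui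
    rw [hX']
    exact this
  refine main_HP H dX' ?_ ?_
  · obtain ⟨z, hz⟩ := hXne
    refine ⟨u z, fun h0 => hz ?_⟩
    rw [hX'] at h0
    have h1 : fderiv ℂ u z (X z) = 0 := by simpa only [hu1] using h0
    have := left_inv_fderiv du dui hu1 z (X z)
    rw [h1, map_zero] at this
    exact this.symm
  · intro ζ
    obtain ⟨z, rfl⟩ : ∃ z, u z = ζ := ⟨uinv ζ, hu2 ζ⟩
    have e1 : h (u z) = u (f z) := by rw [hfu, hu2]
    rw [e1, hX']
    simp only [hu1]
    have e2 : fderiv ℂ h (u z) (fderiv ℂ u z (X z)) = fderiv ℂ u (f z) (fderiv ℂ f z (X z)) := by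
      have c1 := fderiv_comp (𝕜 := ℂ) z (H.F.diff (u z)) (du z)
      have c2 := fderiv_comp (𝕜 := ℂ) z (du (f z)) (df z)
      have e3 : h ∘ u = u ∘ f := by
        funext z
        show h (u z) = u (f z)
        rw [hfu, hu2]
      rw [e3, c2] at c1
      have := congrArg (fun T => T (X z)) c1
      exact this.symm
    rw [e2]
    exact wg_map_zero _ (Xinv z)
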